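/- Let (𝒫, 𝒩) be a Beurling generalized number system with θ-well-behaved integers (N(x) = Ax + O(x^θ), A > 0, θ ∈ [0,1)) whose zeta function has no zeros in the region σ > 1 − d (log log t)/(log t) for some d > 0 and all t > t₀ ≥ e². Then for every λ > 1 − (1−θ)d/(4d + 9(1−θ)) and every constant c₀ > 0: ψ(x+h) − ψ(x) ∼ h as x → ∞, uniformly for h ≥ c₀ x^λ. -/

import Mathlib

open Filter Topology

/-- A Beurling generalized prime number system: a nondecreasing sequence of
generalized primes, each `> 1`, tending to infinity. -/
structure BeurlingSystem where
  p : ℕ → ℝ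
  one_lt_p : ∀ k, 1 < p k
  p_mono : Monotone p
  p_tendsto : Filter.Tendsto p Filter.atTop Filter.atTop

namespace BeurlingSystem

variable (S : BeurlingSystem)

/-- The numerical value of a generalized integer, encoded as the finitely supported
vector of exponents of the generalized primes. -/
noncomputable def val (n : ℕ →₀ ℕ) : ℝ := n.prod fun k e => S.p k ^ e

/-- The integer counting function `N(x)`. -/
noncomputable def cnt (x : ℝ) : ℝ := (Set.ncard {n : ℕ →₀ ℕ | S.val n ≤ x} : ℝ)

/-- `χ(x, λ)`: the number of generalized integers within distance `λ` of `x`. -/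
noncomputable def chi (x lam : ℝ) : ℝ := (Set.ncard {n : ℕ →₀ ℕ | |x - S.val n| ≤ lam} : ℝ)

/-- The integers are `θ`-well-behaved with density `A` and implied constant `K₀`:
`N(x) = A x + O(x^θ)`. -/
def WellBehaved (A θ K₀ : ℝ) : Prop :=
  0 < A ∧ 0 ≤ θ ∧ θ < 1 ∧ 0 ≤ K₀ ∧ ∀ x : ℝ, 1 ≤ x → |S.cnt x - A * x| ≤ K₀ * x ^ θ

/-- `ζ` is (the unique) analytic continuation of the Beurling zeta function
to `{Re s > θ} \ {1}`. -/
def IsZeta (θ : ℝ) (ζ : ℂ → ℂ) : Prop :=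
  DifferentiableOn ℂ ζ {s : ℂ | θ < s.re ∧ s ≠ 1} ∧
  ∀ s : ℂ, 1 < s.re → ζ s = ∑' n : ℕ →₀ ℕ, (S.val n : ℂ) ^ (-s)

/-- The von Mangoldt function: `log p` on prime powers `p^m`, `0` otherwise. -/
noncomputable def vonMangoldt (n : ℕ →₀ ℕ) : ℝ :=
  ∑ k ∈ n.support, if n.support = {k} then Real.log (S.p k) else 0

/-- The Chebyshev function `ψ(x)`. -/
noncomputable def psi (x : ℝ) : ℝ :=
  ∑ᶠ n ∈ {n : ℕ →₀ ℕ | S.val n ≤ x}, S.vonMangoldt n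

end BeurlingSystem

/-- The generalized divisor function: the number of ordered pairs of generalized
integers whose formal product equals `n`. -/
noncomputable def gDivisor (n : ℕ →₀ ℕ) : ℝ :=
  (Set.ncard {q : (ℕ →₀ ℕ) × (ℕ →₀ ℕ) | q.1 + q.2 = n} : ℝ)

/-- The generalized Möbius function. -/
noncomputable def gMoebius (n : ℕ →₀ ℕ) : ℝ :=
  if ∀ k ∈ n.support, n k ≤ 1 then (-1 : ℝ) ^ n.support.card else 0

/-- The zero-counting function `N(α, T)` of the (continued) zeta function. -/
noncomputable def zeroCount (ζ : ℂ → ℂ) (α T : ℝ) : ℝ :=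
  (Set.ncard {ρ : ℂ | ζ ρ = 0 ∧ ρ ≠ 1 ∧ α ≤ ρ.re ∧ |ρ.im| ≤ T} : ℝ)

namespace BeurlingSystem

variable (S : BeurlingSystem)

lemma p_pos (k : ℕ) : 0 < S.p k := zero_lt_one.trans (S.one_lt_p k)

@[simp] lemma val_zero : S.val 0 = 1 := by simp [val]

lemma val_add (m n : ℕ →₀ ℕ) : S.val (m + n) = S.val m * S.val n :=
  Finsupp.prod_add_index' (by simp) (by intros; exact pow_add _ _ _)

lemma val_single (k e : ℕ) : S.val (Finsupp.single k e) = S.p k ^ e := by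
  simp [val]

lemma one_le_val (n : ℕ →₀ ℕ) : 1 ≤ S.val n := by
  unfold val Finsupp.prod
  refine Finset.prod_induction _ (fun x => (1 : ℝ) ≤ x) ?_ le_rfl ?_
  · intro a b ha hb
    exact one_le_mul_of_one_le_of_one_le ha hb
  · intro k _
    exact one_le_pow₀ (S.one_lt_p k).le

lemma val_pos (n : ℕ →₀ ℕ) : 0 < S.val n := zero_lt_one.trans_le (S.one_le_val n)

lemma pow_le_val (n : ℕ →₀ ℕ) (k : ℕ) : S.p k ^ n k ≤ S.val n := by
  conv_rhs => rw [← Finsupp.single_add_erase k n, val_add, val_single]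
  exact le_mul_of_one_le_right (pow_nonneg (S.p_pos k).le _) (S.one_le_val _)

lemma val_mono {m n : ℕ →₀ ℕ} (h : m ≤ n) : S.val m ≤ S.val n := by
  obtain ⟨c, rfl⟩ := exists_add_of_le h
  rw [val_add]
  exact le_mul_of_one_le_right (S.val_pos m).le (S.one_le_val c)

lemma finite_val_le (x : ℝ) : {n : ℕ →₀ ℕ | S.val n ≤ x}.Finite := by
  obtain ⟨K, hK⟩ := (S.p_tendsto.eventually_gt_atTop x).exists_forall_of_atTop
  obtain ⟨e, he⟩ := pow_unbounded_of_one_lt x (S.one_lt_p 0)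
  refine (Set.finite_Iic (∑ k ∈ Finset.range K, Finsupp.single k e)).subset ?_
  intro n hn
  rw [Set.mem_ofPred_eq] at hn
  rw [Set.mem_Iic, Finsupp.le_def]
  intro k
  rcases Nat.eq_zero_or_pos (n k) with h0 | h0
  · rw [h0]; exact Nat.zero_le _
  have h1 : S.p k ^ n k ≤ x := (S.pow_le_val n k).trans hn
  have hkK : k < K := by
    by_contra hcon
    have h2 := hK k (not_lt.1 hcon)
    have h3 : S.p k ≤ S.p k ^ n k := le_self_pow₀ (S.one_lt_p k).le h0.ne'
    linarith
  have hne : n k ≤ e := by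
    by_contra hcon
    have h2 : S.p 0 ^ e ≤ S.p k ^ n k :=
      (pow_le_pow_left₀ (S.p_pos 0).le (S.p_mono (Nat.zero_le k)) e).trans
        (pow_le_pow_right₀ (S.one_lt_p k).le (not_le.1 hcon).le)
    linarith
  rw [Finsupp.finsetSum_apply, Finset.sum_eq_single k]
  · simpa using hne
  · intro b _ hb
    simp [hb]
  · intro h
    exact absurd (Finset.mem_range.2 hkK) h

/-- The finite set of generalized integers with value at most `x`. -/
noncomputable def below (x : ℝ) : Finset (ℕ →₀ ℕ) := (S.finite_val_le x).toFinset

@[simp] lemma mem_below {x : ℝ} {n : ℕ →₀ ℕ} : n ∈ S.below x ↔ S.val n ≤ x := by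
  simp [below]

lemma below_mono {x y : ℝ} (h : x ≤ y) : S.below x ⊆ S.below y := fun n hn => by
  rw [mem_below] at *
  exact hn.trans h

lemma cnt_eq_card (x : ℝ) : S.cnt x = (S.below x).card := by
  rw [cnt, below, Set.ncard_eq_toFinset_card _ (S.finite_val_le x)]

lemma cnt_mono : Monotone S.cnt := fun x y h => by
  rw [cnt_eq_card, cnt_eq_card]
  exact_mod_cast Finset.card_le_card (S.below_mono h)

lemma cnt_nonneg (x : ℝ) : 0 ≤ S.cnt x := by
  rw [cnt_eq_card]; positivity

/-- The error term in the counting function of the generalized integers. -/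
noncomputable def err (A x : ℝ) : ℝ := S.cnt x - A * x

lemma measurable_err (A : ℝ) : Measurable (S.err A) :=
  S.cnt_mono.measurable.sub (measurable_const.mul measurable_id)

variable {S} {A θ K₀ : ℝ}

lemma WellBehaved.cnt_le (h : S.WellBehaved A θ K₀) {x : ℝ} (hx : 1 ≤ x) :
    S.cnt x ≤ (A + K₀) * x := by
  obtain ⟨hA, hθ, hθ1, hK, H⟩ := h
  have h1 := (abs_le.1 (H x hx)).2
  have h2 : x ^ θ ≤ x := by
    simpa using Real.rpow_le_rpow_of_exponent_le hx hθ1.le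
  nlinarith

lemma WellBehaved.abs_err_le (h : S.WellBehaved A θ K₀) {x : ℝ} (hx : 1 ≤ x) :
    |S.err A x| ≤ K₀ * x ^ θ := h.2.2.2.2 x hx

lemma WellBehaved.le_cnt (h : S.WellBehaved A θ K₀) {x y : ℝ} (hxy : x ≤ y) (hy : 1 ≤ y) :
    A * x - (A + K₀) * y ^ θ ≤ S.cnt x := by
  obtain ⟨hA, hθ, hθ1, hK, H⟩ := h
  have hy1 : 1 ≤ y ^ θ := Real.one_le_rpow hy hθ
  rcases le_or_gt 1 x with h1 | h1
  · have h2 := (abs_le.1 (H x h1)).1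
    have h3 : x ^ θ ≤ y ^ θ := Real.rpow_le_rpow (by linarith) hxy hθ
    nlinarith
  · have := S.cnt_nonneg x
    nlinarith

/-- The number of generalized integers in a short logarithmic interval. -/
lemma WellBehaved.card_near_le (h : S.WellBehaved A θ K₀) (F : Finset (ℕ →₀ ℕ)) {δ : ℝ}
    (hδ : 0 < δ) (hδ1 : δ ≤ 2) (n : ℕ →₀ ℕ) :
    ((F.filter fun m => |Real.log (S.val m) - Real.log (S.val n)| ≤ δ).card : ℝ) ≤
      3 * Real.exp 2 * (2 * A + 2 * K₀) * (S.val n * δ + S.val n ^ θ) := by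
  classical
  set v := S.val n with hv
  have hv1 : 1 ≤ v := S.one_le_val n
  have hsub : F.filter (fun m => |Real.log (S.val m) - Real.log v| ≤ δ) ⊆
      S.below (v * Real.exp δ) \ S.below (v * Real.exp (-(2 * δ))) := by
    intro m hm
    rw [Finset.mem_filter] at hm
    obtain ⟨h1, h2⟩ := abs_le.1 hm.2
    rw [Finset.mem_sdiff, mem_below, mem_below, not_le]
    have e1 : S.val m = Real.exp (Real.log (S.val m)) := (Real.exp_log (S.val_pos m)).symm
    have e2 : v = Real.exp (Real.log v) := (Real.exp_log (by linarith)).symm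
    constructor
    · rw [e1]
      conv_rhs => rw [e2]
      rw [← Real.exp_add, Real.exp_le_exp]
      linarith
    · rw [e1]
      conv_lhs => rw [e2]
      rw [← Real.exp_add, Real.exp_lt_exp]
      linarith
  have hc := Finset.card_le_card hsub
  have hle : v * Real.exp (-(2 * δ)) ≤ v * Real.exp δ :=
    mul_le_mul_of_nonneg_left (Real.exp_le_exp.2 (by linarith)) (by linarith)
  rw [Finset.card_sdiff_of_subset (S.below_mono hle)] at hc
  have hc2 : ((F.filter fun m => |Real.log (S.val m) - Real.log v| ≤ δ).card : ℝ) ≤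
      S.cnt (v * Real.exp δ) - S.cnt (v * Real.exp (-(2 * δ))) := by
    rw [cnt_eq_card, cnt_eq_card, ← Nat.cast_sub (Finset.card_le_card (S.below_mono hle))]
    exact_mod_cast hc
  have hy1 : 1 ≤ v * Real.exp δ := by
    have := Real.one_le_exp hδ.le
    nlinarith
  have hl := h.le_cnt hle hy1
  obtain ⟨hA, hθ, hθ1, hK, H⟩ := h
  have hu := (abs_le.1 (H _ hy1)).2
  have hp : (v * Real.exp δ) ^ θ ≤ v ^ θ * Real.exp 2 := by
    rw [Real.mul_rpow (by linarith) (Real.exp_pos _).le, ← Real.exp_mul]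
    refine mul_le_mul_of_nonneg_left (Real.exp_le_exp.2 ?_) (by positivity)
    nlinarith
  have he : Real.exp δ - Real.exp (-(2 * δ)) ≤ 3 * δ * Real.exp 2 := by
    have h1 : Real.exp (-(2 * δ)) = Real.exp δ * Real.exp (-(3 * δ)) := by
      rw [← Real.exp_add]; congr 1; ring
    have h2 : 1 - 3 * δ ≤ Real.exp (-(3 * δ)) := by
      have := Real.add_one_le_exp (-(3 * δ)); linarith
    have h3 : Real.exp δ ≤ Real.exp 2 := Real.exp_le_exp.2 hδ1
    have h4 := Real.exp_pos δ
    rw [h1]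
    nlinarith
  have hve : A * (v * Real.exp δ) - A * (v * Real.exp (-(2 * δ))) ≤
      A * v * (3 * δ * Real.exp 2) := by
    have : 0 ≤ A * v := by positivity
    nlinarith
  have hE := Real.exp_pos 2
  have hvθ : 0 ≤ v ^ θ := by positivity
  have h5 : (A + 2 * K₀) * (v * Real.exp δ) ^ θ ≤ (A + 2 * K₀) * (v ^ θ * Real.exp 2) :=
    mul_le_mul_of_nonneg_left hp (by positivity)
  have h6 : 0 ≤ Real.exp 2 * v ^ θ * A := by positivity
  have h7 : 0 ≤ Real.exp 2 * v ^ θ * K₀ := by positivity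
  have h8 : 0 ≤ Real.exp 2 * (v * δ) * A := by positivity
  have h9 : 0 ≤ Real.exp 2 * (v * δ) * K₀ := by positivity
  nlinarith

end BeurlingSystem

namespace BeurlingSystem
open MeasureTheory Set

variable {S : BeurlingSystem} {A θ K₀ : ℝ}

lemma integral_tail_rpow {σ v : ℝ} (hσ : 0 < σ) (hv : 0 < v) :
    ∫ u in Ioi v, u ^ (-σ - 1) = v ^ (-σ) / σ := by
  rw [integral_Ioi_rpow_of_lt (by linarith) hv]
  rw [show -σ - 1 + 1 = -σ by ring, div_neg, neg_div, neg_neg]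

lemma integral_tail_cpow {s : ℂ} {v : ℝ} (hs : 0 < s.re) (hv : 0 < v) :
    ∫ u in Ioi v, (u : ℂ) ^ (-s - 1) = (v : ℂ) ^ (-s) / s := by
  rw [integral_Ioi_cpow_of_lt (by simp; linarith) hv]
  rw [show -s - 1 + 1 = -s by ring, div_neg, neg_div, neg_neg]

lemma integral_indicator_tail {E : Type*} [NormedAddCommGroup E] [NormedSpace ℝ E] {N v : ℝ}
    (h : N ≤ v) (f : ℝ → E) :
    ∫ u in Ioi N, (Ioi v).indicator f u = ∫ u in Ioi v, f u := by
  rw [setIntegral_indicator measurableSet_Ioi, Ioi_inter_Ioi, sup_eq_right.2 h]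

lemma WellBehaved.sum_rpow_le (h : S.WellBehaved A θ K₀) {σ : ℝ} (hσ : 1 < σ)
    (F : Finset (ℕ →₀ ℕ)) :
    ∑ n ∈ F, S.val n ^ (-σ) ≤ (A + K₀) * σ / (σ - 1) := by
  have hAK : 0 ≤ A + K₀ := add_nonneg h.1.le h.2.2.2.1
  have e1 : ∀ n, S.val n ^ (-σ) = ∫ u in Ioi (1 : ℝ),
      (Ioi (S.val n)).indicator (fun u => σ * u ^ (-σ - 1)) u := by
    intro n
    rw [integral_indicator_tail (S.one_le_val n), integral_const_mul,
      integral_tail_rpow (by linarith) (S.val_pos n)]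
    field_simp
  have hInt : IntegrableOn (fun u : ℝ => u ^ (-σ - 1)) (Ioi 1) :=
    integrableOn_Ioi_rpow_of_lt (by linarith) one_pos
  have hInt2 : IntegrableOn (fun u : ℝ => (A + K₀) * (σ * u ^ (-(σ - 1) - 1))) (Ioi 1) :=
    ((integrableOn_Ioi_rpow_of_lt (by linarith) one_pos).const_mul _).const_mul _
  simp_rw [e1]
  rw [← integral_finsetSum]
  · calc _ ≤ ∫ u in Ioi (1 : ℝ), (A + K₀) * (σ * u ^ (-(σ - 1) - 1)) := by
          refine setIntegral_mono_on ?_ hInt2 measurableSet_Ioi ?_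
          · refine integrable_finsetSum _ fun n _ => ?_
            exact (hInt.const_mul σ).indicator measurableSet_Ioi
          · intro u hu
            have hu1 : (1 : ℝ) < u := hu
            have hu0 : 0 ≤ u ^ (-σ - 1) := by positivity
            have h1 : ∑ n ∈ F, (Ioi (S.val n)).indicator (fun u => σ * u ^ (-σ - 1)) u
                ≤ ∑ n ∈ S.below u, σ * u ^ (-σ - 1) := by
              rw [← Finset.sum_filter_add_sum_filter_not F (fun n => S.val n ≤ u)]
              have h2 : ∑ n ∈ F.filter (fun n => ¬ S.val n ≤ u),
                  (Ioi (S.val n)).indicator (fun u => σ * u ^ (-σ - 1)) u = 0 := by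
                refine Finset.sum_eq_zero fun n hn => ?_
                rw [Finset.mem_filter] at hn
                exact indicator_of_notMem (fun h => hn.2 (le_of_lt h)) _
              rw [h2, add_zero]
              refine (Finset.sum_le_sum (g := fun _ => σ * u ^ (-σ - 1)) fun n _ => ?_).trans ?_
              · rw [indicator_apply]
                split_ifs
                · exact le_rfl
                · positivity
              · refine Finset.sum_le_sum_of_subset_of_nonneg ?_ fun _ _ _ => by positivity
                intro n hn
                rw [Finset.mem_filter] at hn
                exact (S.mem_below).2 hn.2
            refine h1.trans ?_
            rw [Finset.sum_const, nsmul_eq_mul, ← cnt_eq_card]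
            have h3 := h.cnt_le hu1.le
            have h4 : u ^ (-(σ - 1) - 1) = u * u ^ (-σ - 1) := by
              rw [show -(σ - 1) - 1 = 1 + (-σ - 1) by ring, Real.rpow_add (by linarith),
                Real.rpow_one]
            rw [h4]
            calc _ ≤ ((A + K₀) * u) * (σ * u ^ (-σ - 1)) :=
                  mul_le_mul_of_nonneg_right h3 (by positivity)
              _ = _ := by ring
      _ = _ := by
          rw [integral_const_mul, integral_const_mul, integral_tail_rpow (by linarith) one_pos,
            Real.one_rpow]
          ring
  · intro n _
    exact (hInt.const_mul σ).indicator measurableSet_Ioi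

lemma WellBehaved.summable_rpow (h : S.WellBehaved A θ K₀) {σ : ℝ} (hσ : 1 < σ) :
    Summable fun n => S.val n ^ (-σ) :=
  summable_of_sum_le (fun n => Real.rpow_nonneg (S.val_pos n).le _) (h.sum_rpow_le hσ)

lemma WellBehaved.tsum_rpow_le (h : S.WellBehaved A θ K₀) {σ : ℝ} (hσ : 1 < σ) :
    ∑' n, S.val n ^ (-σ) ≤ (A + K₀) * σ / (σ - 1) :=
  (h.summable_rpow hσ).tsum_le_of_sum_le (h.sum_rpow_le hσ)

lemma norm_val_cpow (n : ℕ →₀ ℕ) (s : ℂ) : ‖(S.val n : ℂ) ^ (-s)‖ = S.val n ^ (-s.re) := by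
  rw [Complex.norm_cpow_eq_rpow_re_of_pos (S.val_pos n), Complex.neg_re]

/-- Abel summation for the tail of the Dirichlet series. -/
lemma WellBehaved.hasSum_tail (h : S.WellBehaved A θ K₀) {s : ℂ} (hs : 1 < s.re) {N : ℝ}
    (hN : 1 ≤ N) :
    HasSum (fun n => if S.val n ≤ N then 0 else (S.val n : ℂ) ^ (-s))
      (s * ∫ u in Ioi N, ((S.cnt u - S.cnt N : ℝ) : ℂ) * (u : ℂ) ^ (-s - 1)) := by
  have hs0 : s ≠ 0 := by rintro rfl; simp at hs; linarith
  have hN0 : 0 < N := by linarith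
  set F : (ℕ →₀ ℕ) → ℝ → ℂ := fun n u =>
    if S.val n ≤ N then 0 else (Ioi (S.val n)).indicator (fun u : ℝ => (u : ℂ) ^ (-s - 1)) u with hF
  have hi : ∀ n, IntegrableOn (F n) (Ioi N) := by
    intro n
    simp only [hF]
    split_ifs
    · exact integrableOn_zero
    · exact (integrableOn_Ioi_cpow_of_lt (by simp; linarith) hN0).indicator measurableSet_Ioi
  have hnorm : ∀ n, ∫ u in Ioi N, ‖F n u‖ ≤ S.val n ^ (-s.re) / s.re := by
    intro n
    simp only [hF]
    split_ifs with hn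
    · simp only [norm_zero, integral_zero]
      exact div_nonneg (Real.rpow_nonneg (S.val_pos n).le _) (by linarith)
    · simp_rw [norm_indicator_eq_indicator_norm]
      rw [integral_indicator_tail (not_le.1 hn).le, ← integral_tail_rpow (by linarith) (S.val_pos n)]
      refine le_of_eq (setIntegral_congr_fun measurableSet_Ioi fun u hu => ?_)
      have : 0 < u := (S.val_pos n).trans hu
      rw [Complex.norm_cpow_eq_rpow_re_of_pos this]
      simp
  have hval : ∀ n, ∫ u in Ioi N, F n u = (if S.val n ≤ N then 0 else (S.val n : ℂ) ^ (-s)) / s := by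
    intro n
    simp only [hF]
    split_ifs with hn
    · simp
    · rw [integral_indicator_tail (not_le.1 hn).le, integral_tail_cpow (by linarith) (S.val_pos n)]
  have key := hasSum_integral_of_summable_integral_norm hi
    (Summable.of_nonneg_of_le (fun n => integral_nonneg fun u => norm_nonneg _) hnorm
      ((h.summable_rpow hs).div_const _))
  simp_rw [hval] at key
  have key2 := key.mul_left s
  have e1 : (fun n => s * ((if S.val n ≤ N then 0 else (S.val n : ℂ) ^ (-s)) / s)) =
      fun n => if S.val n ≤ N then 0 else (S.val n : ℂ) ^ (-s) := by
    funext n; field_simp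
  rw [e1] at key2
  have hmem : ∀ u : ℝ, N < u → ∑' n, F n u =
      ((S.cnt u - S.cnt N : ℝ) : ℂ) * (u : ℂ) ^ (-s - 1) ∨ ∃ n, S.val n = u := by
    intro u hu
    by_cases hex : ∃ n, S.val n = u
    · exact Or.inr hex
    left
    rw [tsum_eq_sum (s := S.below u \ S.below N)]
    · rw [Finset.sum_congr rfl (g := fun _ => (u : ℂ) ^ (-s - 1))]
      · rw [Finset.sum_const, nsmul_eq_mul, Finset.card_sdiff_of_subset (S.below_mono hu.le),
          Nat.cast_sub (Finset.card_le_card (S.below_mono hu.le)), cnt_eq_card, cnt_eq_card]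
        push_cast
        rfl
      · intro n hn
        rw [Finset.mem_sdiff, mem_below, mem_below] at hn
        simp only [hF]
        rw [if_neg hn.2, indicator_of_mem]
        exact lt_of_le_of_ne hn.1 fun h => hex ⟨n, h⟩
    · intro n hn
      rw [Finset.mem_sdiff, mem_below, mem_below] at hn
      simp only [hF]
      split_ifs with h1
      · rfl
      · rw [indicator_of_notMem]
        intro h2
        exact hn ⟨le_of_lt (show S.val n < u from h2), h1⟩
  have hcount : (range S.val).Countable := countable_range _
  suffices hI : ∫ u in Ioi N, ((S.cnt u - S.cnt N : ℝ) : ℂ) * (u : ℂ) ^ (-s - 1) =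
      ∫ u in Ioi N, ∑' n, F n u by
    rw [hI]
    exact key2
  refine setIntegral_congr_ae (μ := volume) measurableSet_Ioi ?_
  filter_upwards [hcount.ae_notMem volume] with u hu huN
  rcases hmem u huN with h1 | ⟨n, h1⟩
  · exact h1.symm
  · exact absurd ⟨n, h1⟩ hu

/-- The Mellin-type integral of the error term over `(N, ∞)`. -/
noncomputable def errInt (S : BeurlingSystem) (A N : ℝ) (s : ℂ) : ℂ :=
  ∫ u in Ioi N, (S.err A u : ℂ) * (u : ℂ) ^ (-s - 1)

lemma WellBehaved.integrableOn_err (h : S.WellBehaved A θ K₀) {s : ℂ} (hs : θ < s.re) {N : ℝ}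
    (hN : 1 ≤ N) : IntegrableOn (fun u : ℝ => (S.err A u : ℂ) * (u : ℂ) ^ (-s - 1)) (Ioi N) := by
  have hb : IntegrableOn (fun u : ℝ => K₀ * u ^ (-(s.re - θ) - 1)) (Ioi N) :=
    (integrableOn_Ioi_rpow_of_lt (by linarith) (by linarith)).const_mul _
  refine Integrable.mono' hb ?_ ?_
  · refine AEStronglyMeasurable.mul ?_ ?_
    · exact (Complex.measurable_ofReal.comp (S.measurable_err A)).aestronglyMeasurable
    · refine ContinuousOn.aestronglyMeasurable ?_ measurableSet_Ioi
      intro u hu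
      have hu0 : 0 < u := by
        have : N < u := hu
        linarith
      exact (Complex.continuousAt_ofReal_cpow_const u _ (Or.inr hu0.ne')).continuousWithinAt
  · refine (ae_restrict_iff' measurableSet_Ioi).2 (ae_of_all _ fun u hu => ?_)
    have hu1 : N < u := hu
    have hu0 : 0 < u := by linarith
    rw [norm_mul, Complex.norm_cpow_eq_rpow_re_of_pos hu0, Complex.norm_real, Real.norm_eq_abs]
    calc _ ≤ (K₀ * u ^ θ) * u ^ (-s - 1).re :=
          mul_le_mul_of_nonneg_right (h.abs_err_le (by linarith)) (by positivity)
      _ = _ := by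
          rw [mul_assoc, ← Real.rpow_add hu0]
          congr 2
          simp; ring

lemma WellBehaved.norm_errInt_le (h : S.WellBehaved A θ K₀) {s : ℂ} (hs : θ < s.re) {N : ℝ}
    (hN : 1 ≤ N) : ‖S.errInt A N s‖ ≤ K₀ * N ^ (-(s.re - θ)) / (s.re - θ) := by
  have hb : IntegrableOn (fun u : ℝ => K₀ * u ^ (-(s.re - θ) - 1)) (Ioi N) :=
    (integrableOn_Ioi_rpow_of_lt (by linarith) (by linarith)).const_mul _
  rw [mul_div_assoc, ← integral_tail_rpow (by linarith) (by linarith), ← integral_const_mul]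
  refine norm_integral_le_of_norm_le hb ?_
  refine (ae_restrict_iff' measurableSet_Ioi).2 (ae_of_all _ fun u hu => ?_)
  have hu1 : N < u := hu
  have hu0 : 0 < u := by linarith
  rw [norm_mul, Complex.norm_cpow_eq_rpow_re_of_pos hu0, Complex.norm_real, Real.norm_eq_abs]
  calc _ ≤ (K₀ * u ^ θ) * u ^ (-s - 1).re :=
        mul_le_mul_of_nonneg_right (h.abs_err_le (by linarith)) (by positivity)
    _ = _ := by
        rw [mul_assoc, ← Real.rpow_add hu0]
        congr 2
        simp; ring

lemma WellBehaved.differentiableAt_errInt (h : S.WellBehaved A θ K₀) {s : ℂ} (hs : θ < s.re)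
    {N : ℝ} (hN : 1 ≤ N) : DifferentiableAt ℂ (S.errInt A N) s := by
  set f : ℝ → ℂ := (Ioi N).indicator fun u => (S.err A u : ℂ) with hf
  have hmeas : Measurable f :=
    (Complex.measurable_ofReal.comp (S.measurable_err A)).indicator measurableSet_Ioi
  have hbound : ∀ u, 0 < u → ‖f u‖ ≤ K₀ * u ^ θ := by
    intro u hu
    simp only [hf]
    by_cases hu1 : u ∈ Ioi N
    · rw [indicator_of_mem hu1, Complex.norm_real, Real.norm_eq_abs]
      exact h.abs_err_le (hN.trans (le_of_lt hu1))
    · rw [indicator_of_notMem hu1, norm_zero]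
      exact mul_nonneg h.2.2.2.1 (by positivity)
  have hd : DifferentiableAt ℂ (mellin f) (-s) := by
    refine mellin_differentiableAt_of_isBigO_rpow (a := -θ) (b := -s.re - 1) ?_ ?_ (by simpa using hs) ?_
      (by simp)
    · have hloc : LocallyIntegrableOn (fun u : ℝ => K₀ * u ^ θ) (Ioi 0) := by
        refine ContinuousOn.locallyIntegrableOn ?_ measurableSet_Ioi
        intro u hu
        have hu0 : 0 < u := hu
        exact ((Real.continuousAt_rpow_const u θ (Or.inl hu0.ne')).const_mul K₀).continuousWithinAt
      intro x hx
      obtain ⟨t, ht, hti⟩ := hloc x hx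
      refine ⟨t ∩ Ioi 0, inter_mem ht self_mem_nhdsWithin, ?_⟩
      refine Integrable.mono (hti.mono_set inter_subset_left) hmeas.aestronglyMeasurable ?_
      have hsub : ∀ᵐ u ∂(volume.restrict (t ∩ Ioi (0 : ℝ))), u ∈ Ioi (0 : ℝ) :=
        ae_mono (Measure.restrict_mono inter_subset_right le_rfl) (ae_restrict_mem measurableSet_Ioi)
      filter_upwards [hsub] with u hu
      exact (hbound u hu).trans (le_abs_self _)
    · refine Asymptotics.IsBigO.of_bound K₀ ?_
      filter_upwards [eventually_gt_atTop 0] with u hu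
      rw [neg_neg, Real.norm_of_nonneg (by positivity)]
      exact hbound u hu
    · refine Asymptotics.IsBigO.of_bound 1 ?_
      have : ∀ᶠ u : ℝ in 𝓝[>] 0, u < 1 := by
        exact nhdsWithin_le_nhds (eventually_lt_nhds one_pos)
      filter_upwards [this] with u hu
      simp only [hf]
      rw [indicator_of_notMem (by simp; linarith), norm_zero]
      positivity
  have e : S.errInt A N = fun s => mellin f (-s) := by
    funext s
    simp only [errInt, mellin, hf]
    have e2 : ∀ t : ℝ, (t : ℂ) ^ (-s - 1) • (Ioi N).indicator (fun u => (S.err A u : ℂ)) t =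
        (Ioi N).indicator (fun u => (S.err A u : ℂ) * (u : ℂ) ^ (-s - 1)) t := by
      intro t
      by_cases ht : t ∈ Ioi N
      · rw [indicator_of_mem ht, indicator_of_mem ht, smul_eq_mul, mul_comm]
      · rw [indicator_of_notMem ht, indicator_of_notMem ht, smul_zero]
    simp_rw [e2]
    rw [integral_indicator_tail (by linarith)]
  rw [e]
  exact DifferentiableAt.comp (f := fun s : ℂ => -s) s hd differentiableAt_id.neg

lemma err_cast (u : ℝ) : ((S.err A u : ℝ) : ℂ) = (S.cnt u : ℂ) - A * u := by
  simp [err]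

/-- The partial sum of the Dirichlet series. -/
noncomputable def zetaSum (S : BeurlingSystem) (N : ℝ) (s : ℂ) : ℂ :=
  ∑ n ∈ S.below N, (S.val n : ℂ) ^ (-s)

/-- The truncated representation of the zeta function, valid for `σ > θ`. -/
noncomputable def zetaRep (S : BeurlingSystem) (A N : ℝ) (s : ℂ) : ℂ :=
  S.zetaSum N s + A * (N : ℂ) ^ (1 - s) / (s - 1) - S.err A N * (N : ℂ) ^ (-s) +
    s * S.errInt A N s

lemma WellBehaved.tsum_eq_zetaRep (h : S.WellBehaved A θ K₀) {s : ℂ} (hs : 1 < s.re) {N : ℝ}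
    (hN : 1 ≤ N) : ∑' n, (S.val n : ℂ) ^ (-s) = S.zetaRep A N s := by
  have hN0 : 0 < N := by linarith
  have hNc : (N : ℂ) ≠ 0 := by exact_mod_cast hN0.ne'
  have hs0 : s ≠ 0 := by rintro rfl; simp at hs; linarith
  have hs1 : s - 1 ≠ 0 := by
    intro h0
    have : s = 1 := by linear_combination h0
    rw [this] at hs; simp at hs
  have h1 : HasSum (fun n => if S.val n ≤ N then (S.val n : ℂ) ^ (-s) else 0) (S.zetaSum N s) := by
    have := hasSum_sum_of_ne_finset_zero (L := SummationFilter.unconditional _) (f := fun n => if S.val n ≤ N then (S.val n : ℂ) ^ (-s) else 0)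
      (s := S.below N) (fun n hn => by rw [mem_below] at hn; simp [hn])
    convert this using 1
    refine Finset.sum_congr rfl fun n hn => ?_
    rw [mem_below] at hn
    simp [hn]
  have h2 := h1.add (h.hasSum_tail hs hN)
  have e1 : (fun n => (if S.val n ≤ N then (S.val n : ℂ) ^ (-s) else 0) +
      (if S.val n ≤ N then 0 else (S.val n : ℂ) ^ (-s))) = fun n => (S.val n : ℂ) ^ (-s) := by
    funext n; split_ifs <;> simp
  rw [e1] at h2
  rw [h2.tsum_eq, zetaRep]
  have e2 : ∫ u in Ioi N, ((S.cnt u - S.cnt N : ℝ) : ℂ) * (u : ℂ) ^ (-s - 1) =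
      (∫ u in Ioi N, (S.err A u : ℂ) * (u : ℂ) ^ (-s - 1)) +
      ((∫ u in Ioi N, A * (u : ℂ) ^ (-(s - 1) - 1)) - ∫ u in Ioi N, S.cnt N * (u : ℂ) ^ (-s - 1)) := by
    have i2 : IntegrableOn (fun u : ℝ => (A : ℂ) * (u : ℂ) ^ (-(s - 1) - 1)) (Ioi N) :=
      (integrableOn_Ioi_cpow_of_lt (by simp; linarith) hN0).const_mul _
    have i3 : IntegrableOn (fun u : ℝ => (S.cnt N : ℂ) * (u : ℂ) ^ (-s - 1)) (Ioi N) :=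
      (integrableOn_Ioi_cpow_of_lt (by simp; linarith) hN0).const_mul _
    have i4 : Integrable (fun u : ℝ => (A : ℂ) * (u : ℂ) ^ (-(s - 1) - 1) -
        S.cnt N * (u : ℂ) ^ (-s - 1)) (volume.restrict (Ioi N)) := Integrable.sub i2 i3
    rw [← integral_sub i2 i3, ← integral_add (h.integrableOn_err (s := s) (by linarith [h.2.2.1]) hN) i4]
    refine setIntegral_congr_fun measurableSet_Ioi fun u hu => ?_
    have hu1 : N < u := hu
    have hu0 : (u : ℂ) ≠ 0 := by
      have : 0 < u := by linarith
      exact_mod_cast this.ne'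
    have e3 : (u : ℂ) ^ (-(s - 1) - 1) = u * (u : ℂ) ^ (-s - 1) := by
      rw [show -(s - 1) - 1 = 1 + (-s - 1) by ring, Complex.cpow_add _ _ hu0, Complex.cpow_one]
    simp only [e3, err]
    push_cast
    ring
  rw [e2, integral_const_mul, integral_const_mul, integral_tail_cpow (by simp; linarith) hN0,
    integral_tail_cpow (by linarith) hN0, errInt]
  have e3 : (N : ℂ) ^ (-(s - 1)) = N * (N : ℂ) ^ (-s) := by
    rw [show -(s - 1) = 1 + (-s) by ring, Complex.cpow_add _ _ hNc, Complex.cpow_one]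
  have e4 : (N : ℂ) ^ (1 - s) = N * (N : ℂ) ^ (-s) := by rw [← e3]; congr 1; ring
  rw [e3, e4, err]
  push_cast
  field_simp
  ring

lemma differentiableAt_val_cpow (n : ℕ →₀ ℕ) (s : ℂ) :
    DifferentiableAt ℂ (fun s : ℂ => (S.val n : ℂ) ^ (-s)) s := by
  refine DifferentiableAt.const_cpow differentiableAt_id.neg (Or.inl ?_)
  exact_mod_cast (S.val_pos n).ne'

lemma differentiable_zetaSum (N : ℝ) : Differentiable ℂ (S.zetaSum N) := by
  intro s
  unfold zetaSum
  exact DifferentiableAt.fun_sum fun n _ => differentiableAt_val_cpow n s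

lemma WellBehaved.differentiableAt_zetaRep (h : S.WellBehaved A θ K₀) {s : ℂ} (hs : θ < s.re)
    (hs1 : s ≠ 1) {N : ℝ} (hN : 1 ≤ N) : DifferentiableAt ℂ (S.zetaRep A N) s := by
  have hN0 : (N : ℂ) ≠ 0 := by
    have : 0 < N := by linarith
    exact_mod_cast this.ne'
  unfold zetaRep
  refine DifferentiableAt.add (DifferentiableAt.sub (DifferentiableAt.add ?_ ?_) ?_) ?_
  · exact differentiable_zetaSum N s
  · refine DifferentiableAt.div ?_ (by fun_prop) (sub_ne_zero.2 hs1)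
    exact (DifferentiableAt.const_cpow (by fun_prop) (Or.inl hN0)).const_mul _
  · exact (DifferentiableAt.const_cpow (by fun_prop) (Or.inl hN0)).const_mul _
  · exact differentiableAt_id.mul (h.differentiableAt_errInt hs hN)

lemma isOpen_punctured (θ : ℝ) : IsOpen {s : ℂ | θ < s.re ∧ s ≠ 1} :=
  (isOpen_lt continuous_const Complex.continuous_re).inter isOpen_ne

lemma IsZeta.differentiableAt {ζ : ℂ → ℂ} (hζ : S.IsZeta θ ζ) {s : ℂ} (hs : θ < s.re)
    (hs1 : s ≠ 1) : DifferentiableAt ℂ ζ s :=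
  (hζ.1 s ⟨hs, hs1⟩).differentiableAt ((isOpen_punctured θ).mem_nhds ⟨hs, hs1⟩)

lemma eqOn_halfStrip {f g : ℂ → ℂ} {c : ℝ} (hc : c = 1 ∨ c = -1)
    (hf : ∀ s : ℂ, θ < s.re → s ≠ 1 → DifferentiableAt ℂ f s)
    (hg : ∀ s : ℂ, θ < s.re → s ≠ 1 → DifferentiableAt ℂ g s)
    (hfg : ∀ s : ℂ, 1 < s.re → f s = g s) (hθ : θ < 1) :
    EqOn f g {s : ℂ | θ < s.re ∧ 0 < c * s.im} := by
  set U : Set ℂ := {s : ℂ | θ < s.re ∧ 0 < c * s.im} with hU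
  have hopen : IsOpen U := (isOpen_lt continuous_const Complex.continuous_re).inter
    (isOpen_lt continuous_const (continuous_const.mul Complex.continuous_im))
  have hne : ∀ s ∈ U, s ≠ 1 := by
    rintro s hs rfl
    simp [hU] at hs
  have hconv : Convex ℝ U := by
    have hUe : U = {s : ℂ | θ < s.re} ∩ {s : ℂ | 0 < c * s.im} := rfl
    rw [hUe]
    refine (convex_halfSpace_re_gt θ).inter ?_
    rcases hc with rfl | rfl
    · have : {s : ℂ | 0 < (1 : ℝ) * s.im} = {s : ℂ | 0 < s.im} := by
        ext s; simp
      rw [this]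
      exact convex_halfSpace_im_gt 0
    · have : {s : ℂ | 0 < (-1 : ℝ) * s.im} = {s : ℂ | s.im < 0} := by
        ext s; simp
      rw [this]
      exact convex_halfSpace_im_lt 0
  have hfa : AnalyticOnNhd ℂ f U :=
    DifferentiableOn.analyticOnNhd (fun s hs => (hf s hs.1 (hne s hs)).differentiableWithinAt) hopen
  have hga : AnalyticOnNhd ℂ g U :=
    DifferentiableOn.analyticOnNhd (fun s hs => (hg s hs.1 (hne s hs)).differentiableWithinAt) hopen
  have h0 : (⟨2, c⟩ : ℂ) ∈ U := by
    refine ⟨by simp; linarith, ?_⟩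
    rcases hc with rfl | rfl <;> simp
  refine hfa.eqOn_of_preconnected_of_eventuallyEq hga hconv.isPreconnected h0 ?_
  have : {s : ℂ | 1 < s.re} ∈ 𝓝 (⟨2, c⟩ : ℂ) :=
    (isOpen_lt continuous_const Complex.continuous_re).mem_nhds (by simp)
  filter_upwards [this] with s hs using hfg s hs

/-- The continued zeta function is given by the truncated representation. -/
lemma IsZeta.eq_zetaRep {ζ : ℂ → ℂ} (hζ : S.IsZeta θ ζ) (h : S.WellBehaved A θ K₀) {s : ℂ}
    (hs : θ < s.re) (hs1 : s ≠ 1) {N : ℝ} (hN : 1 ≤ N) : ζ s = S.zetaRep A N s := by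
  have hf : ∀ s : ℂ, θ < s.re → s ≠ 1 → DifferentiableAt ℂ ζ s := fun s => hζ.differentiableAt
  have hg : ∀ s : ℂ, θ < s.re → s ≠ 1 → DifferentiableAt ℂ (S.zetaRep A N) s :=
    fun s h1 h2 => h.differentiableAt_zetaRep h1 h2 hN
  have hfg : ∀ s : ℂ, 1 < s.re → ζ s = S.zetaRep A N s := fun s h1 => by
    rw [hζ.2 s h1, h.tsum_eq_zetaRep h1 hN]
  have hθ := h.2.2.1
  rcases lt_trichotomy s.im 0 with h0 | h0 | h0
  · exact eqOn_halfStrip (c := -1) (Or.inr rfl) hf hg hfg hθ ⟨hs, by linarith⟩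
  · have hlim : Tendsto (fun t : ℝ => s + t * Complex.I) (𝓝[>] 0) (𝓝 s) := by
      have : Continuous fun t : ℝ => s + t * Complex.I := by fun_prop
      have h2 := this.tendsto 0
      simp only [Complex.ofReal_zero, zero_mul, add_zero] at h2
      exact h2.mono_left nhdsWithin_le_nhds
    have t1 := (hf s hs hs1).continuousAt.tendsto.comp hlim
    have t2 := (hg s hs hs1).continuousAt.tendsto.comp hlim
    refine tendsto_nhds_unique (t1.congr' ?_) t2
    filter_upwards [self_mem_nhdsWithin] with t ht
    refine eqOn_halfStrip (c := 1) (Or.inl rfl) hf hg hfg hθ ⟨by simpa using hs, ?_⟩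
    simpa [h0] using ht
  · exact eqOn_halfStrip (c := 1) (Or.inl rfl) hf hg hfg hθ ⟨hs, by linarith⟩

lemma log_val_nonneg (n : ℕ →₀ ℕ) : 0 ≤ Real.log (S.val n) := Real.log_nonneg (S.one_le_val n)

lemma vonMangoldt_nonneg (n : ℕ →₀ ℕ) : 0 ≤ S.vonMangoldt n := by
  refine Finset.sum_nonneg fun k _ => ?_
  split_ifs
  · exact Real.log_nonneg (S.one_lt_p k).le
  · exact le_rfl

lemma vonMangoldt_eq_sum {m n : ℕ →₀ ℕ} (h : m ≤ n) :
    S.vonMangoldt m = ∑ k ∈ n.support, ∑ e ∈ Finset.Icc 1 (n k),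
      if m = Finsupp.single k e then Real.log (S.p k) else 0 := by
  have h1 : ∀ k, (∑ e ∈ Finset.Icc 1 (n k),
      if m = Finsupp.single k e then Real.log (S.p k) else 0) =
      if m.support = {k} then Real.log (S.p k) else 0 := by
    intro k
    split_ifs with hk
    · rw [Finset.sum_eq_single (m k)]
      · rw [if_pos]
        rw [Finsupp.support_eq_singleton] at hk
        exact hk.2
      · intro e _ he
        rw [if_neg]
        intro h2
        apply he
        rw [h2]; simp
      · intro h2
        exfalso
        apply h2
        rw [Finset.mem_Icc]
        refine ⟨?_, h k⟩
        rw [Finsupp.support_eq_singleton] at hk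
        exact Nat.one_le_iff_ne_zero.2 hk.1
    · refine Finset.sum_eq_zero fun e he => ?_
      rw [if_neg]
      intro h2
      apply hk
      rw [h2, Finsupp.support_single]
      rw [Finset.mem_Icc] at he
      omega
  simp_rw [h1]
  unfold vonMangoldt
  refine Finset.sum_subset (Finsupp.support_mono h) fun k _ hk => ?_
  rw [if_neg]
  intro h2
  apply hk
  rw [h2]; simp

lemma sum_antidiagonal_vonMangoldt (n : ℕ →₀ ℕ) :
    ∑ q ∈ Finset.HasAntidiagonal.antidiagonal n, S.vonMangoldt q.1 = Real.log (S.val n) := by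
  have h1 : ∀ q ∈ Finset.HasAntidiagonal.antidiagonal n, S.vonMangoldt q.1 =
      ∑ k ∈ n.support, ∑ e ∈ Finset.Icc 1 (n k),
      if q.1 = Finsupp.single k e then Real.log (S.p k) else 0 := by
    intro q hq
    rw [Finset.HasAntidiagonal.mem_antidiagonal] at hq
    exact vonMangoldt_eq_sum (hq ▸ le_self_add)
  rw [Finset.sum_congr rfl h1, Finset.sum_comm]
  have h2 : Real.log (S.val n) = ∑ k ∈ n.support, n k * Real.log (S.p k) := by
    unfold val Finsupp.prod
    rw [Real.log_prod fun k _ => (pow_pos (S.p_pos k) _).ne']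
    simp
  rw [h2]
  refine Finset.sum_congr rfl fun k hk => ?_
  rw [Finset.sum_comm]
  have h3 : ∀ e ∈ Finset.Icc 1 (n k), (∑ q ∈ Finset.HasAntidiagonal.antidiagonal n,
      if q.1 = Finsupp.single k e then Real.log (S.p k) else 0) = Real.log (S.p k) := by
    intro e he
    rw [Finset.mem_Icc] at he
    have hle : Finsupp.single k e ≤ n := by
      rw [Finsupp.single_le_iff]; exact he.2
    rw [Finset.sum_eq_single (Finsupp.single k e, n - Finsupp.single k e)]
    · simp
    · rintro ⟨a, b⟩ hq hne
      rw [if_neg]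
      intro h4
      apply hne
      rw [Finset.HasAntidiagonal.mem_antidiagonal] at hq
      simp only at h4 hq
      rw [← h4, ← hq]; simp
    · intro h4
      exfalso
      apply h4
      rw [Finset.HasAntidiagonal.mem_antidiagonal]
      exact add_tsub_cancel_of_le hle
  rw [Finset.sum_congr rfl h3]
  simp

lemma abs_gMoebius_le (n : ℕ →₀ ℕ) : |gMoebius n| ≤ 1 := by
  unfold gMoebius
  split_ifs
  · simp
  · simp

lemma sum_antidiagonal_gMoebius (n : ℕ →₀ ℕ) :
    ∑ q ∈ Finset.HasAntidiagonal.antidiagonal n, gMoebius q.1 = if n = 0 then 1 else 0 := by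
  have h1 : ∑ q ∈ Finset.HasAntidiagonal.antidiagonal n, gMoebius q.1 =
      ∑ t ∈ n.support.powerset, (-1 : ℝ) ^ t.card := by
    unfold gMoebius
    rw [← Finset.sum_filter]
    refine Finset.sum_bij' (fun q _ => q.1.support)
      (fun t _ => (Finsupp.indicator t fun _ _ => 1, n - Finsupp.indicator t fun _ _ => 1))
      ?_ ?_ ?_ ?_ ?_
    · intro q hq
      rw [Finset.mem_filter, Finset.HasAntidiagonal.mem_antidiagonal] at hq
      rw [Finset.mem_powerset]
      exact Finsupp.support_mono (hq.1 ▸ le_self_add)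
    · intro t ht
      rw [Finset.mem_powerset] at ht
      rw [Finset.mem_filter, Finset.HasAntidiagonal.mem_antidiagonal]
      refine ⟨add_tsub_cancel_of_le ?_, ?_⟩
      · intro k
        rw [Finsupp.indicator_apply]
        split_ifs with hk
        · exact Nat.one_le_iff_ne_zero.2 (Finsupp.mem_support_iff.1 (ht hk))
        · exact Nat.zero_le _
      · intro k _
        simp only [Finsupp.indicator_apply]
        split_ifs <;> simp
    · rintro ⟨a, b⟩ hq
      rw [Finset.mem_filter, Finset.HasAntidiagonal.mem_antidiagonal] at hq
      have ha : (Finsupp.indicator a.support fun _ _ => 1) = a := by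
        ext k
        rw [Finsupp.indicator_apply]
        split_ifs with hk
        · have := hq.2 k hk
          have h0 := Finsupp.mem_support_iff.1 hk
          simp only at this
          omega
        · rw [Finsupp.notMem_support_iff.1 hk]
      have hb : n - a = b := by rw [← hq.1]; simp
      simp only [ha, hb]
    · intro t ht
      ext k
      simp [Finsupp.indicator_apply]
    · intro q hq
      rfl
  rw [h1]
  have h2 := Finset.sum_powerset_neg_one_pow_card (x := n.support)
  have h3 : (∑ t ∈ n.support.powerset, (-1 : ℝ) ^ t.card) =
      ((∑ t ∈ n.support.powerset, (-1 : ℤ) ^ t.card : ℤ) : ℝ) := by push_cast; rfl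
  rw [h3, h2]
  by_cases hn : n = 0
  · simp [hn]
  · simp [hn]

lemma sum_below_antidiagonal {E : Type*} [AddCommMonoid E] (Y : ℝ) (hY : 1 ≤ Y)
    (f : (ℕ →₀ ℕ) × (ℕ →₀ ℕ) → E) :
    ∑ q ∈ S.below Y ×ˢ S.below Y, f q = ∑ n ∈ S.below (Y ^ 2),
      ∑ q ∈ (Finset.HasAntidiagonal.antidiagonal n).filter (fun q => S.val q.1 ≤ Y ∧ S.val q.2 ≤ Y), f q := by
  rw [Finset.sum_sigma']
  symm
  refine Finset.sum_bij' (fun x _ => x.2) (fun q _ => ⟨q.1 + q.2, q⟩) ?_ ?_ ?_ ?_ ?_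
  · rintro ⟨n, q⟩ hx
    rw [Finset.mem_sigma, Finset.mem_filter] at hx
    rw [Finset.mem_product, mem_below, mem_below]
    exact hx.2.2
  · rintro ⟨a, b⟩ hq
    rw [Finset.mem_product, mem_below, mem_below] at hq
    rw [Finset.mem_sigma, Finset.mem_filter, Finset.HasAntidiagonal.mem_antidiagonal, mem_below]
    refine ⟨?_, rfl, hq⟩
    simp only
    rw [val_add, sq]
    exact mul_le_mul hq.1 hq.2 (S.val_pos _).le (by linarith)
  · rintro ⟨n, q⟩ hx
    rw [Finset.mem_sigma, Finset.mem_filter, Finset.HasAntidiagonal.mem_antidiagonal] at hx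
    simp only [Sigma.mk.injEq] at hx ⊢
    exact ⟨hx.2.1, HEq.rfl⟩
  · intro q hq; rfl
  · intro q hq; rfl

lemma sum_below_antidiagonal_le (Z : ℝ) (hZ : 1 ≤ Z)
    (f : (ℕ →₀ ℕ) × (ℕ →₀ ℕ) → ℝ) (hf : ∀ q, 0 ≤ f q) :
    ∑ n ∈ S.below Z, ∑ q ∈ Finset.HasAntidiagonal.antidiagonal n, f q ≤ ∑ q ∈ S.below Z ×ˢ S.below Z, f q := by
  rw [sum_below_antidiagonal Z hZ]
  have hsub : S.below Z ⊆ S.below (Z ^ 2) := S.below_mono (by nlinarith)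
  refine le_trans ?_ (Finset.sum_le_sum_of_subset_of_nonneg hsub
    fun n _ _ => Finset.sum_nonneg fun q _ => hf q)
  refine Finset.sum_le_sum fun n hn => le_of_eq ?_
  rw [Finset.filter_true_of_mem]
  intro q hq
  rw [Finset.HasAntidiagonal.mem_antidiagonal] at hq
  rw [mem_below] at hn
  exact ⟨(S.val_mono (hq ▸ le_self_add)).trans hn,
    (S.val_mono (hq ▸ le_add_self)).trans hn⟩

lemma card_antidiagonal_add_le (a b : ℕ →₀ ℕ) :
    (Finset.HasAntidiagonal.antidiagonal (a + b)).card ≤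
      (Finset.HasAntidiagonal.antidiagonal a).card * (Finset.HasAntidiagonal.antidiagonal b).card := by
  rw [← Finset.card_product]
  refine le_trans (Finset.card_le_card ?_) (Finset.card_image_le (f := fun x => x.1 + x.2))
  rintro ⟨m, n⟩ hq
  rw [Finset.HasAntidiagonal.mem_antidiagonal] at hq
  rw [Finset.mem_image]
  refine ⟨((m ⊓ a, a - m ⊓ a), (m - m ⊓ a, b - (m - m ⊓ a))), ?_, ?_⟩
  · rw [Finset.mem_product, Finset.HasAntidiagonal.mem_antidiagonal, Finset.HasAntidiagonal.mem_antidiagonal]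
    refine ⟨add_tsub_cancel_of_le inf_le_right, add_tsub_cancel_of_le ?_⟩
    intro k
    have := DFunLike.congr_fun hq k
    simp only [Finsupp.coe_add, Pi.add_apply, Finsupp.coe_tsub, Pi.sub_apply, Finsupp.inf_apply] at this ⊢
    omega
  · ext k
    · have := DFunLike.congr_fun hq k
      simp only [Finsupp.coe_add, Pi.add_apply, Finsupp.coe_tsub, Pi.sub_apply, Finsupp.inf_apply, Prod.mk_add_mk] at this ⊢
      omega
    · have := DFunLike.congr_fun hq k
      simp only [Finsupp.coe_add, Pi.add_apply, Finsupp.coe_tsub, Pi.sub_apply, Finsupp.inf_apply, Prod.mk_add_mk] at this ⊢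
      omega

lemma sum_card_antidiagonal_le (Z : ℝ) (hZ : 1 ≤ Z) :
    ∑ n ∈ S.below Z, ((Finset.HasAntidiagonal.antidiagonal n).card : ℝ) ^ 2 / S.val n ≤
      (∑ n ∈ S.below Z, (S.val n)⁻¹) ^ 4 := by
  have h1 : ∑ n ∈ S.below Z, ((Finset.HasAntidiagonal.antidiagonal n).card : ℝ) / S.val n ≤
      (∑ n ∈ S.below Z, (S.val n)⁻¹) ^ 2 := by
    rw [sq, Finset.sum_mul_sum, ← Finset.sum_product']
    refine le_trans (le_of_eq ?_) (sum_below_antidiagonal_le Z hZ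
      (fun q => (S.val q.1)⁻¹ * (S.val q.2)⁻¹)
      fun q => mul_nonneg (inv_nonneg.2 (S.val_pos _).le) (inv_nonneg.2 (S.val_pos _).le))
    refine Finset.sum_congr rfl fun n _ => ?_
    rw [Finset.sum_congr rfl (g := fun _ => (S.val n)⁻¹)]
    · rw [Finset.sum_const, nsmul_eq_mul, div_eq_mul_inv]
    · intro q hq
      rw [Finset.HasAntidiagonal.mem_antidiagonal] at hq
      rw [← hq, val_add, mul_inv]
  have h0 : 0 ≤ ∑ n ∈ S.below Z, ((Finset.HasAntidiagonal.antidiagonal n).card : ℝ) / S.val n :=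
    Finset.sum_nonneg fun n _ => div_nonneg (Nat.cast_nonneg _) (S.val_pos _).le
  have h2 : ∑ n ∈ S.below Z, ((Finset.HasAntidiagonal.antidiagonal n).card : ℝ) ^ 2 / S.val n ≤
      (∑ n ∈ S.below Z, ((Finset.HasAntidiagonal.antidiagonal n).card : ℝ) / S.val n) ^ 2 := by
    rw [sq (∑ n ∈ S.below Z, ((Finset.HasAntidiagonal.antidiagonal n).card : ℝ) / S.val n), Finset.sum_mul_sum,
      ← Finset.sum_product']
    refine le_trans ?_ (sum_below_antidiagonal_le Z hZ
      (fun q => ((Finset.HasAntidiagonal.antidiagonal q.1).card : ℝ) / S.val q.1 *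
        (((Finset.HasAntidiagonal.antidiagonal q.2).card : ℝ) / S.val q.2))
      fun q => mul_nonneg (div_nonneg (Nat.cast_nonneg _) (S.val_pos _).le)
        (div_nonneg (Nat.cast_nonneg _) (S.val_pos _).le))
    refine Finset.sum_le_sum fun n _ => ?_
    have h3 : ((Finset.HasAntidiagonal.antidiagonal n).card : ℝ) ^ 2 / S.val n =
        ∑ q ∈ Finset.HasAntidiagonal.antidiagonal n, ((Finset.HasAntidiagonal.antidiagonal n).card : ℝ) / S.val n := by
      rw [Finset.sum_const, nsmul_eq_mul, sq, mul_div_assoc]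
    rw [h3]
    refine Finset.sum_le_sum fun q hq => ?_
    rw [Finset.HasAntidiagonal.mem_antidiagonal] at hq
    rw [← hq, val_add, div_mul_div_comm]
    have := card_antidiagonal_add_le q.1 q.2
    have hp := mul_pos (S.val_pos q.1) (S.val_pos q.2)
    gcongr
    exact_mod_cast this
  calc _ ≤ _ := h2
    _ ≤ ((∑ n ∈ S.below Z, (S.val n)⁻¹) ^ 2) ^ 2 := by gcongr
    _ = _ := by ring

lemma vonMangoldt_le_log (n : ℕ →₀ ℕ) : S.vonMangoldt n ≤ Real.log (S.val n) := by
  rw [← sum_antidiagonal_vonMangoldt]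
  refine Finset.single_le_sum (f := fun q : (ℕ →₀ ℕ) × (ℕ →₀ ℕ) => S.vonMangoldt q.1)
    (fun q _ => vonMangoldt_nonneg q.1) (a := (n, 0)) ?_
  rw [Finset.HasAntidiagonal.mem_antidiagonal, add_zero]

lemma WellBehaved.summable_log (h : S.WellBehaved A θ K₀) {σ : ℝ} (hσ : 1 < σ) :
    Summable fun n => Real.log (S.val n) * S.val n ^ (-σ) := by
  have hε : 0 < (σ - 1) / 2 := by linarith
  refine Summable.of_nonneg_of_le (fun n => mul_nonneg (log_val_nonneg n)
    (Real.rpow_nonneg (S.val_pos n).le _)) (fun n => ?_)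
    ((h.summable_rpow (σ := 1 + (σ - 1) / 2) (by linarith)).mul_left ((σ - 1) / 2)⁻¹)
  have h1 := Real.log_le_rpow_div (S.val_pos n).le hε
  calc _ ≤ (S.val n ^ ((σ - 1) / 2) / ((σ - 1) / 2)) * S.val n ^ (-σ) :=
        mul_le_mul_of_nonneg_right h1 (Real.rpow_nonneg (S.val_pos n).le _)
    _ = _ := by
        rw [div_mul_eq_mul_div, ← Real.rpow_add (S.val_pos n), div_eq_mul_inv, mul_comm]
        congr 2; ring

lemma WellBehaved.summable_vonMangoldt (h : S.WellBehaved A θ K₀) {σ : ℝ} (hσ : 1 < σ) :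
    Summable fun n => S.vonMangoldt n * S.val n ^ (-σ) :=
  Summable.of_nonneg_of_le (fun n => mul_nonneg (vonMangoldt_nonneg n)
    (Real.rpow_nonneg (S.val_pos n).le _))
    (fun n => mul_le_mul_of_nonneg_right (vonMangoldt_le_log n)
      (Real.rpow_nonneg (S.val_pos n).le _)) (h.summable_log hσ)

lemma norm_ofReal_mul_cpow (a : ℝ) (n : ℕ →₀ ℕ) (s : ℂ) :
    ‖(a : ℂ) * (S.val n : ℂ) ^ (-s)‖ = |a| * S.val n ^ (-s.re) := by
  rw [norm_mul, norm_val_cpow, Complex.norm_real, Real.norm_eq_abs]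

lemma sum_antidiagonal_cpow (f g : (ℕ →₀ ℕ) → ℝ) (s : ℂ) (n : ℕ →₀ ℕ) :
    ∑ q ∈ Finset.HasAntidiagonal.antidiagonal n,
      ((f q.1 : ℂ) * (S.val q.1 : ℂ) ^ (-s)) * ((g q.2 : ℂ) * (S.val q.2 : ℂ) ^ (-s)) =
    ((∑ q ∈ Finset.HasAntidiagonal.antidiagonal n, f q.1 * g q.2 : ℝ) : ℂ) *
        (S.val n : ℂ) ^ (-s) := by
  rw [Complex.ofReal_sum, Finset.sum_mul]
  refine Finset.sum_congr rfl fun q hq => ?_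
  rw [Finset.HasAntidiagonal.mem_antidiagonal] at hq
  rw [← hq, val_add, Complex.ofReal_mul, Complex.ofReal_mul,
    Complex.mul_cpow_ofReal_nonneg (S.val_pos _).le (S.val_pos _).le]
  ring

lemma tsum_mul_tsum_antidiagonal {F G : (ℕ →₀ ℕ) → ℂ} (hF : Summable fun n => ‖F n‖)
    (hG : Summable fun n => ‖G n‖) : (∑' n, F n) * (∑' n, G n) =
      ∑' n, ∑ q ∈ Finset.HasAntidiagonal.antidiagonal n, F q.1 * G q.2 :=
  Summable.tsum_mul_tsum_eq_tsum_sum_antidiagonal hF.of_norm hG.of_norm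
    (summable_mul_of_summable_norm hF hG)

lemma tsum_mul_tsum_cpow {f g : (ℕ →₀ ℕ) → ℝ} {s : ℂ}
    (hf : Summable fun n => |f n| * S.val n ^ (-s.re))
    (hg : Summable fun n => |g n| * S.val n ^ (-s.re)) :
    (∑' n, (f n : ℂ) * (S.val n : ℂ) ^ (-s)) * (∑' n, (g n : ℂ) * (S.val n : ℂ) ^ (-s)) =
      ∑' n, ((∑ q ∈ Finset.HasAntidiagonal.antidiagonal n, f q.1 * g q.2 : ℝ) : ℂ) *
        (S.val n : ℂ) ^ (-s) := by
  have hf' : Summable fun n => ‖(f n : ℂ) * (S.val n : ℂ) ^ (-s)‖ := by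
    simpa only [norm_ofReal_mul_cpow] using hf
  have hg' : Summable fun n => ‖(g n : ℂ) * (S.val n : ℂ) ^ (-s)‖ := by
    simpa only [norm_ofReal_mul_cpow] using hg
  exact (tsum_mul_tsum_antidiagonal hf' hg').trans
    (tsum_congr fun n => sum_antidiagonal_cpow f g s n)

/-- The Dirichlet series of the von Mangoldt function. -/
noncomputable def logDer (S : BeurlingSystem) (s : ℂ) : ℂ :=
  ∑' n, (S.vonMangoldt n : ℂ) * (S.val n : ℂ) ^ (-s)

lemma IsZeta.tsum_log {ζ : ℂ → ℂ} (hζ : S.IsZeta θ ζ) (h : S.WellBehaved A θ K₀) {s : ℂ}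
    (hs : 1 < s.re) :
    ∑' n, ((Real.log (S.val n) : ℝ) : ℂ) * (S.val n : ℂ) ^ (-s) = - deriv ζ s := by
  obtain ⟨σ, h1, h2⟩ := exists_between hs
  have hopen : IsOpen {s : ℂ | σ < s.re} := isOpen_lt continuous_const Complex.continuous_re
  have key := Complex.hasSum_deriv_of_summable_norm (F := fun n (s : ℂ) => (S.val n : ℂ) ^ (-s))
    (u := fun n => S.val n ^ (-σ)) (h.summable_rpow h1)
    (fun n s _ => (differentiableAt_val_cpow n s).differentiableWithinAt) hopen
    (fun n w hw => by
      rw [norm_val_cpow]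
      exact Real.rpow_le_rpow_of_exponent_le (S.one_le_val n) (neg_le_neg (le_of_lt hw)))
    (show s ∈ {s : ℂ | σ < s.re} from h2)
  have e1 : deriv (fun w => ∑' n, (S.val n : ℂ) ^ (-w)) s = deriv ζ s := by
    refine Filter.EventuallyEq.deriv_eq ?_
    filter_upwards [hopen.mem_nhds h2] with w hw
    exact (hζ.2 w (h1.trans hw)).symm
  rw [e1] at key
  rw [← key.neg.tsum_eq]
  refine tsum_congr fun n => ?_
  have hne : (S.val n : ℂ) ≠ 0 := by exact_mod_cast (S.val_pos n).ne'
  have hd : HasDerivAt (fun w : ℂ => (S.val n : ℂ) ^ (-w))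
      ((S.val n : ℂ) ^ (-s) * Complex.log (S.val n) * -1) s :=
    HasDerivAt.const_cpow (hasDerivAt_id s).fun_neg (Or.inl hne)
  rw [hd.deriv, Complex.ofReal_log (S.val_pos n).le]
  ring

lemma IsZeta.deriv_eq {ζ : ℂ → ℂ} (hζ : S.IsZeta θ ζ) (h : S.WellBehaved A θ K₀) {s : ℂ}
    (hs : 1 < s.re) : deriv ζ s = -(ζ s * S.logDer s) := by
  have h1 := tsum_mul_tsum_cpow (S := S) (f := S.vonMangoldt) (g := fun _ => 1) (s := s)
    (by simpa only [abs_of_nonneg (vonMangoldt_nonneg _)] using h.summable_vonMangoldt hs)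
    (by simpa using h.summable_rpow hs)
  simp only [mul_one, sum_antidiagonal_vonMangoldt, Complex.ofReal_one, one_mul] at h1
  rw [hζ.tsum_log h hs, ← hζ.2 s hs] at h1
  rw [logDer, mul_comm, h1, neg_neg]

lemma WellBehaved.summable_gMoebius (h : S.WellBehaved A θ K₀) {σ : ℝ} (hσ : 1 < σ) :
    Summable fun n => |gMoebius n| * S.val n ^ (-σ) :=
  Summable.of_nonneg_of_le (fun n => mul_nonneg (abs_nonneg _)
    (Real.rpow_nonneg (S.val_pos n).le _))
    (fun n => by
      have := mul_le_mul_of_nonneg_right (abs_gMoebius_le n)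
        (Real.rpow_nonneg (S.val_pos n).le (-σ))
      simpa using this) (h.summable_rpow hσ)

lemma IsZeta.mul_moebius {ζ : ℂ → ℂ} (hζ : S.IsZeta θ ζ) (h : S.WellBehaved A θ K₀) {s : ℂ}
    (hs : 1 < s.re) : (∑' n, (gMoebius n : ℂ) * (S.val n : ℂ) ^ (-s)) * ζ s = 1 := by
  have h1 := tsum_mul_tsum_cpow (S := S) (f := gMoebius) (g := fun _ => 1) (s := s)
    (h.summable_gMoebius hs) (by simpa using h.summable_rpow hs)
  simp only [mul_one, sum_antidiagonal_gMoebius, Complex.ofReal_one, one_mul] at h1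
  rw [hζ.2 s hs, h1, tsum_eq_single 0]
  · simp
  · intro n hn
    simp [hn]

lemma IsZeta.ne_zero {ζ : ℂ → ℂ} (hζ : S.IsZeta θ ζ) (h : S.WellBehaved A θ K₀) {s : ℂ}
    (hs : 1 < s.re) : ζ s ≠ 0 := by
  intro h0
  have := hζ.mul_moebius h hs
  rw [h0, mul_zero] at this
  exact zero_ne_one this

lemma IsZeta.norm_inv_le {ζ : ℂ → ℂ} (hζ : S.IsZeta θ ζ) (h : S.WellBehaved A θ K₀) {s : ℂ}
    (hs : 1 < s.re) : ‖ζ s‖⁻¹ ≤ (A + K₀) * s.re / (s.re - 1) := by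
  have h1 := hζ.mul_moebius h hs
  have h2 : ‖ζ s‖⁻¹ = ‖∑' n, (gMoebius n : ℂ) * (S.val n : ℂ) ^ (-s)‖ := by
    rw [eq_comm, ← norm_inv]
    congr 1
    exact eq_inv_of_mul_eq_one_left h1
  rw [h2]
  refine (norm_tsum_le_tsum_norm ?_).trans (le_trans ?_ (h.tsum_rpow_le hs))
  · simpa only [norm_ofReal_mul_cpow] using h.summable_gMoebius hs
  · simp only [norm_ofReal_mul_cpow]
    refine Summable.tsum_le_tsum (fun n => ?_) (h.summable_gMoebius hs) (h.summable_rpow hs)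
    have := mul_le_mul_of_nonneg_right (abs_gMoebius_le n)
      (Real.rpow_nonneg (S.val_pos n).le (-s.re))
    simpa using this

lemma IsZeta.logDer_eq {ζ : ℂ → ℂ} (hζ : S.IsZeta θ ζ) (h : S.WellBehaved A θ K₀) {s : ℂ}
    (hs : 1 < s.re) : S.logDer s = -(deriv ζ s / ζ s) := by
  have := hζ.ne_zero h hs
  rw [hζ.deriv_eq h hs]
  field_simp

lemma WellBehaved.norm_logDer_le (h : S.WellBehaved A θ K₀) {s : ℂ} (hs : 1 < s.re) :
    ‖S.logDer s‖ ≤ ∑' n, S.vonMangoldt n * S.val n ^ (-s.re) := by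
  refine (norm_tsum_le_tsum_norm ?_).trans (le_of_eq ?_)
  · simpa only [norm_ofReal_mul_cpow, abs_of_nonneg (vonMangoldt_nonneg _)] using
      h.summable_vonMangoldt hs
  · simp only [norm_ofReal_mul_cpow, abs_of_nonneg (vonMangoldt_nonneg _)]

lemma logDer_ofReal (σ : ℝ) :
    S.logDer σ = ((∑' n, S.vonMangoldt n * S.val n ^ (-σ) : ℝ) : ℂ) := by
  rw [logDer, Complex.ofReal_tsum]
  refine tsum_congr fun n => ?_
  rw [Complex.ofReal_mul, Complex.ofReal_cpow (S.val_pos n).le]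
  simp

/-- The function `(s - 1) ζ(s)`, regular for `σ > θ`. -/
noncomputable def zetaReg (S : BeurlingSystem) (A : ℝ) (s : ℂ) : ℂ :=
  (s - 1) * (A + s * S.errInt A 1 s) + A

lemma WellBehaved.differentiableAt_zetaReg (h : S.WellBehaved A θ K₀) {s : ℂ} (hs : θ < s.re) :
    DifferentiableAt ℂ (S.zetaReg A) s := by
  have := h.differentiableAt_errInt hs le_rfl
  unfold zetaReg
  fun_prop

lemma zetaSum_one (s : ℂ) : S.zetaSum 1 s = S.cnt 1 := by
  rw [zetaSum, Finset.sum_congr rfl (g := fun _ => (1 : ℂ))]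
  · rw [cnt_eq_card]; simp
  · intro n hn
    rw [mem_below] at hn
    rw [le_antisymm hn (S.one_le_val n)]
    simp

lemma IsZeta.zetaReg_eq {ζ : ℂ → ℂ} (hζ : S.IsZeta θ ζ) (h : S.WellBehaved A θ K₀) {s : ℂ}
    (hs : θ < s.re) (hs1 : s ≠ 1) : S.zetaReg A s = (s - 1) * ζ s := by
  rw [hζ.eq_zetaRep h hs hs1 le_rfl, zetaRep, zetaSum_one, err_cast, zetaReg]
  have : s - 1 ≠ 0 := sub_ne_zero.2 hs1
  simp only [Complex.ofReal_one, Complex.one_cpow]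
  field_simp
  ring

lemma zetaReg_one : S.zetaReg A 1 = A := by simp [zetaReg]

lemma errInt_conj (s : ℂ) : S.errInt A 1 (starRingEnd ℂ s) = starRingEnd ℂ (S.errInt A 1 s) := by
  rw [errInt, errInt, ← integral_conj]
  refine setIntegral_congr_fun measurableSet_Ioi fun u hu => ?_
  have hu0 : (0 : ℝ) < u := zero_lt_one.trans hu
  have harg : (u : ℂ).arg ≠ Real.pi := by
    rw [Complex.arg_ofReal_of_nonneg hu0.le]; exact Real.pi_pos.ne
  have e1 : -(starRingEnd ℂ) s - 1 = (starRingEnd ℂ) (-s - 1) := by simp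
  simp only [e1, Complex.cpow_conj _ _ harg, map_mul, Complex.conj_ofReal]

lemma zetaReg_conj (s : ℂ) : S.zetaReg A (starRingEnd ℂ s) = starRingEnd ℂ (S.zetaReg A s) := by
  simp only [zetaReg, errInt_conj, map_add, map_mul, map_sub, map_one, Complex.conj_ofReal]

lemma IsZeta.norm_le {ζ : ℂ → ℂ} (hζ : S.IsZeta θ ζ) (h : S.WellBehaved A θ K₀) {s : ℂ}
    (hs : θ < s.re) (hs1 : 1 ≤ ‖s - 1‖) : ‖ζ s‖ ≤ 2 * A + ‖s‖ * (K₀ / (s.re - θ)) := by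
  have hne : s - 1 ≠ 0 := by
    intro h0; rw [h0] at hs1; simp at hs1; linarith
  have e : ζ s = A / (s - 1) + A + s * S.errInt A 1 s := by
    have := hζ.zetaReg_eq h hs (sub_ne_zero.1 hne)
    rw [zetaReg] at this
    field_simp
    linear_combination -this
  have hA : (0 : ℝ) < A := h.1
  rw [e]
  refine (norm_add_le _ _).trans (add_le_add ((norm_add_le _ _).trans ?_) ?_)
  · rw [norm_div, Complex.norm_real, Real.norm_of_nonneg hA.le]
    have := div_le_self hA.le hs1
    linarith
  · rw [norm_mul]
    have := h.norm_errInt_le hs le_rfl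
    rw [Real.one_rpow, mul_one] at this
    gcongr

/-- The limit of the logarithmic derivative at a zero of an analytic function. -/
lemma tendsto_mul_logDeriv {f : ℂ → ℂ} {z : ℂ} (hf : AnalyticAt ℂ f z)
    (hne : ¬ ∀ᶠ w in 𝓝 z, f w = 0) :
    ∃ m : ℕ, (f z = 0 → 1 ≤ m) ∧
      Tendsto (fun w => (w - z) * (deriv f w / f w)) (𝓝[≠] z) (𝓝 m) := by
  have hord : ∃ (n : ℕ) (g : ℂ → ℂ), AnalyticAt ℂ g z ∧ g z ≠ 0 ∧
      ∀ᶠ w in 𝓝 z, f w = (w - z) ^ n • g w :=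
    (hf.exists_eventuallyEq_pow_smul_nonzero_iff).2 hne
  obtain ⟨m, g, hg, hgz, he⟩ := hord
  refine ⟨m, ?_, ?_⟩
  · intro h0
    by_contra hm
    have hm0 : m = 0 := by omega
    have := he.self_of_nhds
    rw [h0, hm0] at this
    simp at this
    exact hgz this.symm
  · have h1 : Tendsto (fun w => (m : ℂ) + (w - z) * (deriv g w / g w)) (𝓝[≠] z) (𝓝 m) := by
      have hc : ContinuousAt (fun w => (m : ℂ) + (w - z) * (deriv g w / g w)) z := by
        have h2 := hg.deriv.continuousAt
        have h3 := hg.continuousAt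
        fun_prop (disch := assumption)
      have := hc.tendsto.mono_left (nhdsWithin_le_nhds (s := {z}ᶜ))
      simpa using this
    refine h1.congr' ?_
    have h4 : ∀ᶠ w in 𝓝[≠] z, ∀ᶠ v in 𝓝 w, f v = (v - z) ^ m • g v :=
      nhdsWithin_le_nhds he.eventually_nhds
    have h5 : ∀ᶠ w in 𝓝[≠] z, g w ≠ 0 :=
      nhdsWithin_le_nhds (hg.continuousAt.eventually_ne hgz)
    have h6 : ∀ᶠ w in 𝓝[≠] z, AnalyticAt ℂ g w :=
      nhdsWithin_le_nhds hg.eventually_analyticAt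
    filter_upwards [h4, h5, h6, self_mem_nhdsWithin] with w h4 h5 h6 h7
    have hwz : w - z ≠ 0 := sub_ne_zero.2 h7
    have hd : HasDerivAt (fun v => (v - z) ^ m • g v)
        (((m : ℂ) * (w - z) ^ (m - 1) * 1) * g w + (w - z) ^ m * deriv g w) w :=
      (((hasDerivAt_id w).sub_const z).pow m).mul h6.differentiableAt.hasDerivAt
    have hfd : deriv f w = _ := (Filter.EventuallyEq.deriv_eq h4).trans hd.deriv
    rw [hfd, h4.self_of_nhds]
    simp only [smul_eq_mul]
    rcases Nat.eq_zero_or_pos m with rfl | hm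
    · simp
    · have : (w - z) ^ m = (w - z) ^ (m - 1) * (w - z) := by
        rw [← pow_succ]; congr 1; omega
      rw [this]
      have := pow_ne_zero (m - 1) hwz
      field_simp

lemma isOpen_re_gt (θ : ℝ) : IsOpen {s : ℂ | θ < s.re} :=
  isOpen_lt continuous_const Complex.continuous_re

lemma WellBehaved.analyticAt_zetaReg (h : S.WellBehaved A θ K₀) {s : ℂ} (hs : θ < s.re) :
    AnalyticAt ℂ (S.zetaReg A) s :=
  DifferentiableOn.analyticAt (s := {s : ℂ | θ < s.re})
    (fun _ hw => (h.differentiableAt_zetaReg hw).differentiableWithinAt)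
    ((isOpen_re_gt θ).mem_nhds hs)

lemma ne_one_of_one_lt_re {s : ℂ} (hs : 1 < s.re) : s ≠ 1 := by
  rintro rfl; simp at hs

lemma IsZeta.zetaReg_ne_zero_of_one_lt {ζ : ℂ → ℂ} (hζ : S.IsZeta θ ζ)
    (h : S.WellBehaved A θ K₀) {s : ℂ} (hs : 1 < s.re) : S.zetaReg A s ≠ 0 := by
  have h1 := ne_one_of_one_lt_re hs
  rw [hζ.zetaReg_eq h (by linarith [h.2.2.1]) h1]
  exact mul_ne_zero (sub_ne_zero.2 h1) (hζ.ne_zero h hs)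

/-- The negated logarithmic derivative of the zeta function, minus its polar part `1/(s - 1)`. -/
noncomputable def logDerReg (S : BeurlingSystem) (A : ℝ) (s : ℂ) : ℂ :=
  -(deriv (S.zetaReg A) s / S.zetaReg A s)

lemma IsZeta.deriv_zetaReg {ζ : ℂ → ℂ} (hζ : S.IsZeta θ ζ) (h : S.WellBehaved A θ K₀) {s : ℂ}
    (hs : θ < s.re) (hs1 : s ≠ 1) :
    deriv (S.zetaReg A) s = ζ s + (s - 1) * deriv ζ s := by
  have e : S.zetaReg A =ᶠ[𝓝 s] fun w => (w - 1) * ζ w := by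
    filter_upwards [(isOpen_punctured θ).mem_nhds ⟨hs, hs1⟩] with w hw
    exact hζ.zetaReg_eq h hw.1 hw.2
  rw [e.deriv_eq]
  have hd : HasDerivAt (fun w => (w - 1) * ζ w) (1 * ζ s + (s - 1) * deriv ζ s) s :=
    ((hasDerivAt_id s).sub_const 1).mul (hζ.differentiableAt hs hs1).hasDerivAt
  rw [hd.deriv, one_mul]

lemma IsZeta.logDerReg_eq {ζ : ℂ → ℂ} (hζ : S.IsZeta θ ζ) (h : S.WellBehaved A θ K₀) {s : ℂ}
    (hs : θ < s.re) (hs1 : s ≠ 1) (h0 : ζ s ≠ 0) :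
    S.logDerReg A s = -(deriv ζ s / ζ s) - 1 / (s - 1) := by
  rw [logDerReg, hζ.deriv_zetaReg h hs hs1, hζ.zetaReg_eq h hs hs1]
  have : s - 1 ≠ 0 := sub_ne_zero.2 hs1
  field_simp
  ring

lemma IsZeta.logDer_eq_reg {ζ : ℂ → ℂ} (hζ : S.IsZeta θ ζ) (h : S.WellBehaved A θ K₀) {s : ℂ}
    (hs : 1 < s.re) : S.logDer s = S.logDerReg A s + 1 / (s - 1) := by
  rw [hζ.logDerReg_eq h (by linarith [h.2.2.1]) (ne_one_of_one_lt_re hs) (hζ.ne_zero h hs),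
    hζ.logDer_eq h hs]
  ring

lemma re_val_cpow (n : ℕ →₀ ℕ) (σ t : ℝ) :
    ((S.val n : ℂ) ^ (-((σ : ℂ) + t * Complex.I))).re =
      S.val n ^ (-σ) * Real.cos (t * Real.log (S.val n)) := by
  have hne : (S.val n : ℂ) ≠ 0 := by exact_mod_cast (S.val_pos n).ne'
  rw [Complex.cpow_def_of_ne_zero hne, ← Complex.ofReal_log (S.val_pos n).le, Complex.exp_re]
  simp only [Complex.mul_re, Complex.mul_im, Complex.ofReal_re, Complex.ofReal_im, Complex.neg_re,
    Complex.neg_im, Complex.add_re, Complex.add_im, Complex.I_re, Complex.I_im, mul_zero, mul_one,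
    zero_mul, sub_zero, add_zero, zero_add]
  rw [Real.rpow_def_of_pos (S.val_pos n), ← Real.cos_neg (t * Real.log (S.val n))]
  congr 2; ring

lemma WellBehaved.re_logDer_nonneg (h : S.WellBehaved A θ K₀) {σ : ℝ} (hσ : 1 < σ) (t : ℝ) :
    0 ≤ 3 * (S.logDer (σ + (0 : ℝ) * Complex.I)).re + 4 * (S.logDer (σ + t * Complex.I)).re +
      (S.logDer (σ + (2 * t : ℝ) * Complex.I)).re := by
  have key : ∀ τ : ℝ, HasSum (fun n => S.vonMangoldt n * (S.val n ^ (-σ) *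
      Real.cos (τ * Real.log (S.val n)))) (S.logDer (σ + τ * Complex.I)).re := by
    intro τ
    have hsum : Summable fun n => (S.vonMangoldt n : ℂ) *
        (S.val n : ℂ) ^ (-((σ : ℂ) + τ * Complex.I)) := by
      refine Summable.of_norm ?_
      simp only [norm_ofReal_mul_cpow, abs_of_nonneg (vonMangoldt_nonneg _)]
      simpa using h.summable_vonMangoldt hσ
    have := Complex.hasSum_re hsum.hasSum
    simp only [Complex.re_ofReal_mul, re_val_cpow] at this
    exact this
  have := (((key 0).mul_left 3).add ((key t).mul_left 4)).add (key (2 * t))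
  refine this.nonneg fun n => ?_
  have h1 := vonMangoldt_nonneg (S := S) n
  have h2 : 0 ≤ S.val n ^ (-σ) := Real.rpow_nonneg (S.val_pos n).le _
  have h3 : 2 * t * Real.log (S.val n) = 2 * (t * Real.log (S.val n)) := by ring
  rw [h3, Real.cos_two_mul, zero_mul, Real.cos_zero]
  have : 3 * (S.vonMangoldt n * (S.val n ^ (-σ) * 1)) + 4 * (S.vonMangoldt n * (S.val n ^ (-σ) *
      Real.cos (t * Real.log (S.val n)))) + S.vonMangoldt n * (S.val n ^ (-σ) *
      (2 * Real.cos (t * Real.log (S.val n)) ^ 2 - 1)) =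
      2 * (S.vonMangoldt n * S.val n ^ (-σ)) * (1 + Real.cos (t * Real.log (S.val n))) ^ 2 := by
    ring
  rw [this]
  positivity

lemma IsZeta.tendsto_logDer {ζ : ℂ → ℂ} (hζ : S.IsZeta θ ζ) (h : S.WellBehaved A θ K₀) (t : ℝ) :
    ∃ m : ℕ, (S.zetaReg A (1 + t * Complex.I) = 0 → 1 ≤ m) ∧
      Tendsto (fun σ : ℝ => (σ - 1) * (S.logDer (σ + t * Complex.I)).re) (𝓝[>] 1)
        (𝓝 ((if t = 0 then 1 else 0) - m)) := by
  set z : ℂ := 1 + t * Complex.I with hz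
  have hcont : Tendsto (fun σ : ℝ => (σ : ℂ) + t * Complex.I) (𝓝[>] 1) (𝓝[≠] z) := by
    refine tendsto_nhdsWithin_iff.2 ⟨?_, ?_⟩
    · have : Continuous fun σ : ℝ => (σ : ℂ) + t * Complex.I := by fun_prop
      have h1 := (this.tendsto 1).mono_left (nhdsWithin_le_nhds (s := Ioi 1))
      simpa [hz] using h1
    · filter_upwards [self_mem_nhdsWithin] with σ hσ h1
      have h2 : (1 : ℝ) < σ := hσ
      have := congrArg Complex.re (show (σ : ℂ) + t * Complex.I = z from h1)
      simp [hz] at this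
      linarith
  have hθ : θ < z.re := by simp [hz]; exact h.2.2.1
  obtain ⟨m, hm1, hm2⟩ := tendsto_mul_logDeriv (h.analyticAt_zetaReg hθ) (by
    intro h0
    have h1 : ∀ᶠ σ : ℝ in 𝓝[>] 1, S.zetaReg A ((σ : ℂ) + t * Complex.I) = 0 :=
      hcont.eventually (nhdsWithin_le_nhds h0)
    obtain ⟨σ, h2, h3⟩ := (h1.and self_mem_nhdsWithin).exists
    exact hζ.zetaReg_ne_zero_of_one_lt h (s := (σ : ℂ) + t * Complex.I)
      (by simpa using h3) h2)
  refine ⟨m, hm1, ?_⟩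
  have h3 := (Complex.continuous_re.tendsto _).comp (hm2.comp hcont)
  have h4 : Tendsto (fun σ : ℝ => ((σ - 1 : ℂ) / ((σ : ℂ) + t * Complex.I - 1)).re) (𝓝[>] 1)
      (𝓝 (if t = 0 then 1 else 0)) := by
    split_ifs with ht
    · refine tendsto_const_nhds.congr' ?_
      filter_upwards [self_mem_nhdsWithin] with σ hσ
      have h2 : (1 : ℝ) < σ := hσ
      have h5 : (σ - 1 : ℂ) ≠ 0 := by
        rw [sub_ne_zero]; exact_mod_cast h2.ne'
      rw [ht]
      simp [div_self h5]
    · have hI : (t : ℂ) * Complex.I ≠ 0 := by simp [ht]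
      have hc : ContinuousAt (fun σ : ℝ => ((σ - 1 : ℂ) / ((σ : ℂ) + t * Complex.I - 1)).re) 1 := by
        refine Complex.continuous_re.continuousAt.comp (ContinuousAt.div (by fun_prop) (by fun_prop) ?_)
        simpa using ht
      have := hc.tendsto.mono_left (nhdsWithin_le_nhds (s := Ioi 1))
      simpa using this
  have h5 := h4.sub h3
  simp only [Complex.natCast_re] at h5
  refine h5.congr' ?_
  filter_upwards [self_mem_nhdsWithin] with σ hσ
  have h2 : (1 : ℝ) < σ := hσ
  have hre : 1 < ((σ : ℂ) + t * Complex.I).re := by simpa using h2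
  simp only [Function.comp_apply]
  rw [← Complex.sub_re, hζ.logDer_eq_reg h hre, logDerReg, hz]
  have e : ((σ : ℝ) - 1) * (-(deriv (S.zetaReg A) (↑σ + ↑t * Complex.I) /
      S.zetaReg A (↑σ + ↑t * Complex.I)) + 1 / (↑σ + ↑t * Complex.I - 1)).re =
      (((σ - 1 : ℝ) : ℂ) * (-(deriv (S.zetaReg A) (↑σ + ↑t * Complex.I) /
      S.zetaReg A (↑σ + ↑t * Complex.I)) + 1 / (↑σ + ↑t * Complex.I - 1))).re := by
    rw [Complex.re_ofReal_mul]
  rw [e]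
  congr 1
  push_cast
  ring

lemma IsZeta.zetaReg_ne_zero {ζ : ℂ → ℂ} (hζ : S.IsZeta θ ζ) (h : S.WellBehaved A θ K₀) {s : ℂ}
    (hs : 1 ≤ s.re) : S.zetaReg A s ≠ 0 := by
  rcases hs.lt_or_eq with hs | hs
  · exact hζ.zetaReg_ne_zero_of_one_lt h hs
  have e : s = 1 + s.im * Complex.I := by
    apply Complex.ext <;> simp [← hs]
  set t := s.im
  rw [e]
  by_cases ht : t = 0
  · rw [ht]
    simp only [Complex.ofReal_zero, zero_mul, add_zero, zetaReg_one]
    exact_mod_cast h.1.ne'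
  intro h0
  obtain ⟨m0, -, h1⟩ := hζ.tendsto_logDer h 0
  obtain ⟨m1, hm, h2⟩ := hζ.tendsto_logDer h t
  obtain ⟨m2, -, h3⟩ := hζ.tendsto_logDer h (2 * t)
  have hm1 := hm h0
  have h4 := ((h1.const_mul 3).add (h2.const_mul 4)).add h3
  rw [if_pos rfl, if_neg ht, if_neg (by simpa using ht)] at h4
  have h5 : 0 ≤ 3 * (1 - (m0 : ℝ)) + 4 * (0 - m1) + (0 - m2) := by
    refine ge_of_tendsto h4 ?_
    filter_upwards [self_mem_nhdsWithin] with σ hσ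
    have hσ1 : (1 : ℝ) < σ := hσ
    have := mul_nonneg (by linarith : 0 ≤ σ - 1) (h.re_logDer_nonneg hσ1 t)
    linarith
  have : (1 : ℝ) ≤ m1 := by exact_mod_cast hm1
  have h0' : (0 : ℝ) ≤ m0 := Nat.cast_nonneg _
  have h2' : (0 : ℝ) ≤ m2 := Nat.cast_nonneg _
  linarith

lemma IsZeta.exists_zeroFree_compact {ζ : ℂ → ℂ} (hζ : S.IsZeta θ ζ) (h : S.WellBehaved A θ K₀)
    (B : ℝ) : ∃ η : ℝ, 0 < η ∧ η < 1 - θ ∧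
      ∀ s : ℂ, 1 - η ≤ s.re → |s.im| ≤ B → S.zetaReg A s ≠ 0 := by
  have hcont : ContinuousOn (S.zetaReg A) {s : ℂ | θ < s.re} := fun s hs =>
    (h.differentiableAt_zetaReg hs).continuousAt.continuousWithinAt
  have hopen : IsOpen ({s : ℂ | θ < s.re} ∩ S.zetaReg A ⁻¹' {0}ᶜ) :=
    hcont.isOpen_inter_preimage (isOpen_re_gt θ) isOpen_compl_singleton
  have hK : IsCompact ((fun t : ℝ => (1 : ℂ) + t * Complex.I) '' Icc (-B) B) :=
    isCompact_Icc.image (by fun_prop)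
  obtain ⟨δ, hδ, hsub⟩ := hK.exists_thickening_subset_open hopen (by
    rintro _ ⟨t, -, rfl⟩
    refine ⟨by simp; exact h.2.2.1, ?_⟩
    exact hζ.zetaReg_ne_zero h (by simp))
  have hθ := h.2.2.1
  refine ⟨min (δ / 2) ((1 - θ) / 2), lt_min (by linarith) (by linarith),
    (min_le_right _ _).trans_lt (by linarith), fun s hs hB => ?_⟩
  by_cases h1 : 1 ≤ s.re
  · exact hζ.zetaReg_ne_zero h h1
  have h2 : s ∈ Metric.thickening δ ((fun t : ℝ => (1 : ℂ) + t * Complex.I) '' Icc (-B) B) := by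
    rw [Metric.mem_thickening_iff]
    refine ⟨1 + s.im * Complex.I, ⟨s.im, abs_le.1 hB, rfl⟩, ?_⟩
    have e : s - (1 + s.im * Complex.I) = ((s.re - 1 : ℝ) : ℂ) := by
      apply Complex.ext <;> simp
    rw [dist_eq_norm, e, Complex.norm_real, Real.norm_eq_abs, abs_of_neg (by linarith)]
    have := min_le_left (δ / 2) ((1 - θ) / 2)
    linarith
  exact (hsub h2).2

lemma WellBehaved.continuousAt_logDerReg (h : S.WellBehaved A θ K₀) {s : ℂ} (hs : θ < s.re)
    (h0 : S.zetaReg A s ≠ 0) : DifferentiableAt ℂ (S.logDerReg A) s := by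
  have h1 := h.analyticAt_zetaReg hs
  exact (h1.deriv.differentiableAt.div h1.differentiableAt h0).neg

lemma IsZeta.exists_logDerReg_bound {ζ : ℂ → ℂ} (hζ : S.IsZeta θ ζ) (h : S.WellBehaved A θ K₀)
    (B : ℝ) : ∃ η C : ℝ, 0 < η ∧ 0 < C ∧
      ∀ s : ℂ, 1 - η ≤ s.re → s.re ≤ 2 → |s.im| ≤ B → ‖S.logDerReg A s‖ ≤ C := by
  obtain ⟨η, h0, h1, h2⟩ := hζ.exists_zeroFree_compact h B
  have hK : IsCompact (Icc (1 - η) 2 ×ℂ Icc (-B) B) := isCompact_Icc.reProdIm isCompact_Icc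
  obtain ⟨C, hC⟩ := hK.exists_bound_of_continuousOn (f := S.logDerReg A) (by
    intro s hs
    rw [Complex.mem_reProdIm] at hs
    exact (h.continuousAt_logDerReg (by linarith [hs.1.1])
      (h2 s hs.1.1 (abs_le.2 hs.2))).continuousAt.continuousWithinAt)
  refine ⟨η, max C 1, h0, by positivity, fun s a b c => (hC s ?_).trans (le_max_left _ _)⟩
  rw [Complex.mem_reProdIm]
  exact ⟨⟨a, b⟩, abs_le.1 c⟩

/-- The width of the zero-free region up to height `exp L`. -/
noncomputable def width (d L : ℝ) : ℝ := d * Real.log L / (L + 1)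

lemma IsZeta.exists_zeroFree {ζ : ℂ → ℂ} (hζ : S.IsZeta θ ζ) (h : S.WellBehaved A θ K₀)
    {d t₀ : ℝ} (hd : 0 < d)
    (hZ : ∀ ρ : ℂ, θ < ρ.re → ρ ≠ 1 → t₀ < ρ.im →
      1 - d * Real.log (Real.log ρ.im) / Real.log ρ.im < ρ.re → ζ ρ ≠ 0) :
    ∃ η : ℝ, 0 < η ∧ η < 1 - θ ∧ ∀ L : ℝ, 3 ≤ L → width d L ≤ η →
      ∀ s : ℂ, 1 - width d L < s.re → |s.im| ≤ Real.exp L + 1 → S.zetaReg A s ≠ 0 := by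
  set B := max t₀ (Real.exp (Real.exp 1)) with hB
  obtain ⟨η, h0, h1, h2⟩ := hζ.exists_zeroFree_compact h B
  refine ⟨η, h0, h1, fun L hL hw => ?_⟩
  have hpos : ∀ s : ℂ, 1 - width d L < s.re → s.im ≤ Real.exp L + 1 → B < s.im →
      S.zetaReg A s ≠ 0 := by
    intro s hs hs1 hs2
    have hB1 : Real.exp (Real.exp 1) < s.im := (le_max_right _ _).trans_lt hs2
    have him : 0 < s.im := (Real.exp_pos _).trans hB1
    have hx : Real.exp 1 ≤ Real.log s.im := (Real.le_log_iff_exp_le him).2 hB1.le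
    have hx2 : Real.log s.im ≤ L + 1 := by
      rw [Real.log_le_iff_le_exp him, Real.exp_add]
      have h3 := Real.add_one_le_exp (1 : ℝ)
      have h4 : 1 ≤ Real.exp L := Real.one_le_exp (by linarith)
      nlinarith
    have hs3 : s ≠ 1 := by rintro rfl; simp at him
    have hanti := Real.log_div_self_antitoneOn (a := Real.log s.im) (b := L + 1) hx
      (hx.trans hx2) hx2
    have hlog : Real.log L ≤ Real.log (L + 1) := Real.log_le_log (by linarith) (by linarith)
    have hle : width d L ≤ d * Real.log (Real.log s.im) / Real.log s.im := by
      rw [width, mul_div_assoc, mul_div_assoc]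
      refine mul_le_mul_of_nonneg_left (le_trans ?_ hanti) hd.le
      exact div_le_div_of_nonneg_right hlog (by linarith)
    rw [hζ.zetaReg_eq h (by linarith) hs3]
    exact mul_ne_zero (sub_ne_zero.2 hs3) (hZ s (by linarith) hs3
      ((le_max_left _ _).trans_lt hs2) (by linarith))
  intro s hs hs1
  by_cases hcase : |s.im| ≤ B
  · exact h2 s (by linarith) hcase
  rw [not_le] at hcase
  rcases le_total 0 s.im with hi | hi
  · rw [abs_of_nonneg hi] at hcase hs1
    exact hpos s hs hs1 hcase
  · rw [abs_of_nonpos hi] at hcase hs1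
    have := hpos (starRingEnd ℂ s) (by simpa using hs) (by simpa using hs1) (by simpa using hcase)
    rw [zetaReg_conj] at this
    simpa using this

/-- A logarithmic derivative bound from the Borel–Carathéodory theorem. -/
lemma norm_logDeriv_le_of_ball {f : ℂ → ℂ} {z₀ z : ℂ} {R M : ℝ} (hR : 0 < R) (hM : 0 < M)
    (hf : DifferentiableOn ℂ f (Metric.ball z₀ R)) (hne : ∀ w ∈ Metric.ball z₀ R, f w ≠ 0)
    (hb : ∀ w ∈ Metric.ball z₀ R, ‖f w‖ ≤ Real.exp M * ‖f z₀‖)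
    (hz : ‖z - z₀‖ ≤ 17 / 18 * R) : ‖deriv f z / f z‖ ≤ 2520 * M / R := by
  have hz₀ : z₀ ∈ Metric.ball z₀ R := Metric.mem_ball_self hR
  have hder : DifferentiableOn ℂ (fun w => deriv f w / f w) (Metric.ball z₀ R) :=
    (hf.deriv Metric.isOpen_ball).div hf hne
  obtain ⟨g, hg⟩ := hder.isExactOn_ball
  have hconst : ∀ w ∈ Metric.ball z₀ R, f w * Complex.exp (-g w) = f z₀ * Complex.exp (-g z₀) := by
    intro w hw
    have hd : ∀ v ∈ Metric.ball z₀ R, HasDerivAt (fun v => f v * Complex.exp (-g v)) 0 v := by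
      intro v hv
      have h1 := (hf.differentiableAt (Metric.isOpen_ball.mem_nhds hv)).hasDerivAt
      have h2 := h1.mul (hg v hv).fun_neg.cexp
      refine h2.congr_deriv ?_
      have h3 : f v * (deriv f v / f v) = deriv f v := mul_div_cancel₀ _ (hne v hv)
      linear_combination -Complex.exp (-g v) * h3
    exact (convex_ball z₀ R).is_const_of_fderivWithin_eq_zero
      (fun v hv => (hd v hv).differentiableAt.differentiableWithinAt)
      (fun v hv => by
        rw [fderivWithin_of_isOpen Metric.isOpen_ball hv]
        ext
        simp [(hd v hv).deriv]) hw hz₀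
  set l : ℂ → ℂ := fun u => g (z₀ + u) - g z₀ with hl
  have hmem : ∀ {u : ℂ}, u ∈ Metric.ball (0 : ℂ) R → z₀ + u ∈ Metric.ball z₀ R := by
    intro u hu
    simpa [Metric.mem_ball, dist_eq_norm] using hu
  have hexp : ∀ u ∈ Metric.ball (0 : ℂ) R, Complex.exp (l u) = f (z₀ + u) / f z₀ := by
    intro u hu
    have h1 := hconst _ (hmem hu)
    have h2 := hne _ hz₀
    rw [hl, Complex.exp_sub, div_eq_div_iff (Complex.exp_ne_zero _) h2]
    rw [Complex.exp_neg, Complex.exp_neg] at h1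
    have h3 := Complex.exp_ne_zero (g (z₀ + u))
    have h4 := Complex.exp_ne_zero (g z₀)
    field_simp at h1
    linear_combination -h1
  have hld : ∀ u ∈ Metric.ball (0 : ℂ) R, HasDerivAt l (deriv f (z₀ + u) / f (z₀ + u)) u := by
    intro u hu
    exact ((hg _ (hmem hu)).comp_const_add z₀ u).sub_const _
  have hmaps : MapsTo l (Metric.ball 0 R) {z | z.re ≤ M} := by
    intro u hu
    have h1 := hexp u hu
    have h2 : Real.exp (l u).re ≤ Real.exp M := by
      rw [← Complex.norm_exp, h1, norm_div, div_le_iff₀ (norm_pos_iff.2 (hne _ hz₀))]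
      exact hb _ (hmem hu)
    exact Real.exp_le_exp.1 h2
  have hbc : ∀ u : ℂ, ‖u‖ ≤ 35 / 36 * R → ‖l u‖ ≤ 70 * M := by
    intro u hu
    have hu1 : u ∈ Metric.ball (0 : ℂ) R := by
      rw [Metric.mem_ball, dist_zero_right]; linarith
    have h1 := Complex.borelCaratheodory_zero hM
      (fun v hv => (hld v hv).differentiableAt.differentiableWithinAt) hmaps hR hu1
      (by simp [hl])
    refine h1.trans ?_
    rw [div_le_iff₀ (by linarith)]
    nlinarith
  set u := z - z₀ with hu
  have hzu : z₀ + u = z := by rw [hu]; ring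
  have hu1 : u ∈ Metric.ball (0 : ℂ) R := by
    rw [Metric.mem_ball, dist_zero_right]; linarith
  have hder2 := (hld u hu1).deriv
  rw [hzu] at hder2
  rw [← hder2]
  have h3 := Complex.norm_deriv_le_of_forall_mem_sphere_norm_le (f := l) (c := u) (R := R / 36)
    (C := 70 * M) (by linarith) ?_ ?_
  · refine h3.trans (le_of_eq ?_)
    field_simp; ring
  · refine DifferentiableOn.diffContOnCl ?_
    intro v hv
    rw [closure_ball _ (by linarith : R / 36 ≠ 0)] at hv
    rw [Metric.mem_closedBall, dist_eq_norm] at hv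
    refine (hld v ?_).differentiableAt.differentiableWithinAt
    rw [Metric.mem_ball, dist_zero_right]
    have := norm_add_le (v - u) u
    rw [sub_add_cancel] at this
    linarith
  · intro v hv
    rw [Metric.mem_sphere, dist_eq_norm] at hv
    refine hbc v ?_
    have := norm_add_le (v - u) u
    rw [sub_add_cancel] at this
    linarith

lemma IsZeta.exists_logDeriv_bound {ζ : ℂ → ℂ} (hζ : S.IsZeta θ ζ) (h : S.WellBehaved A θ K₀)
    {d η : ℝ} (hd : 0 < d) (hη : ∀ L : ℝ, 3 ≤ L → width d L ≤ η →
      ∀ s : ℂ, 1 - width d L < s.re → |s.im| ≤ Real.exp L + 1 → S.zetaReg A s ≠ 0) :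
    ∃ C : ℝ, 0 < C ∧ ∀ L : ℝ, 3 ≤ L → width d L ≤ η → width d L ≤ 1 / 4 →
      width d L ≤ (1 - θ) / 2 → ∀ s : ℂ, 1 - 8 / 9 * width d L ≤ s.re → s.re ≤ 1 + width d L →
      2 ≤ |s.im| → |s.im| ≤ Real.exp L → ‖deriv ζ s / ζ s‖ ≤ C * L ^ 2 := by
  have hA := h.1
  have hK := h.2.2.2.1
  have hθ := h.2.2.1
  set C₁ : ℝ := 2 * A + 4 * (K₀ / ((1 - θ) / 2)) with hC₁
  have hC₁0 : 0 < C₁ := by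
    have : 0 ≤ K₀ / ((1 - θ) / 2) := div_nonneg hK (by linarith)
    positivity
  set C₂ : ℝ := C₁ * (2 * (A + K₀)) * (2 / d) with hC₂
  have hC₂0 : 0 < C₂ := by positivity
  refine ⟨2520 * (|Real.log C₂| + 2) / d, by positivity, ?_⟩
  intro L hL hwη hw4 hwθ s hs1 hs2 hs3 hs4
  set w := width d L with hw
  have hlogL : 1 ≤ Real.log L := by
    rw [Real.le_log_iff_exp_le (by linarith)]
    have := Real.exp_one_lt_d9
    linarith
  have hw0 : 0 < w := by rw [hw, width]; positivity
  have hwinv : 1 / w ≤ 2 * L / d := by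
    rw [hw, width, one_div_div, div_le_div_iff₀ (by positivity) hd]
    nlinarith [mul_pos hd (by linarith : 0 < L)]
  have him : ∀ z ∈ Metric.ball (⟨1 + w, s.im⟩ : ℂ) (2 * w), 1 - w < z.re ∧ z.re < 2 ∧
      |z.im| ≤ Real.exp L + 1 ∧ 1 ≤ |z.im| := by
    intro z hz
    rw [Metric.mem_ball, dist_eq_norm] at hz
    have h1 := (Complex.abs_re_le_norm _).trans_lt hz
    have h2 := (Complex.abs_im_le_norm _).trans_lt hz
    simp only [Complex.sub_re, Complex.sub_im] at h1 h2
    rw [abs_lt] at h1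
    refine ⟨by linarith, by linarith, ?_, ?_⟩
    · have := abs_sub_abs_le_abs_sub z.im s.im
      linarith
    · have := abs_sub_abs_le_abs_sub s.im z.im
      rw [abs_sub_comm] at this
      linarith
  have hne1 : ∀ z : ℂ, 1 ≤ |z.im| → z ≠ 1 := by
    rintro z hz rfl
    simp at hz
    linarith
  have hθw : ∀ z : ℂ, 1 - w < z.re → (1 - θ) / 2 ≤ z.re - θ := fun z hz => by linarith
  have hLe : 1 ≤ Real.exp L := Real.one_le_exp (by linarith)
  have hbound : ∀ z ∈ Metric.ball (⟨1 + w, s.im⟩ : ℂ) (2 * w), ‖ζ z‖ ≤ C₁ * Real.exp L := by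
    intro z hz
    obtain ⟨a, b, c, e⟩ := him z hz
    have h1 : 1 ≤ ‖z - 1‖ := by
      have := Complex.abs_im_le_norm (z - 1)
      simp at this
      linarith
    have h2 := hζ.norm_le h (by linarith [hθw z a] : θ < z.re) h1
    have h3 : ‖z‖ ≤ 4 * Real.exp L := by
      have := Complex.norm_le_abs_re_add_abs_im z
      have h4 : |z.re| ≤ 2 := abs_le.2 ⟨by linarith, b.le⟩
      linarith
    have h5 : K₀ / (z.re - θ) ≤ K₀ / ((1 - θ) / 2) :=
      div_le_div_of_nonneg_left hK (by linarith) (hθw z a)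
    have h6 : 0 ≤ K₀ / ((1 - θ) / 2) := div_nonneg hK (by linarith)
    have h7 : 0 ≤ K₀ / (z.re - θ) := div_nonneg hK (by linarith [hθw z a])
    have h8 : ‖z‖ * (K₀ / (z.re - θ)) ≤ (4 * Real.exp L) * (K₀ / ((1 - θ) / 2)) := by gcongr
    have h9 : 2 * A ≤ 2 * A * Real.exp L := by nlinarith
    rw [hC₁]
    linarith
  have hz0 : ‖ζ ⟨1 + w, s.im⟩‖⁻¹ ≤ 2 * (A + K₀) * (2 * L / d) := by
    have h1 := hζ.norm_inv_le h (s := ⟨1 + w, s.im⟩) (by simpa using hw0)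
    refine h1.trans ?_
    simp only [add_sub_cancel_left]
    rw [mul_div_assoc, mul_assoc]
    have : (1 + w) / w ≤ 2 * (2 * L / d) := by
      rw [div_eq_mul_one_div]
      have : 0 < 1 / w := by positivity
      nlinarith
    have h3 : 0 ≤ A + K₀ := by linarith
    nlinarith
  have hz0ne : 0 < ‖ζ ⟨1 + w, s.im⟩‖ :=
    norm_pos_iff.2 (hζ.ne_zero h (s := ⟨1 + w, s.im⟩) (by simpa using hw0))
  have hM : C₂ * L * Real.exp L ≤ Real.exp ((|Real.log C₂| + 2) * L) := by
    have h1 : C₂ ≤ Real.exp (|Real.log C₂| * L) := by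
      rw [← Real.log_le_iff_le_exp hC₂0]
      have := le_abs_self (Real.log C₂)
      nlinarith [abs_nonneg (Real.log C₂)]
    have h2 : L ≤ Real.exp L := by linarith [Real.add_one_le_exp L]
    have h3 : (|Real.log C₂| + 2) * L = |Real.log C₂| * L + L + L := by ring
    rw [h3, Real.exp_add, Real.exp_add]
    gcongr
  have key := norm_logDeriv_le_of_ball (f := ζ) (z₀ := ⟨1 + w, s.im⟩) (z := s) (R := 2 * w)
    (M := (|Real.log C₂| + 2) * L) (by linarith) (by positivity) ?_ ?_ ?_ ?_
  · refine key.trans ?_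
    calc _ = 1260 * ((|Real.log C₂| + 2) * L) * (1 / w) := by field_simp; ring
      _ ≤ 1260 * ((|Real.log C₂| + 2) * L) * (2 * L / d) := by gcongr
      _ = _ := by ring
  · intro z hz
    obtain ⟨a, b, c, e⟩ := him z hz
    exact (hζ.differentiableAt (by linarith [hθw z a]) (hne1 z e)).differentiableWithinAt
  · intro z hz h0
    obtain ⟨a, b, c, e⟩ := him z hz
    refine hη L hL hwη z a c ?_
    rw [hζ.zetaReg_eq h (by linarith [hθw z a]) (hne1 z e), h0, mul_zero]
  · intro z hz
    refine (hbound z hz).trans ?_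
    rw [← div_le_iff₀ hz0ne, div_eq_mul_inv]
    refine le_trans ?_ hM
    calc _ ≤ C₁ * Real.exp L * (2 * (A + K₀) * (2 * L / d)) := by gcongr
      _ = _ := by rw [hC₂]; ring
  · have e : s - ⟨1 + w, s.im⟩ = ((s.re - (1 + w) : ℝ) : ℂ) := by
      apply Complex.ext <;> simp
    rw [e, Complex.norm_real, Real.norm_eq_abs, abs_of_nonpos (by linarith)]
    linarith

lemma integral_exp_mul_sq_norm_le {f : ℝ → ℂ} (hf : Integrable f)
    (hf2 : Integrable fun v => ‖f v‖ ^ 2) {b : ℝ} (hb : 0 < b) :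
    ∫ t : ℝ, Real.exp (-b * t ^ 2) * ‖∫ v : ℝ, f v * Complex.exp (-(t * v * Complex.I))‖ ^ 2 ≤
      2 * Real.pi * ∫ v, ‖f v‖ ^ 2 := by
  have hg : Integrable fun t : ℝ => Real.exp (-b * t ^ 2) := integrable_exp_neg_mul_sq hb
  set k : ℝ → ℝ := fun u => Real.sqrt (Real.pi / b) * Real.exp (-(1 / (4 * b)) * u ^ 2) with hk
  have hb4 : 0 < 1 / (4 * b) := by positivity
  have hkint : Integrable k := (integrable_exp_neg_mul_sq hb4).const_mul _
  have hkI : ∫ u, k u = 2 * Real.pi := by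
    rw [hk, integral_const_mul, integral_gaussian, ← Real.sqrt_mul (by positivity)]
    rw [show Real.pi / b * (Real.pi / (1 / (4 * b))) = (2 * Real.pi) ^ 2 by field_simp; ring]
    exact Real.sqrt_sq (by positivity)
  have hk0 : ∀ u, 0 ≤ k u := fun u => by positivity
  set Φ : ℝ → ℝ × ℝ → ℂ := fun t q =>
    (Real.exp (-b * t ^ 2) : ℂ) * (f q.1 * (starRingEnd ℂ) (f q.2)) *
      Complex.exp (-(t * (q.1 - q.2) * Complex.I)) with hΦ
  have hff : Integrable (fun q : ℝ × ℝ => f q.1 * (starRingEnd ℂ) (f q.2))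
      (volume.prod volume) := by
    refine hf.mul_prod (g := fun w => (starRingEnd ℂ) (f w)) ?_
    exact (Complex.conjCLE.toContinuousLinearMap.integrable_comp hf)
  have hΦi : Integrable (Function.uncurry Φ) (volume.prod (volume.prod volume)) := by
    have h1 : Integrable (fun z : ℝ × (ℝ × ℝ) => (Real.exp (-b * z.1 ^ 2) : ℂ) *
        (f z.2.1 * (starRingEnd ℂ) (f z.2.2))) (volume.prod (volume.prod volume)) :=
      hg.ofReal.mul_prod hff
    refine h1.mul_bdd (c := 1) ?_ (ae_of_all _ ?_)
    · exact Continuous.aestronglyMeasurable (by fun_prop)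
    · intro z
      rw [Complex.norm_exp]
      simp
  have hsq : ∀ t : ℝ, ((Real.exp (-b * t ^ 2) *
      ‖∫ v : ℝ, f v * Complex.exp (-(t * v * Complex.I))‖ ^ 2 : ℝ) : ℂ) = ∫ q, Φ t q ∂(volume.prod volume) := by
    intro t
    simp only [hΦ, mul_assoc]
    rw [integral_const_mul]
    push_cast
    congr 1
    rw [← Complex.mul_conj', ← integral_conj, ← integral_prod_mul]
    refine integral_congr_ae (ae_of_all _ fun q => ?_)
    simp only [map_mul, ← Complex.exp_conj, map_neg, Complex.conj_ofReal, Complex.conj_I]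
    rw [show (-(↑t * ((↑q.1 - ↑q.2) * Complex.I)) : ℂ) = -(↑t * (↑q.1 * Complex.I)) +
      -(↑t * (↑q.2 * -Complex.I)) by ring, Complex.exp_add]
    ring
  have hinner : ∀ q : ℝ × ℝ, ∫ t, Φ t q = f q.1 * (starRingEnd ℂ) (f q.2) * (k (q.1 - q.2) : ℂ) := by
    intro q
    have h1 := fourierIntegral_gaussian (b := (b : ℂ)) (by simpa using hb) (-(q.1 - q.2 : ℂ))
    have h2 : ∀ t : ℝ, Φ t q = f q.1 * (starRingEnd ℂ) (f q.2) *
        (Complex.exp (Complex.I * -(q.1 - q.2 : ℂ) * t) * Complex.exp (-(b : ℂ) * t ^ 2)) := by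
      intro t
      simp only [hΦ]
      push_cast
      rw [show Complex.I * -(↑q.1 - ↑q.2 : ℂ) * ↑t = -(t * (q.1 - q.2) * Complex.I) by ring]
      ring
    simp_rw [h2]
    rw [integral_const_mul, h1]
    congr 1
    simp only [hk]
    push_cast
    rw [Real.sqrt_eq_rpow, Complex.ofReal_cpow (by positivity)]
    push_cast
    congr 2
    ring
  have hcv : Integrable (fun p : ℝ × ℝ => ‖f p.2‖ ^ 2 * k (p.1 - p.2)) (volume.prod volume) := by
    simpa using hf2.convolution_integrand (ContinuousLinearMap.mul ℝ ℝ) hkint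
  have hcv' : Integrable (fun p : ℝ × ℝ => ‖f p.1‖ ^ 2 * k (p.1 - p.2)) (volume.prod volume) := by
    refine hcv.swap.congr (ae_of_all _ fun p => ?_)
    simp only [Function.comp, Prod.swap, hk]
    congr 3
    ring
  have hval : ∫ p : ℝ × ℝ, ‖f p.2‖ ^ 2 * k (p.1 - p.2) ∂(volume.prod volume) =
      2 * Real.pi * ∫ v, ‖f v‖ ^ 2 := by
    rw [integral_prod_symm _ hcv]
    simp only [integral_const_mul]
    have : ∀ w : ℝ, ∫ v, k (v - w) = 2 * Real.pi := fun w => by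
      rw [integral_sub_right_eq_self k w, hkI]
    simp only [this]
    rw [integral_mul_const]
    ring
  have hval' : ∫ p : ℝ × ℝ, ‖f p.1‖ ^ 2 * k (p.1 - p.2) ∂(volume.prod volume) =
      2 * Real.pi * ∫ v, ‖f v‖ ^ 2 := by
    rw [← hval, ← integral_prod_swap]
    refine integral_congr_ae (ae_of_all _ fun p => ?_)
    simp only [Prod.swap, hk]
    congr 3
    ring
  have hmain : ((∫ t : ℝ, Real.exp (-b * t ^ 2) *
      ‖∫ v : ℝ, f v * Complex.exp (-(t * v * Complex.I))‖ ^ 2 : ℝ) : ℂ) =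
      ∫ q : ℝ × ℝ, f q.1 * (starRingEnd ℂ) (f q.2) * (k (q.1 - q.2) : ℂ) ∂(volume.prod volume) := by
    rw [← integral_complex_ofReal]
    simp_rw [hsq]
    rw [integral_integral_swap hΦi]
    simp_rw [hinner]
  have h3 := congrArg Complex.re hmain
  rw [Complex.ofReal_re] at h3
  rw [h3]
  refine (Complex.re_le_norm _).trans ((norm_integral_le_integral_norm _).trans ?_)
  calc _ ≤ ∫ q : ℝ × ℝ, (1 / 2 * (‖f q.1‖ ^ 2 * k (q.1 - q.2)) +
        1 / 2 * (‖f q.2‖ ^ 2 * k (q.1 - q.2))) ∂(volume.prod volume) := by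
        refine integral_mono_of_nonneg (ae_of_all _ fun q => norm_nonneg _)
          ((hcv'.const_mul _).add (hcv.const_mul _)) (ae_of_all _ fun q => ?_)
        simp only [norm_mul, RCLike.norm_conj, Complex.norm_real, Real.norm_eq_abs,
          abs_of_nonneg (hk0 _)]
        have := two_mul_le_add_sq ‖f q.1‖ ‖f q.2‖
        nlinarith [hk0 (q.1 - q.2)]
    _ = _ := by
        rw [integral_add (hcv'.const_mul _) (hcv.const_mul _), integral_const_mul,
          integral_const_mul, hval, hval']
        ring

lemma continuous_fourier {f : ℝ → ℂ} (hf : Integrable f) :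
    Continuous fun t : ℝ => ∫ v : ℝ, f v * Complex.exp (-(t * v * Complex.I)) := by
  refine continuous_of_dominated (bound := fun v => ‖f v‖) ?_ ?_ hf.norm ?_
  · intro t
    exact hf.aestronglyMeasurable.mul (Continuous.aestronglyMeasurable (by fun_prop))
  · intro t
    refine ae_of_all _ fun v => ?_
    rw [norm_mul, Complex.norm_exp]
    simp
  · exact ae_of_all _ fun v => by fun_prop

/-- A Bessel type inequality for the Fourier transform. -/
lemma integral_sq_norm_fourier_le {f : ℝ → ℂ} (hf : Integrable f)
    (hf2 : Integrable fun v => ‖f v‖ ^ 2) {T : ℝ} (hT : 0 < T) :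
    ∫ t in (-T)..T, ‖∫ v : ℝ, f v * Complex.exp (-(t * v * Complex.I))‖ ^ 2 ≤
      2 * Real.pi * Real.exp 1 * ∫ v, ‖f v‖ ^ 2 := by
  have hb : 0 < 1 / T ^ 2 := by positivity
  have h1 := integral_exp_mul_sq_norm_le hf hf2 hb
  have hc := continuous_fourier hf
  set F : ℝ → ℂ := fun t => ∫ v : ℝ, f v * Complex.exp (-(t * v * Complex.I)) with hF
  have hbd : ∀ t, ‖F t‖ ≤ ∫ v, ‖f v‖ := by
    intro t
    refine (norm_integral_le_integral_norm _).trans_eq ?_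
    refine integral_congr_ae (ae_of_all _ fun v => ?_)
    simp only [norm_mul, Complex.norm_exp]
    simp
  have hInt : Integrable fun t : ℝ => Real.exp (-(1 / T ^ 2) * t ^ 2) * ‖F t‖ ^ 2 := by
    refine (integrable_exp_neg_mul_sq hb).mul_bdd (c := (∫ v, ‖f v‖) ^ 2)
      (Continuous.aestronglyMeasurable (by fun_prop)) (ae_of_all _ fun t => ?_)
    rw [Real.norm_eq_abs, abs_of_nonneg (by positivity)]
    exact pow_le_pow_left₀ (norm_nonneg _) (hbd t) 2
  calc _ ≤ ∫ t in (-T)..T, Real.exp 1 * (Real.exp (-(1 / T ^ 2) * t ^ 2) * ‖F t‖ ^ 2) := by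
        refine intervalIntegral.integral_mono_on (by linarith)
          ((hc.norm.pow 2).intervalIntegrable _ _)
          (Continuous.intervalIntegrable (by fun_prop) _ _) fun t ht => ?_
        rw [← mul_assoc, ← Real.exp_add]
        refine le_mul_of_one_le_left (by positivity) (Real.one_le_exp ?_)
        have : t ^ 2 ≤ T ^ 2 := sq_le_sq' ht.1 ht.2
        rw [neg_mul, one_div_mul_eq_div, ← sub_eq_add_neg, sub_nonneg]
        exact (div_le_one (by positivity)).2 this
    _ ≤ Real.exp 1 * ∫ t, (Real.exp (-(1 / T ^ 2) * t ^ 2) * ‖F t‖ ^ 2) := by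
        rw [intervalIntegral.integral_const_mul, intervalIntegral.integral_of_le (by linarith)]
        refine mul_le_mul_of_nonneg_left ?_ (Real.exp_pos _).le
        exact setIntegral_le_integral hInt (ae_of_all _ fun t => by positivity)
    _ ≤ _ := by
        have := mul_le_mul_of_nonneg_left h1 (Real.exp_pos 1).le
        linarith

lemma le_norm_integral_window {δ t : ℝ} (hδ : 0 < δ) (ht : |t| * δ ≤ 1) :
    δ ≤ ‖∫ u in Icc (-δ) δ, Complex.exp (-(t * u * Complex.I))‖ := by
  refine le_trans ?_ (Complex.re_le_norm _)
  have hi : IntegrableOn (fun u : ℝ => Complex.exp (-(t * u * Complex.I))) (Icc (-δ) δ) :=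
    (Continuous.continuousOn (by fun_prop)).integrableOn_compact isCompact_Icc
  rw [← RCLike.re_eq_complex_re, ← integral_re hi]
  have h1 : ∫ _ in Icc (-δ) δ, (1 / 2 : ℝ) = δ := by
    simp [Measure.real, hδ.le]
    ring
  refine h1.symm.trans_le ?_
  refine setIntegral_mono_on (integrableOn_const (by simp)) hi.re measurableSet_Icc fun u hu => ?_
  have h2 : (Complex.exp (-(t * u * Complex.I))).re = Real.cos (t * u) := by
    rw [← Real.cos_neg, ← Complex.exp_ofReal_mul_I_re]
    congr 2
    push_cast
    ring
  rw [RCLike.re_eq_complex_re, h2]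
  have h3 : (t * u) ^ 2 ≤ 1 := by
    rw [← sq_abs, abs_mul]
    refine pow_le_one₀ (by positivity) (le_trans ?_ ht)
    exact mul_le_mul_of_nonneg_left (abs_le.2 hu) (abs_nonneg _)
  linarith [Real.one_sub_sq_div_two_le_cos (x := t * u)]

/-- Gallagher's mean value inequality for finite exponential sums. -/
lemma integral_sq_norm_sum_exp_le {ι : Type*} (F : Finset ι) (a : ι → ℂ) (l c : ι → ℝ) {T : ℝ}
    (hT : 0 < T)
    (hc : ∀ n ∈ F, ((F.filter fun m => |l m - l n| ≤ 2 / T).card : ℝ) ≤ c n) :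
    ∫ t in (-T)..T, ‖∑ n ∈ F, a n * Complex.exp (-(t * l n * Complex.I))‖ ^ 2 ≤
      4 * Real.pi * Real.exp 1 * T * ∑ n ∈ F, ‖a n‖ ^ 2 * c n := by
  classical
  set δ : ℝ := 1 / T with hδ
  have hδ0 : 0 < δ := by positivity
  set f : ℝ → ℂ := fun v => ∑ n ∈ F, (Icc (l n - δ) (l n + δ)).indicator (fun _ => a n) v with hf
  have hind : ∀ (n : ι) (z : ℂ), Integrable ((Icc (l n - δ) (l n + δ)).indicator fun _ => z) := by
    intro n z
    rw [integrable_indicator_iff measurableSet_Icc]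
    simp
  have hindr : ∀ (n : ι) (z : ℝ), Integrable ((Icc (l n - δ) (l n + δ)).indicator fun _ => z) := by
    intro n z
    rw [integrable_indicator_iff measurableSet_Icc]
    simp
  have hfi : Integrable f := integrable_finsetSum _ fun n _ => hind n (a n)
  have hpt : ∀ v, ‖f v‖ ^ 2 ≤
      ∑ n ∈ F, (Icc (l n - δ) (l n + δ)).indicator (fun _ => ‖a n‖ ^ 2 * c n) v := by
    intro v
    set G := F.filter fun n => v ∈ Icc (l n - δ) (l n + δ) with hG
    have h1 : f v = ∑ n ∈ G, a n := by
      simp only [hf, hG, Finset.sum_filter, indicator_apply]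
    rw [h1]
    have h2 : ∑ n ∈ F, (Icc (l n - δ) (l n + δ)).indicator (fun _ => ‖a n‖ ^ 2 * c n) v =
        ∑ n ∈ G, ‖a n‖ ^ 2 * c n := by
      simp only [hG, Finset.sum_filter, indicator_apply]
    rw [h2]
    calc _ ≤ (∑ n ∈ G, ‖a n‖) ^ 2 := by gcongr; exact norm_sum_le _ _
      _ ≤ G.card * ∑ n ∈ G, ‖a n‖ ^ 2 := sq_sum_le_card_mul_sum_sq
      _ = ∑ n ∈ G, ‖a n‖ ^ 2 * G.card := by rw [Finset.mul_sum]; simp only [mul_comm]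
      _ ≤ _ := by
        refine Finset.sum_le_sum fun n hn => ?_
        have hn' := Finset.mem_filter.1 hn
        refine mul_le_mul_of_nonneg_left (le_trans ?_ (hc n hn'.1)) (by positivity)
        norm_cast
        refine Finset.card_le_card fun m hm => ?_
        have hm' := Finset.mem_filter.1 hm
        refine Finset.mem_filter.2 ⟨hm'.1, ?_⟩
        rw [show (2 : ℝ) / T = 2 * δ by rw [hδ]; ring, abs_le]
        have e1 := hn'.2
        have e2 := hm'.2
        constructor <;> linarith [e1.1, e1.2, e2.1, e2.2]
  have hbi : Integrable fun v =>
      ∑ n ∈ F, (Icc (l n - δ) (l n + δ)).indicator (fun _ => ‖a n‖ ^ 2 * c n) v :=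
    integrable_finsetSum _ fun n _ => hindr n _
  have hf2 : Integrable fun v => ‖f v‖ ^ 2 :=
    hbi.mono' (hfi.aestronglyMeasurable.norm.pow 2) (ae_of_all _ fun v => by
      rw [Real.norm_eq_abs, abs_of_nonneg (by positivity)]
      exact hpt v)
  have hf2I : ∫ v, ‖f v‖ ^ 2 ≤ 2 * δ * ∑ n ∈ F, ‖a n‖ ^ 2 * c n := by
    refine (integral_mono hf2 hbi hpt).trans_eq ?_
    rw [integral_finsetSum _ fun n _ => hindr n _, Finset.mul_sum]
    refine Finset.sum_congr rfl fun n _ => ?_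
    rw [integral_indicator measurableSet_Icc]
    simp only [integral_const, smul_eq_mul, measureReal_restrict_apply_univ,
      Real.volume_real_Icc_of_le (show l n - δ ≤ l n + δ by linarith)]
    ring
  have hFT : ∀ t : ℝ, ∫ v : ℝ, f v * Complex.exp (-(t * v * Complex.I)) =
      (∑ n ∈ F, a n * Complex.exp (-(t * l n * Complex.I))) *
        ∫ u in Icc (-δ) δ, Complex.exp (-(t * u * Complex.I)) := by
    intro t
    have e1 : ∀ v : ℝ, f v * Complex.exp (-(t * v * Complex.I)) =
        ∑ n ∈ F, (Icc (l n - δ) (l n + δ)).indicator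
          (fun v : ℝ => a n * Complex.exp (-(t * v * Complex.I))) v := by
      intro v
      simp only [hf, Finset.sum_mul]
      refine Finset.sum_congr rfl fun n _ => ?_
      by_cases hv : v ∈ Icc (l n - δ) (l n + δ) <;> simp [hv]
    simp_rw [e1]
    rw [integral_finsetSum, Finset.sum_mul]
    · refine Finset.sum_congr rfl fun n _ => ?_
      rw [← integral_indicator measurableSet_Icc, ← integral_const_mul,
        ← integral_add_right_eq_self _ (l n)]
      refine integral_congr_ae (ae_of_all _ fun u => ?_)
      have hiff : u + l n ∈ Icc (l n - δ) (l n + δ) ↔ u ∈ Icc (-δ) δ := by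
        simp only [mem_Icc]
        constructor <;> rintro ⟨x, y⟩ <;> constructor <;> linarith
      by_cases hu : u ∈ Icc (-δ) δ
      · simp only [indicator_of_mem hu, indicator_of_mem (hiff.2 hu)]
        rw [mul_assoc (a n), ← Complex.exp_add]
        congr 2
        push_cast
        ring
      · simp only [indicator_of_notMem hu, indicator_of_notMem (fun h => hu (hiff.1 h)), mul_zero]
    · intro n _
      rw [integrable_indicator_iff measurableSet_Icc]
      exact (Continuous.continuousOn (by fun_prop)).integrableOn_compact isCompact_Icc
  have hmain := integral_sq_norm_fourier_le hfi hf2 hT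
  have hcont : Continuous fun t : ℝ => ‖∑ n ∈ F, a n * Complex.exp (-(t * l n * Complex.I))‖ ^ 2 := by
    fun_prop
  have hlow : δ ^ 2 * ∫ t in (-T)..T, ‖∑ n ∈ F, a n * Complex.exp (-(t * l n * Complex.I))‖ ^ 2 ≤
      ∫ t in (-T)..T, ‖∫ v : ℝ, f v * Complex.exp (-(t * v * Complex.I))‖ ^ 2 := by
    rw [← intervalIntegral.integral_const_mul]
    refine intervalIntegral.integral_mono_on (by linarith)
      ((hcont.const_mul _).intervalIntegrable _ _)
      (((continuous_fourier hfi).norm.pow 2).intervalIntegrable _ _) fun t ht => ?_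
    rw [hFT, norm_mul, mul_pow, mul_comm]
    refine mul_le_mul_of_nonneg_left ?_ (by positivity)
    refine pow_le_pow_left₀ hδ0.le (le_norm_integral_window hδ0 ?_) 2
    rw [hδ, mul_one_div]
    exact (div_le_one hT).2 (abs_le.2 ht)
  set X := ∫ t in (-T)..T, ‖∑ n ∈ F, a n * Complex.exp (-(t * l n * Complex.I))‖ ^ 2
  set W := ∑ n ∈ F, ‖a n‖ ^ 2 * c n
  have h5 : δ ^ 2 * X ≤ 2 * Real.pi * Real.exp 1 * (2 * δ * W) :=
    hlow.trans (hmain.trans (mul_le_mul_of_nonneg_left hf2I (by positivity)))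
  have h6 : T ^ 2 * (δ ^ 2 * X) = X := by rw [hδ]; field_simp
  rw [← h6]
  refine (mul_le_mul_of_nonneg_left h5 (by positivity)).trans_eq ?_
  rw [hδ]
  field_simp
  ring

/-- Mean values of Dirichlet polynomials over generalized integers. -/
lemma WellBehaved.integral_sq_norm_sum_le (h : S.WellBehaved A θ K₀) (F : Finset (ℕ →₀ ℕ))
    (a : (ℕ →₀ ℕ) → ℂ) {T σ W : ℝ} (hT : 1 ≤ T)
    (hW : ∀ n ∈ F, a n ≠ 0 → S.val n ^ (2 - 2 * σ) + T * S.val n ^ (1 + θ - 2 * σ) ≤ W) :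
    ∫ t in (-T)..T, ‖∑ n ∈ F, a n * (S.val n : ℂ) ^ (-(σ + t * Complex.I))‖ ^ 2 ≤
      4 * Real.pi * Real.exp 1 * (6 * Real.exp 2 * (2 * A + 2 * K₀)) * W *
        ∑ n ∈ F, ‖a n‖ ^ 2 / S.val n := by
  have hA : 0 < A := h.1
  have hK : 0 ≤ K₀ := h.2.2.2.1
  have hT0 : 0 < T := by linarith
  have h1 := integral_sq_norm_sum_exp_le F (fun n => a n * (S.val n : ℂ) ^ (-(σ : ℂ)))
    (fun n => Real.log (S.val n))
    (fun n => 3 * Real.exp 2 * (2 * A + 2 * K₀) * (S.val n * (2 / T) + S.val n ^ θ)) hT0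
    (fun n _ => h.card_near_le F (by positivity) ((div_le_iff₀ hT0).2 (by linarith)) n)
  have h2 : ∀ t : ℝ, ∑ n ∈ F, a n * (S.val n : ℂ) ^ (-(σ + t * Complex.I)) =
      ∑ n ∈ F, a n * (S.val n : ℂ) ^ (-(σ : ℂ)) *
        Complex.exp (-(t * Real.log (S.val n) * Complex.I)) := by
    intro t
    refine Finset.sum_congr rfl fun n _ => ?_
    have hv : (S.val n : ℂ) ≠ 0 := by exact_mod_cast (S.val_pos n).ne'
    rw [neg_add, Complex.cpow_add _ _ hv, mul_assoc]
    congr 2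
    rw [Complex.cpow_def_of_ne_zero hv, ← Complex.ofReal_log (S.val_pos n).le]
    congr 1
    ring
  simp_rw [h2]
  refine h1.trans ?_
  rw [mul_assoc, mul_assoc (4 * Real.pi * Real.exp 1), mul_assoc (4 * Real.pi * Real.exp 1)]
  refine mul_le_mul_of_nonneg_left ?_ (by positivity)
  rw [Finset.mul_sum, Finset.mul_sum]
  refine Finset.sum_le_sum fun n hn => ?_
  have hv := S.val_pos n
  by_cases ha : a n = 0
  · simp [ha]
  have hWn := hW n hn ha
  set x := S.val n ^ (-(2 * σ)) with hx
  have hx0 : 0 ≤ x := by positivity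
  have e1 : S.val n ^ (2 - 2 * σ) = S.val n * S.val n * x := by
    rw [show 2 - 2 * σ = 1 + (1 + -(2 * σ)) by ring, Real.rpow_add hv, Real.rpow_add hv,
      Real.rpow_one, mul_assoc]
  have e2 : S.val n ^ (1 + θ - 2 * σ) = S.val n * S.val n ^ θ * x := by
    rw [show 1 + θ - 2 * σ = 1 + (θ + -(2 * σ)) by ring, Real.rpow_add hv, Real.rpow_add hv,
      Real.rpow_one, mul_assoc]
  have e3 : ‖a n * (S.val n : ℂ) ^ (-(σ : ℂ))‖ ^ 2 = ‖a n‖ ^ 2 * x := by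
    rw [norm_mul, Complex.norm_cpow_eq_rpow_re_of_pos hv, mul_pow, ← Real.rpow_natCast,
      ← Real.rpow_natCast (_ ^ _), ← Real.rpow_mul hv.le, hx]
    congr 2
    simp
    ring
  rw [e1, e2] at hWn
  rw [e3]
  set B := 3 * Real.exp 2 * (2 * A + 2 * K₀) with hB
  have hB0 : 0 ≤ B := by positivity
  have e4 : T * (‖a n‖ ^ 2 * x * (B * (S.val n * (2 / T) + S.val n ^ θ))) =
      B * (‖a n‖ ^ 2 / S.val n) * (2 * (S.val n * S.val n * x) + T * (S.val n * S.val n ^ θ * x)) := by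
    field_simp
  rw [e4, show 6 * Real.exp 2 * (2 * A + 2 * K₀) * W * (‖a n‖ ^ 2 / S.val n) =
    B * (‖a n‖ ^ 2 / S.val n) * (2 * W) by rw [hB]; ring]
  refine mul_le_mul_of_nonneg_left ?_ (by positivity)
  have : 0 ≤ T * (S.val n * S.val n ^ θ * x) := by positivity
  linarith

lemma WellBehaved.sum_inv_le (h : S.WellBehaved A θ K₀) {X : ℝ} (hX : 1 < X) :
    ∑ n ∈ S.below X, (S.val n)⁻¹ ≤ Real.exp 1 * (A + K₀) * (Real.log X + 1) := by
  have hl : 0 < Real.log X := Real.log_pos hX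
  have hσ : 1 < 1 + 1 / Real.log X := by linarith [one_div_pos.2 hl]
  have h1 := h.tsum_rpow_le hσ
  have h2 : ∀ n ∈ S.below X, (S.val n)⁻¹ ≤ Real.exp 1 * S.val n ^ (-(1 + 1 / Real.log X)) := by
    intro n hn
    rw [mem_below] at hn
    have hv := S.val_pos n
    rw [neg_add, Real.rpow_add hv, Real.rpow_neg_one, mul_left_comm]
    refine le_mul_of_one_le_right (by positivity) ?_
    rw [Real.rpow_def_of_pos hv, ← Real.exp_add]
    refine Real.one_le_exp ?_
    have : Real.log (S.val n) ≤ Real.log X := Real.log_le_log hv hn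
    have h3 : Real.log (S.val n) / Real.log X ≤ 1 := (div_le_one hl).2 this
    have h4 : Real.log (S.val n) * -(1 / Real.log X) = -(Real.log (S.val n) / Real.log X) := by ring
    linarith
  refine (Finset.sum_le_sum h2).trans ?_
  rw [← Finset.mul_sum]
  have h3 : ∑ n ∈ S.below X, S.val n ^ (-(1 + 1 / Real.log X)) ≤
      ∑' n, S.val n ^ (-(1 + 1 / Real.log X)) :=
    (h.summable_rpow hσ).sum_le_tsum _ fun n _ => (Real.rpow_pos_of_pos (S.val_pos n) _).le
  refine (mul_le_mul_of_nonneg_left (h3.trans h1) (Real.exp_pos 1).le).trans_eq ?_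
  field_simp
  ring

/-- The Dirichlet polynomial over generalized integers up to `Y` with coefficients `b`. -/
noncomputable def dirPoly (S : BeurlingSystem) (Y : ℝ) (b : (ℕ →₀ ℕ) → ℂ) (s : ℂ) : ℂ :=
  ∑ n ∈ S.below Y, b n * (S.val n : ℂ) ^ (-s)

lemma WellBehaved.norm_dirPoly_le (h : S.WellBehaved A θ K₀) {Y B : ℝ} (hY : 1 < Y)
    {b : (ℕ →₀ ℕ) → ℂ} (hb : ∀ n ∈ S.below Y, ‖b n‖ ≤ B) (hB : 0 ≤ B) {s : ℂ} (hs : s.re ≤ 1) :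
    ‖S.dirPoly Y b s‖ ≤ B * Y ^ (1 - s.re) * (Real.exp 1 * (A + K₀) * (Real.log Y + 1)) := by
  calc _ ≤ ∑ n ∈ S.below Y, B * Y ^ (1 - s.re) * (S.val n)⁻¹ := by
        refine norm_sum_le_of_le _ fun n hn => ?_
        have hv := S.val_pos n
        rw [norm_mul, norm_val_cpow, mul_assoc]
        refine mul_le_mul (hb n hn) ?_ (by positivity) hB
        rw [show -s.re = (1 - s.re) + -1 by ring, Real.rpow_add hv, Real.rpow_neg_one]
        refine mul_le_mul_of_nonneg_right ?_ (by positivity)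
        exact Real.rpow_le_rpow hv.le ((S.mem_below).1 hn) (by linarith)
    _ = B * Y ^ (1 - s.re) * ∑ n ∈ S.below Y, (S.val n)⁻¹ := by rw [Finset.mul_sum]
    _ ≤ _ := mul_le_mul_of_nonneg_left (h.sum_inv_le hY) (by positivity)

lemma differentiable_dirPoly (Y : ℝ) (b : (ℕ →₀ ℕ) → ℂ) : Differentiable ℂ (S.dirPoly Y b) := by
  unfold dirPoly
  refine Differentiable.fun_sum fun n _ => ?_
  exact (differentiable_const _).mul fun s => S.differentiableAt_val_cpow n s

lemma hasDerivAt_dirPoly (Y : ℝ) (b : (ℕ →₀ ℕ) → ℂ) (s : ℂ) :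
    HasDerivAt (S.dirPoly Y b)
      (S.dirPoly Y (fun n => -((Real.log (S.val n) : ℂ) * b n)) s) s := by
  unfold dirPoly
  refine HasDerivAt.fun_sum fun n _ => ?_
  have hv : (S.val n : ℂ) ≠ 0 := by exact_mod_cast (S.val_pos n).ne'
  have h1 := ((hasDerivAt_id s).fun_neg.const_cpow (c := (S.val n : ℂ)) (Or.inl hv)).const_mul (b n)
  refine h1.congr_deriv ?_
  simp only [id]
  rw [Complex.ofReal_log (S.val_pos n).le]
  ring

/-- The coefficients of the product of the truncated zeta sum and a Dirichlet polynomial. -/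
noncomputable def prodCoeff (S : BeurlingSystem) (Y : ℝ) (b : (ℕ →₀ ℕ) → ℂ) (n : ℕ →₀ ℕ) : ℂ :=
  ∑ q ∈ (Finset.HasAntidiagonal.antidiagonal n).filter
    (fun q => S.val q.1 ≤ Y ∧ S.val q.2 ≤ Y), b q.1

lemma zetaSum_mul_dirPoly {Y : ℝ} (hY : 1 ≤ Y) (b : (ℕ →₀ ℕ) → ℂ) (s : ℂ) :
    S.zetaSum Y s * S.dirPoly Y b s = S.dirPoly (Y ^ 2) (S.prodCoeff Y b) s := by
  unfold zetaSum dirPoly prodCoeff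
  rw [mul_comm, Finset.sum_mul_sum, ← Finset.sum_product',
    sum_below_antidiagonal Y hY (fun q => b q.1 * (S.val q.1 : ℂ) ^ (-s) * (S.val q.2 : ℂ) ^ (-s))]
  refine Finset.sum_congr rfl fun n _ => ?_
  rw [Finset.sum_mul]
  refine Finset.sum_congr rfl fun q hq => ?_
  have hq' := (Finset.HasAntidiagonal.mem_antidiagonal).1 (Finset.mem_filter.1 hq).1
  rw [← hq', val_add, mul_assoc]
  congr 1
  push_cast
  rw [Complex.mul_cpow_ofReal_nonneg (S.val_pos _).le (S.val_pos _).le]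

lemma norm_prodCoeff_le {Y B : ℝ} {b : (ℕ →₀ ℕ) → ℂ} (hb : ∀ n ∈ S.below Y, ‖b n‖ ≤ B)
    (hB : 0 ≤ B) (n : ℕ →₀ ℕ) :
    ‖S.prodCoeff Y b n‖ ≤ B * (Finset.HasAntidiagonal.antidiagonal n).card := by
  unfold prodCoeff
  refine (norm_sum_le_of_le _ (f := fun q : (ℕ →₀ ℕ) × (ℕ →₀ ℕ) => b q.1) (n := fun _ => B) fun q hq => ?_).trans ?_
  · exact hb _ (by rw [mem_below]; exact (Finset.mem_filter.1 hq).2.1)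
  · rw [Finset.sum_const, nsmul_eq_mul, mul_comm]
    refine mul_le_mul_of_nonneg_left ?_ hB
    exact_mod_cast Finset.card_filter_le _ _

lemma prodCoeff_gMoebius {Y : ℝ} {n : ℕ →₀ ℕ} (hn : S.val n ≤ Y) :
    S.prodCoeff Y (fun n => (gMoebius n : ℂ)) n = if n = 0 then 1 else 0 := by
  unfold prodCoeff
  rw [Finset.filter_true_of_mem]
  · have := sum_antidiagonal_gMoebius n
    rw [← Complex.ofReal_sum, this]
    split_ifs <;> simp
  · intro q hq
    have hq' := (Finset.HasAntidiagonal.mem_antidiagonal).1 hq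
    rw [← hq', val_add] at hn
    have h1 := S.one_le_val q.1
    have h2 := S.one_le_val q.2
    constructor <;> nlinarith

/-- Coefficients of `1` minus the truncated zeta sum times the truncated Möbius sum. -/
noncomputable def remCoeff (S : BeurlingSystem) (Y : ℝ) (n : ℕ →₀ ℕ) : ℂ :=
  if S.val n ≤ Y then 0 else -S.prodCoeff Y (fun n => (gMoebius n : ℂ)) n

lemma one_sub_zetaSum_mul {Y : ℝ} (hY : 1 ≤ Y) (s : ℂ) :
    1 - S.zetaSum Y s * S.dirPoly Y (fun n => (gMoebius n : ℂ)) s =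
      S.dirPoly (Y ^ 2) (S.remCoeff Y) s := by
  rw [zetaSum_mul_dirPoly hY]
  have h0 : (0 : ℕ →₀ ℕ) ∈ S.below (Y ^ 2) := by
    rw [mem_below, val_zero]
    nlinarith
  have h1 : (1 : ℂ) = ∑ n ∈ S.below (Y ^ 2), (if n = 0 then 1 else 0) * (S.val n : ℂ) ^ (-s) := by
    simp only [ite_mul, one_mul, zero_mul, Finset.sum_ite_eq', h0, if_true]
    simp
  conv_lhs => rw [h1]
  unfold dirPoly
  rw [← Finset.sum_sub_distrib]
  refine Finset.sum_congr rfl fun n _ => ?_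
  unfold remCoeff
  rw [← sub_mul]
  congr 1
  by_cases hn : S.val n ≤ Y
  · rw [prodCoeff_gMoebius hn, if_pos hn, sub_self]
  · rw [if_neg hn, if_neg, zero_sub]
    rintro rfl
    rw [val_zero] at hn
    exact hn hY

lemma norm_gMoebius_le (n : ℕ →₀ ℕ) : ‖(gMoebius n : ℂ)‖ ≤ 1 := by
  rw [Complex.norm_real]
  exact abs_gMoebius_le n

lemma norm_remCoeff_le (Y : ℝ) (n : ℕ →₀ ℕ) :
    ‖S.remCoeff Y n‖ ≤ 1 * (Finset.HasAntidiagonal.antidiagonal n).card := by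
  unfold remCoeff
  split_ifs
  · simp
  · rw [norm_neg]
    exact norm_prodCoeff_le (fun n _ => norm_gMoebius_le n) zero_le_one n

/-- Mean values of Dirichlet polynomials with divisor bounded coefficients. -/
lemma WellBehaved.integral_sq_norm_dirPoly_le (h : S.WellBehaved A θ K₀) {Z : ℝ} (hZ : 1 < Z)
    {a : (ℕ →₀ ℕ) → ℂ} {T σ W B : ℝ} (hT : 1 ≤ T) (hW0 : 0 ≤ W)
    (hB : ∀ n, ‖a n‖ ≤ B * (Finset.HasAntidiagonal.antidiagonal n).card)
    (hW : ∀ n ∈ S.below Z, a n ≠ 0 → S.val n ^ (2 - 2 * σ) + T * S.val n ^ (1 + θ - 2 * σ) ≤ W) :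
    ∫ t in (-T)..T, ‖S.dirPoly Z a (σ + t * Complex.I)‖ ^ 2 ≤
      4 * Real.pi * Real.exp 1 * (6 * Real.exp 2 * (2 * A + 2 * K₀)) * W *
        (B ^ 2 * (Real.exp 1 * (A + K₀) * (Real.log Z + 1)) ^ 4) := by
  have hA : 0 < A := h.1
  have hK : 0 ≤ K₀ := h.2.2.2.1
  refine (h.integral_sq_norm_sum_le _ a hT hW).trans ?_
  refine mul_le_mul_of_nonneg_left ?_ (by positivity)
  calc _ ≤ ∑ n ∈ S.below Z, B ^ 2 *
        (((Finset.HasAntidiagonal.antidiagonal n).card : ℝ) ^ 2 / S.val n) := by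
        refine Finset.sum_le_sum fun n _ => ?_
        rw [← mul_div_assoc, ← mul_pow]
        have := S.val_pos n
        gcongr
        exact hB n
    _ = B ^ 2 * ∑ n ∈ S.below Z,
        (((Finset.HasAntidiagonal.antidiagonal n).card : ℝ) ^ 2 / S.val n) := by
        rw [Finset.mul_sum]
    _ ≤ _ := by
        refine mul_le_mul_of_nonneg_left ((sum_card_antidiagonal_le Z hZ.le).trans ?_) (by positivity)
        refine pow_le_pow_left₀ (Finset.sum_nonneg fun n _ => ?_) (h.sum_inv_le hZ) 4
        have := S.val_pos n
        positivity

/-- The exponentially weighted error term, whose Fourier transform is `errInt`. -/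
noncomputable def expErr (S : BeurlingSystem) (A Y σ v : ℝ) : ℂ :=
  (Ioi (Real.log Y)).indicator (fun v => ((S.err A (Real.exp v) * Real.exp (-(σ * v)) : ℝ) : ℂ)) v

lemma errInt_eq_fourier {Y : ℝ} (hY : 1 ≤ Y) (σ t : ℝ) :
    S.errInt A Y (σ + t * Complex.I) =
      ∫ v : ℝ, S.expErr A Y σ v * Complex.exp (-(t * v * Complex.I)) := by
  have h1 : Ioi Y = Real.exp '' Ioi (Real.log Y) := by
    rw [Real.image_exp_Ioi, Real.exp_log (by linarith)]
  unfold errInt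
  rw [h1, integral_image_eq_integral_abs_deriv_smul measurableSet_Ioi
    (fun x _ => (Real.hasDerivAt_exp x).hasDerivWithinAt) Real.exp_injective.injOn,
    ← integral_indicator measurableSet_Ioi]
  refine integral_congr_ae (ae_of_all _ fun v => ?_)
  unfold expErr
  by_cases hv : v ∈ Ioi (Real.log Y)
  · simp only [indicator_of_mem hv]
    rw [abs_of_pos (Real.exp_pos v), Complex.real_smul, Complex.cpow_def_of_ne_zero (by simp),
      ← Complex.ofReal_log (Real.exp_pos v).le, Real.log_exp]
    push_cast
    rw [mul_left_comm, mul_assoc, ← Complex.exp_add, ← Complex.exp_add]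
    congr 2
    ring
  · simp [indicator_of_notMem hv]

lemma WellBehaved.norm_expErr_le (h : S.WellBehaved A θ K₀) {Y : ℝ} (hY : 1 ≤ Y) (σ v : ℝ) :
    ‖S.expErr A Y σ v‖ ≤
      (Ioi (Real.log Y)).indicator (fun v => K₀ * Real.exp (-(σ - θ) * v)) v := by
  unfold expErr
  by_cases hv : v ∈ Ioi (Real.log Y)
  · simp only [indicator_of_mem hv]
    rw [Complex.norm_real, norm_mul, Real.norm_eq_abs, Real.norm_eq_abs, Real.abs_exp]
    have hv0 : 0 ≤ v := (Real.log_nonneg hY).trans (le_of_lt hv)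
    refine (mul_le_mul_of_nonneg_right (h.abs_err_le (Real.one_le_exp hv0))
      (Real.exp_pos _).le).trans_eq ?_
    rw [← Real.exp_mul, mul_assoc, ← Real.exp_add]
    congr 2
    ring
  · simp [indicator_of_notMem hv]

lemma measurable_expErr (Y σ : ℝ) : Measurable (S.expErr A Y σ) := by
  unfold expErr
  refine Measurable.indicator ?_ measurableSet_Ioi
  refine Complex.measurable_ofReal.comp (Measurable.mul ?_ (by fun_prop))
  exact (S.measurable_err A).comp Real.measurable_exp

lemma WellBehaved.integrable_expErr (h : S.WellBehaved A θ K₀) {Y : ℝ} (hY : 1 ≤ Y) {σ : ℝ}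
    (hσ : θ < σ) : Integrable (S.expErr A Y σ) := by
  refine Integrable.mono' ?_ (measurable_expErr Y σ).aestronglyMeasurable
    (ae_of_all _ (h.norm_expErr_le hY σ))
  rw [integrable_indicator_iff measurableSet_Ioi]
  exact (integrableOn_exp_mul_Ioi (by linarith) _).const_mul _

lemma WellBehaved.integral_sq_norm_expErr (h : S.WellBehaved A θ K₀) {Y : ℝ} (hY : 1 ≤ Y) {σ : ℝ}
    (hσ : θ < σ) : Integrable (fun v => ‖S.expErr A Y σ v‖ ^ 2) ∧
      ∫ v, ‖S.expErr A Y σ v‖ ^ 2 ≤ K₀ ^ 2 * Y ^ (-(2 * (σ - θ))) / (2 * (σ - θ)) := by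
  have hle : ∀ v, ‖S.expErr A Y σ v‖ ^ 2 ≤
      (Ioi (Real.log Y)).indicator (fun v => K₀ ^ 2 * Real.exp (-(2 * (σ - θ)) * v)) v := by
    intro v
    refine (pow_le_pow_left₀ (norm_nonneg _) (h.norm_expErr_le hY σ v) 2).trans_eq ?_
    by_cases hv : v ∈ Ioi (Real.log Y)
    · simp only [indicator_of_mem hv]
      rw [mul_pow, ← Real.exp_nat_mul]
      congr 2
      push_cast
      ring
    · simp [indicator_of_notMem hv]
  have hInt : Integrable
      ((Ioi (Real.log Y)).indicator (fun v => K₀ ^ 2 * Real.exp (-(2 * (σ - θ)) * v))) := by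
    rw [integrable_indicator_iff measurableSet_Ioi]
    exact (integrableOn_exp_mul_Ioi (by linarith) _).const_mul _
  have hi : Integrable (fun v => ‖S.expErr A Y σ v‖ ^ 2) :=
    hInt.mono' ((measurable_expErr Y σ).norm.pow_const 2).aestronglyMeasurable
      (ae_of_all _ fun v => by
        rw [Real.norm_eq_abs, abs_of_nonneg (by positivity)]
        exact hle v)
  refine ⟨hi, (integral_mono hi hInt hle).trans_eq ?_⟩
  rw [integral_indicator measurableSet_Ioi, integral_const_mul,
    integral_exp_mul_Ioi (by linarith), Real.rpow_def_of_pos (by linarith)]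
  rw [mul_comm (Real.log Y), neg_div_neg_eq, mul_div_assoc]

/-- The tail of the truncated representation of the zeta function. -/
noncomputable def zetaTail (S : BeurlingSystem) (A N : ℝ) (s : ℂ) : ℂ :=
  A * (N : ℂ) ^ (1 - s) / (s - 1) - S.err A N * (N : ℂ) ^ (-s) + s * S.errInt A N s

lemma zetaRep_eq (N : ℝ) (s : ℂ) : S.zetaRep A N s = S.zetaSum N s + S.zetaTail A N s := by
  unfold zetaRep zetaTail
  ring

lemma WellBehaved.continuous_zetaTail_line (h : S.WellBehaved A θ K₀) {Y : ℝ} (hY : 1 ≤ Y) {σ : ℝ}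
    (hσ : θ < σ) {a b : ℝ} (hab : ∀ t ∈ Icc a b, 1 ≤ |t|) :
    ContinuousOn (fun t : ℝ => S.zetaTail A Y (σ + t * Complex.I)) (Icc a b) := by
  have hY0 : (Y : ℂ) ≠ 0 := by exact_mod_cast (show Y ≠ 0 by linarith)
  have hc : Continuous fun t : ℝ => S.errInt A Y (σ + t * Complex.I) := by
    simp_rw [errInt_eq_fourier hY]
    exact continuous_fourier (h.integrable_expErr hY hσ)
  unfold zetaTail
  refine ContinuousOn.add (ContinuousOn.sub (ContinuousOn.div ?_ (by fun_prop) ?_) ?_) ?_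
  · exact Continuous.continuousOn (continuous_const.mul
      (Continuous.const_cpow (by fun_prop) (Or.inl hY0)))
  · intro t ht h0
    have h1 := congrArg Complex.im h0
    simp at h1
    have := hab t ht
    rw [h1] at this
    simp at this
    linarith
  · exact Continuous.continuousOn (continuous_const.mul
      (Continuous.const_cpow (by fun_prop) (Or.inl hY0)))
  · exact Continuous.continuousOn (by fun_prop)

lemma WellBehaved.sq_norm_zetaTail_le (h : S.WellBehaved A θ K₀) {Y : ℝ} (hY : 1 ≤ Y) {σ : ℝ}
    (hσ : |σ| ≤ 1) {t T : ℝ} (ht : 1 ≤ |t|) (htT : |t| ≤ T) :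
    ‖S.zetaTail A Y (σ + t * Complex.I)‖ ^ 2 ≤
      6 * A ^ 2 * Y ^ (2 - 2 * σ) * (1 + t ^ 2)⁻¹ + 3 * K₀ ^ 2 * Y ^ (2 * θ - 2 * σ) +
        6 * T ^ 2 * ‖S.errInt A Y (σ + t * Complex.I)‖ ^ 2 := by
  have hA : 0 < A := h.1
  have hK : 0 ≤ K₀ := h.2.2.2.1
  have hY0 : 0 < Y := by linarith
  have ht2 : 1 ≤ t ^ 2 := by rw [← sq_abs]; nlinarith
  have hT2 : t ^ 2 ≤ T ^ 2 := by
    rw [← sq_abs]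
    exact pow_le_pow_left₀ (abs_nonneg t) htT 2
  have hn1 : ‖(σ + t * Complex.I : ℂ)‖ ^ 2 ≤ 2 * T ^ 2 := by
    rw [Complex.sq_norm, Complex.normSq_apply]
    simp
    have : σ * σ ≤ 1 := by rw [← sq, ← sq_abs]; exact pow_le_one₀ (abs_nonneg _) hσ
    nlinarith
  have hn2 : t ^ 2 ≤ ‖(σ + t * Complex.I - 1 : ℂ)‖ ^ 2 := by
    rw [Complex.sq_norm, Complex.normSq_apply]
    simp
    nlinarith [sq_nonneg (σ - 1)]
  set s : ℂ := σ + t * Complex.I with hs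
  have hre : s.re = σ := by simp [hs]
  have e1 : ‖(A * (Y : ℂ) ^ (1 - s) / (s - 1))‖ ^ 2 ≤
      2 * A ^ 2 * Y ^ (2 - 2 * σ) * (1 + t ^ 2)⁻¹ := by
    rw [norm_div, norm_mul, Complex.norm_real, Real.norm_eq_abs, abs_of_pos hA,
      Complex.norm_cpow_eq_rpow_re_of_pos hY0, div_pow, mul_pow, ← Real.rpow_mul_natCast hY0.le]
    have e : ((1 - s).re * (2 : ℕ) : ℝ) = 2 - 2 * σ := by simp [hre]; ring
    rw [e, div_le_iff₀ (by linarith)]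
    have h3 : 1 ≤ 2 * (1 + t ^ 2)⁻¹ * ‖s - 1‖ ^ 2 := by
      rw [← div_eq_mul_inv, div_mul_eq_mul_div, le_div_iff₀ (by positivity)]
      linarith
    have h4 : 0 ≤ A ^ 2 * Y ^ (2 - 2 * σ) := by positivity
    calc _ ≤ A ^ 2 * Y ^ (2 - 2 * σ) * (2 * (1 + t ^ 2)⁻¹ * ‖s - 1‖ ^ 2) :=
          le_mul_of_one_le_right h4 h3
      _ = _ := by ring
  have e2 : ‖(S.err A Y * (Y : ℂ) ^ (-s) : ℂ)‖ ^ 2 ≤ K₀ ^ 2 * Y ^ (2 * θ - 2 * σ) := by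
    rw [norm_mul, Complex.norm_real, Real.norm_eq_abs, Complex.norm_cpow_eq_rpow_re_of_pos hY0]
    have h1 : |S.err A Y| * Y ^ (-s).re ≤ K₀ * Y ^ (θ - σ) := by
      refine (mul_le_mul_of_nonneg_right (h.abs_err_le hY) (by positivity)).trans_eq ?_
      rw [mul_assoc, ← Real.rpow_add hY0]
      simp [hre, sub_eq_add_neg]
    refine (pow_le_pow_left₀ (by positivity) h1 2).trans_eq ?_
    rw [mul_pow, ← Real.rpow_mul_natCast hY0.le]
    congr 2
    push_cast
    ring
  have e3 : ‖s * S.errInt A Y s‖ ^ 2 ≤ 2 * T ^ 2 * ‖S.errInt A Y s‖ ^ 2 := by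
    rw [norm_mul, mul_pow]
    gcongr
  unfold zetaTail
  have e4 := norm_add_le (A * (Y : ℂ) ^ (1 - s) / (s - 1) - S.err A Y * (Y : ℂ) ^ (-s))
    (s * S.errInt A Y s)
  have e5 := norm_sub_le (A * (Y : ℂ) ^ (1 - s) / (s - 1)) (S.err A Y * (Y : ℂ) ^ (-s))
  set x := ‖A * (Y : ℂ) ^ (1 - s) / (s - 1)‖
  set y := ‖(S.err A Y * (Y : ℂ) ^ (-s) : ℂ)‖
  set z := ‖s * S.errInt A Y s‖
  have e6 := pow_le_pow_left₀ (norm_nonneg _) (e4.trans (add_le_add_left e5 z)) 2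
  nlinarith [sq_nonneg (x - y), sq_nonneg (x - z), sq_nonneg (y - z)]

lemma WellBehaved.integral_sq_norm_zetaTail_le (h : S.WellBehaved A θ K₀) :
    ∃ C : ℝ, 0 < C ∧ ∀ Y T σ a b : ℝ, 1 ≤ Y → 1 ≤ T → T ≤ Y ^ (1 - θ) → (1 + θ) / 2 ≤ σ → σ ≤ 1 →
      -T ≤ a → a ≤ b → b ≤ T → (∀ t ∈ Icc a b, 1 ≤ |t|) →
      ∫ t in a..b, ‖S.zetaTail A Y (σ + t * Complex.I)‖ ^ 2 ≤ C * Y ^ (2 - 2 * σ) := by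
  have hA : 0 < A := h.1
  have hK : 0 ≤ K₀ := h.2.2.2.1
  have hθ0 : 0 ≤ θ := h.2.1
  have hθ1 : θ < 1 := h.2.2.1
  refine ⟨6 * A ^ 2 * Real.pi + 6 * K₀ ^ 2 +
    12 * Real.pi * Real.exp 1 * (K₀ ^ 2 / (1 - θ)), ?_, ?_⟩
  · have : 0 < 1 - θ := by linarith
    positivity
  intro Y T σ a b hY hT hTY hσ1 hσ2 ha hab hb hab1
  have hY0 : 0 < Y := by linarith
  have hσ : θ < σ := by linarith
  have hc : Continuous fun t : ℝ => S.errInt A Y (σ + t * Complex.I) := by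
    simp_rw [errInt_eq_fourier hY]
    exact continuous_fourier (h.integrable_expErr hY hσ)
  have hE : ∫ t in a..b, ‖S.errInt A Y (σ + t * Complex.I)‖ ^ 2 ≤
      2 * Real.pi * Real.exp 1 * (K₀ ^ 2 * Y ^ (-(2 * (σ - θ))) / (1 - θ)) := by
    obtain ⟨h1, h2⟩ := h.integral_sq_norm_expErr hY hσ
    have h3 := integral_sq_norm_fourier_le (h.integrable_expErr hY hσ) h1
      (show 0 < T by linarith)
    simp_rw [← errInt_eq_fourier hY] at h3
    have h4 : ∫ t in a..b, ‖S.errInt A Y (σ + t * Complex.I)‖ ^ 2 ≤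
        ∫ t in (-T)..T, ‖S.errInt A Y (σ + t * Complex.I)‖ ^ 2 :=
      intervalIntegral.integral_mono_interval ha hab hb
        (ae_of_all _ fun t => by positivity) ((hc.norm.pow 2).intervalIntegrable _ _)
    refine h4.trans (h3.trans (mul_le_mul_of_nonneg_left (h2.trans ?_) (by positivity)))
    exact div_le_div_of_nonneg_left (by positivity) (by linarith) (by linarith)
  have hcauchy : ∫ t in a..b, (1 + t ^ 2)⁻¹ ≤ Real.pi := by
    rw [intervalIntegral.integral_of_le hab, ← integral_univ_inv_one_add_sq]
    exact setIntegral_le_integral integrable_inv_one_add_sq (ae_of_all _ fun t => by positivity)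
  have hci : IntervalIntegrable (fun t : ℝ => (1 + t ^ 2)⁻¹) volume a b :=
    integrable_inv_one_add_sq.intervalIntegrable
  have hconst : IntervalIntegrable (fun _ : ℝ => 3 * K₀ ^ 2 * Y ^ (2 * θ - 2 * σ)) volume a b :=
    intervalIntegrable_const
  have hei : IntervalIntegrable (fun t : ℝ => ‖S.errInt A Y (σ + t * Complex.I)‖ ^ 2) volume a b :=
    (hc.norm.pow 2).intervalIntegrable _ _
  have hmono : ∫ t in a..b, ‖S.zetaTail A Y (σ + t * Complex.I)‖ ^ 2 ≤
      ∫ t in a..b, (6 * A ^ 2 * Y ^ (2 - 2 * σ) * (1 + t ^ 2)⁻¹ +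
        3 * K₀ ^ 2 * Y ^ (2 * θ - 2 * σ) +
        6 * T ^ 2 * ‖S.errInt A Y (σ + t * Complex.I)‖ ^ 2) := by
    refine intervalIntegral.integral_mono_on hab ?_
      (((hci.const_mul _).add hconst).add (hei.const_mul _)) fun t ht =>
        h.sq_norm_zetaTail_le hY (by rw [abs_le]; constructor <;> linarith) (hab1 t ht)
          (abs_le.2 ⟨ha.trans ht.1, ht.2.trans hb⟩)
    refine ContinuousOn.intervalIntegrable ?_
    rw [uIcc_of_le hab]
    exact (h.continuous_zetaTail_line hY hσ hab1).norm.pow 2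
  rw [intervalIntegral.integral_add ((hci.const_mul _).add hconst) (hei.const_mul _),
    intervalIntegral.integral_add (hci.const_mul _) hconst, intervalIntegral.integral_const_mul,
    intervalIntegral.integral_const, smul_eq_mul, intervalIntegral.integral_const_mul] at hmono
  refine hmono.trans ?_
  set P := Y ^ (2 - 2 * σ) with hP
  have hP0 : 0 < P := by positivity
  have t2 : (b - a) * (3 * K₀ ^ 2 * Y ^ (2 * θ - 2 * σ)) ≤ 6 * K₀ ^ 2 * P := by
    have h1 : b - a ≤ 2 * Y ^ (1 - θ) := by linarith
    have h2 : Y ^ (1 - θ) * Y ^ (2 * θ - 2 * σ) ≤ P := by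
      rw [← Real.rpow_add hY0]
      exact Real.rpow_le_rpow_of_exponent_le hY (by linarith)
    calc _ ≤ 2 * Y ^ (1 - θ) * (3 * K₀ ^ 2 * Y ^ (2 * θ - 2 * σ)) := by gcongr
      _ = 6 * K₀ ^ 2 * (Y ^ (1 - θ) * Y ^ (2 * θ - 2 * σ)) := by ring
      _ ≤ _ := by gcongr
  have t3 : 6 * T ^ 2 * ∫ t in a..b, ‖S.errInt A Y (σ + t * Complex.I)‖ ^ 2 ≤
      12 * Real.pi * Real.exp 1 * (K₀ ^ 2 / (1 - θ)) * P := by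
    have h1 : T ^ 2 * Y ^ (-(2 * (σ - θ))) ≤ P := by
      have : T ^ 2 ≤ Y ^ (2 * (1 - θ)) := by
        refine (pow_le_pow_left₀ (by linarith) hTY 2).trans_eq ?_
        rw [← Real.rpow_mul_natCast hY0.le]
        congr 1
        push_cast
        ring
      refine (mul_le_mul_of_nonneg_right this (by positivity)).trans_eq ?_
      rw [← Real.rpow_add hY0, hP]
      congr 1
      ring
    have h0 : 0 < 1 - θ := by linarith
    calc _ ≤ 6 * T ^ 2 * (2 * Real.pi * Real.exp 1 * (K₀ ^ 2 * Y ^ (-(2 * (σ - θ))) / (1 - θ))) := by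
          gcongr
      _ = 12 * Real.pi * Real.exp 1 * (K₀ ^ 2 / (1 - θ)) * (T ^ 2 * Y ^ (-(2 * (σ - θ)))) := by ring
      _ ≤ _ := by gcongr
  have t1 : 6 * A ^ 2 * P * ∫ t in a..b, (1 + t ^ 2)⁻¹ ≤ 6 * A ^ 2 * P * Real.pi := by gcongr
  linarith

lemma WellBehaved.log_add_one_le (h : S.WellBehaved A θ K₀) {L : ℝ} (hL : 1 ≤ L) :
    1 < Real.exp (L / (1 - θ)) ∧ Real.log (Real.exp (L / (1 - θ))) + 1 ≤ 2 / (1 - θ) * L ∧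
      Real.log (Real.exp (L / (1 - θ)) ^ 2) + 1 ≤ 3 / (1 - θ) * L := by
  have hθ0 : 0 ≤ θ := h.2.1
  have hθ1 : θ < 1 := h.2.2.1
  have h0 : 0 < 1 - θ := by linarith
  have h1 : 1 ≤ L / (1 - θ) := (one_le_div h0).2 (by linarith)
  refine ⟨Real.one_lt_exp_iff.2 (by linarith), ?_, ?_⟩
  · rw [Real.log_exp]
    have : 2 / (1 - θ) * L = L / (1 - θ) + L / (1 - θ) := by ring
    linarith
  · rw [Real.log_pow, Real.log_exp]
    have : 3 / (1 - θ) * L = L / (1 - θ) + L / (1 - θ) + L / (1 - θ) := by ring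
    push_cast
    linarith

lemma WellBehaved.exists_norm_dirPoly_le (h : S.WellBehaved A θ K₀) :
    ∃ C : ℝ, 0 < C ∧ ∀ (L B : ℝ) (b : (ℕ →₀ ℕ) → ℂ) (s : ℂ), 1 ≤ L → 0 ≤ B →
      (∀ n ∈ S.below (Real.exp (L / (1 - θ))), ‖b n‖ ≤ B) → s.re ≤ 1 →
      ‖S.dirPoly (Real.exp (L / (1 - θ))) b s‖ ≤
        C * B * L * Real.exp (L / (1 - θ)) ^ (1 - s.re) := by
  have hA : 0 < A := h.1
  have hK : 0 ≤ K₀ := h.2.2.2.1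
  have hθ1 : θ < 1 := h.2.2.1
  have h0 : 0 < 1 - θ := by linarith
  refine ⟨Real.exp 1 * (A + K₀) * (2 / (1 - θ)), by positivity, ?_⟩
  intro L B b s hL hB hb hs
  obtain ⟨h1, h2, -⟩ := h.log_add_one_le hL
  refine (h.norm_dirPoly_le h1 hb hB hs).trans ?_
  calc _ ≤ B * Real.exp (L / (1 - θ)) ^ (1 - s.re) *
        (Real.exp 1 * (A + K₀) * (2 / (1 - θ) * L)) := by gcongr
    _ = _ := by ring

lemma WellBehaved.exists_integral_mixed_le (h : S.WellBehaved A θ K₀) :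
    ∃ C : ℝ, 0 < C ∧ ∀ (L B W σ x y : ℝ) (b c : (ℕ →₀ ℕ) → ℂ), 1 ≤ L → 0 ≤ B → 0 ≤ W →
      (∀ n ∈ S.below (Real.exp (L / (1 - θ))), ‖b n‖ ≤ B) →
      (∀ n, ‖c n‖ ≤ B * (Finset.HasAntidiagonal.antidiagonal n).card) →
      (∀ n ∈ S.below (Real.exp (L / (1 - θ)) ^ 2), c n ≠ 0 →
        S.val n ^ (2 - 2 * σ) + Real.exp L * S.val n ^ (1 + θ - 2 * σ) ≤ W) →
      (1 + θ) / 2 ≤ σ → σ ≤ 1 → -Real.exp L ≤ x → x ≤ y → y ≤ Real.exp L →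
      (∀ t ∈ Icc x y, 1 ≤ |t|) →
      ∫ t in x..y, (2 * ‖S.dirPoly (Real.exp (L / (1 - θ)) ^ 2) c (σ + t * Complex.I)‖ ^ 2 +
        2 * ‖S.zetaTail A (Real.exp (L / (1 - θ))) (σ + t * Complex.I) *
          S.dirPoly (Real.exp (L / (1 - θ))) b (σ + t * Complex.I)‖ ^ 2) ≤
        C * B ^ 2 * L ^ 4 * (W + Real.exp (L / (1 - θ)) ^ (4 * (1 - σ))) := by
  have hA : 0 < A := h.1
  have hK : 0 ≤ K₀ := h.2.2.2.1
  have hθ1 : θ < 1 := h.2.2.1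
  have h0 : 0 < 1 - θ := by linarith
  obtain ⟨C₁, hC₁, hM⟩ := h.exists_norm_dirPoly_le
  obtain ⟨C₂, hC₂, hQ⟩ := h.integral_sq_norm_zetaTail_le
  set C₃ := 4 * Real.pi * Real.exp 1 * (6 * Real.exp 2 * (2 * A + 2 * K₀)) with hC₃
  set C₄ := (Real.exp 1 * (A + K₀) * (3 / (1 - θ))) ^ 4 with hC₄
  have hC₃0 : 0 < C₃ := by positivity
  have hC₄0 : 0 < C₄ := by positivity
  refine ⟨2 * (C₃ * C₄) + 2 * (C₂ * C₁ ^ 2), by positivity, ?_⟩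
  intro L B W σ x y b c hL hB hW hb hc hcW hσ1 hσ2 hx hxy hy hxy1
  obtain ⟨hY1, -, hY2⟩ := h.log_add_one_le hL
  set Y := Real.exp (L / (1 - θ)) with hY
  have hY0 : 0 < Y := by linarith
  have hσ : θ < σ := by linarith
  have hT1 : 1 ≤ Real.exp L := Real.one_le_exp (by linarith)
  have hTY : Real.exp L ≤ Y ^ (1 - θ) := by
    rw [hY, ← Real.exp_mul, div_mul_cancel₀ _ h0.ne']
  have hcd : ∀ (Z : ℝ) (b : (ℕ →₀ ℕ) → ℂ),
      Continuous fun t : ℝ => S.dirPoly Z b (σ + t * Complex.I) := fun Z b =>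
    (differentiable_dirPoly Z b).continuous.comp (by fun_prop)
  have hQc := h.continuous_zetaTail_line hY1.le hσ hxy1
  have hi1 : IntervalIntegrable (fun t : ℝ => ‖S.dirPoly (Y ^ 2) c (σ + t * Complex.I)‖ ^ 2)
      volume x y := ((hcd _ c).norm.pow 2).intervalIntegrable _ _
  have hi2 : IntervalIntegrable (fun t : ℝ => ‖S.zetaTail A Y (σ + t * Complex.I) *
      S.dirPoly Y b (σ + t * Complex.I)‖ ^ 2) volume x y := by
    refine ContinuousOn.intervalIntegrable ?_
    rw [uIcc_of_le hxy]
    exact (hQc.mul (hcd Y b).continuousOn).norm.pow 2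
  have hi3 : IntervalIntegrable (fun t : ℝ => ‖S.zetaTail A Y (σ + t * Complex.I)‖ ^ 2)
      volume x y := by
    refine ContinuousOn.intervalIntegrable ?_
    rw [uIcc_of_le hxy]
    exact hQc.norm.pow 2
  rw [intervalIntegral.integral_add (hi1.const_mul _) (hi2.const_mul _),
    intervalIntegral.integral_const_mul, intervalIntegral.integral_const_mul]
  have e1 : ∫ t in x..y, ‖S.dirPoly (Y ^ 2) c (σ + t * Complex.I)‖ ^ 2 ≤
      C₃ * W * (B ^ 2 * (C₄ * L ^ 4)) := by
    have e2 : ∫ t in x..y, ‖S.dirPoly (Y ^ 2) c (σ + t * Complex.I)‖ ^ 2 ≤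
        ∫ t in (-Real.exp L)..(Real.exp L), ‖S.dirPoly (Y ^ 2) c (σ + t * Complex.I)‖ ^ 2 :=
      intervalIntegral.integral_mono_interval hx hxy hy
        (ae_of_all _ fun t => by positivity) (((hcd _ c).norm.pow 2).intervalIntegrable _ _)
    have hZ : 1 < Y ^ 2 := one_lt_pow₀ hY1 (by norm_num)
    refine e2.trans ((h.integral_sq_norm_dirPoly_le hZ hT1 hW hc hcW).trans ?_)
    rw [hC₄, ← mul_pow, mul_assoc (Real.exp 1 * (A + K₀))]
    have : 0 ≤ Real.log (Y ^ 2) + 1 := by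
      have := Real.log_nonneg hZ.le
      linarith
    gcongr
  have e2 : ∫ t in x..y, ‖S.zetaTail A Y (σ + t * Complex.I) *
      S.dirPoly Y b (σ + t * Complex.I)‖ ^ 2 ≤ (C₁ * B * L * Y ^ (1 - σ)) ^ 2 * (C₂ * Y ^ (2 - 2 * σ)) := by
    refine le_trans ?_ (mul_le_mul_of_nonneg_left
      (hQ Y _ σ x y hY1.le hT1 hTY hσ1 hσ2 hx hxy hy hxy1) (by positivity))
    rw [← intervalIntegral.integral_const_mul]
    refine intervalIntegral.integral_mono_on hxy hi2 (hi3.const_mul _) fun t _ => ?_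
    rw [norm_mul, mul_pow, mul_comm]
    refine mul_le_mul_of_nonneg_right (pow_le_pow_left₀ (norm_nonneg _) ?_ 2) (by positivity)
    have := hM L B b (σ + t * Complex.I) hL hB hb (by simpa using hσ2)
    simpa using this
  have e3 : (Y ^ (1 - σ)) ^ 2 * Y ^ (2 - 2 * σ) = Y ^ (4 * (1 - σ)) := by
    rw [← Real.rpow_mul_natCast hY0.le, ← Real.rpow_add hY0]
    congr 1
    push_cast
    ring
  have e4 : (C₁ * B * L * Y ^ (1 - σ)) ^ 2 * (C₂ * Y ^ (2 - 2 * σ)) ≤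
      C₂ * C₁ ^ 2 * B ^ 2 * L ^ 4 * Y ^ (4 * (1 - σ)) := by
    rw [← e3]
    have : L ^ 2 ≤ L ^ 4 := pow_le_pow_right₀ hL (by norm_num)
    calc _ = C₂ * C₁ ^ 2 * B ^ 2 * L ^ 2 * ((Y ^ (1 - σ)) ^ 2 * Y ^ (2 - 2 * σ)) := by ring
      _ ≤ _ := by gcongr
  have f1 : 0 ≤ C₃ * C₄ * B ^ 2 * L ^ 4 * Y ^ (4 * (1 - σ)) := by positivity
  have f2 : 0 ≤ C₂ * C₁ ^ 2 * B ^ 2 * L ^ 4 * W := by positivity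
  nlinarith

lemma WellBehaved.norm_log_gMoebius_le (h : S.WellBehaved A θ K₀) {L : ℝ} :
    ∀ n ∈ S.below (Real.exp (L / (1 - θ))),
      ‖-((Real.log (S.val n) : ℂ) * (gMoebius n : ℂ))‖ ≤ 1 / (1 - θ) * L := by
  intro n hn
  have hθ1 : θ < 1 := h.2.2.1
  have h0 : 0 < 1 - θ := by linarith
  rw [mem_below] at hn
  rw [norm_neg, norm_mul, Complex.norm_real, Real.norm_eq_abs, abs_of_nonneg (S.log_val_nonneg n)]
  refine (mul_le_of_le_one_right (S.log_val_nonneg n) (norm_gMoebius_le n)).trans ?_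
  have := Real.log_le_log (S.val_pos n) hn
  rw [Real.log_exp] at this
  rw [one_div_mul_eq_div]
  exact this

/-- The truncated Möbius sum. -/
noncomputable def moe (S : BeurlingSystem) (Y : ℝ) (s : ℂ) : ℂ :=
  S.dirPoly Y (fun n => (gMoebius n : ℂ)) s

/-- The derivative of the truncated Möbius sum. -/
noncomputable def moeDer (S : BeurlingSystem) (Y : ℝ) (s : ℂ) : ℂ :=
  S.dirPoly Y (fun n => -((Real.log (S.val n) : ℂ) * (gMoebius n : ℂ))) s

lemma hasDerivAt_moe (Y : ℝ) (s : ℂ) : HasDerivAt (S.moe Y) (S.moeDer Y s) s :=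
  hasDerivAt_dirPoly Y _ s

lemma IsZeta.continuousOn_line {ζ : ℂ → ℂ} (hζ : S.IsZeta θ ζ) {σ x y : ℝ} (hσ : θ < σ)
    (hxy1 : ∀ t ∈ Icc x y, 1 ≤ |t|) :
    ContinuousOn (fun t : ℝ => ζ (σ + t * Complex.I)) (Icc x y) := by
  intro t ht
  have h1 : (σ + t * Complex.I : ℂ) ≠ 1 := by
    intro h0
    have h1 := congrArg Complex.im h0
    simp at h1
    have := hxy1 t ht
    rw [h1] at this
    simp at this
    linarith
  have := (hζ.differentiableAt (s := σ + t * Complex.I) (by simpa using hσ) h1).continuousAt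
  exact (ContinuousAt.comp (f := fun t : ℝ => (σ + t * Complex.I : ℂ)) this
    (by fun_prop)).continuousWithinAt

/-- Mean square of the remainder `1 - ζM` on vertical lines. -/
lemma IsZeta.exists_integral_rem_le {ζ : ℂ → ℂ} (hζ : S.IsZeta θ ζ) (h : S.WellBehaved A θ K₀) :
    ∃ C : ℝ, 0 < C ∧ ∀ L σ x y : ℝ, 1 ≤ L → (1 + θ) / 2 ≤ σ → σ ≤ 1 → -Real.exp L ≤ x → x ≤ y →
      y ≤ Real.exp L → (∀ t ∈ Icc x y, 1 ≤ |t|) →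
      ∫ t in x..y, ‖1 - ζ (σ + t * Complex.I) *
        S.moe (Real.exp (L / (1 - θ))) (σ + t * Complex.I)‖ ^ 2 ≤
        C * L ^ 4 * Real.exp (L / (1 - θ)) ^ (4 * (1 - σ)) := by
  obtain ⟨C, hC, hmix⟩ := h.exists_integral_mixed_le
  have hθ1 : θ < 1 := h.2.2.1
  have h0 : 0 < 1 - θ := by linarith
  refine ⟨C * 3, by positivity, ?_⟩
  intro L σ x y hL hσ1 hσ2 hx hxy hy hxy1
  obtain ⟨hY1, -, -⟩ := h.log_add_one_le hL
  have hTY : Real.exp L ≤ Real.exp (L / (1 - θ)) ^ (1 - θ) := by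
    rw [← Real.exp_mul, div_mul_cancel₀ _ h0.ne']
  have key := hmix L 1 (2 * Real.exp (L / (1 - θ)) ^ (4 * (1 - σ))) σ x y
    (fun n => (gMoebius n : ℂ)) (S.remCoeff (Real.exp (L / (1 - θ))))
    hL zero_le_one (by positivity) (fun n _ => norm_gMoebius_le n) (norm_remCoeff_le _) ?_
    hσ1 hσ2 hx hxy hy hxy1
  · set Y := Real.exp (L / (1 - θ)) with hY
    have hσ : θ < σ := by linarith
    have hcd : ∀ (Z : ℝ) (b : (ℕ →₀ ℕ) → ℂ),
        Continuous fun t : ℝ => S.dirPoly Z b (σ + t * Complex.I) := fun Z b =>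
      (differentiable_dirPoly Z b).continuous.comp (by fun_prop)
    refine le_trans (intervalIntegral.integral_mono_on hxy ?_ ?_ fun t ht => ?_) (key.trans_eq (by ring))
    · refine ContinuousOn.intervalIntegrable ?_
      rw [uIcc_of_le hxy]
      exact (continuousOn_const.sub ((hζ.continuousOn_line hσ hxy1).mul
        (hcd Y _).continuousOn)).norm.pow 2
    · refine ContinuousOn.intervalIntegrable ?_
      rw [uIcc_of_le hxy]
      exact (((hcd _ _).norm.pow 2).const_mul 2).continuousOn.add
        ((((h.continuous_zetaTail_line hY1.le hσ hxy1).mul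
          (hcd Y _).continuousOn).norm.pow 2).const_mul 2)
    · have h1 : (σ + t * Complex.I : ℂ) ≠ 1 := by
        intro h0
        have h1 := congrArg Complex.im h0
        simp at h1
        have := hxy1 t ht
        rw [h1] at this
        simp at this
        linarith
      rw [hζ.eq_zetaRep h (by simpa using hσ) h1 hY1.le, zetaRep_eq,
        ← one_sub_zetaSum_mul hY1.le, moe]
      set s : ℂ := σ + t * Complex.I
      have e : (1 : ℂ) - (S.zetaSum Y s + S.zetaTail A Y s) * S.dirPoly Y (fun n => (gMoebius n : ℂ)) s =
        (1 - S.zetaSum Y s * S.dirPoly Y (fun n => (gMoebius n : ℂ)) s) -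
        S.zetaTail A Y s * S.dirPoly Y (fun n => (gMoebius n : ℂ)) s := by ring
      rw [e]
      have := norm_sub_le (1 - S.zetaSum Y s * S.dirPoly Y (fun n => (gMoebius n : ℂ)) s)
        (S.zetaTail A Y s * S.dirPoly Y (fun n => (gMoebius n : ℂ)) s)
      set u := ‖1 - S.zetaSum Y s * S.dirPoly Y (fun n => (gMoebius n : ℂ)) s‖
      set v := ‖S.zetaTail A Y s * S.dirPoly Y (fun n => (gMoebius n : ℂ)) s‖
      have := pow_le_pow_left₀ (norm_nonneg _) this 2
      nlinarith [sq_nonneg (u - v)]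
  · intro n hn hcn
    set Y := Real.exp (L / (1 - θ)) with hY
    have hv := S.val_pos n
    have hnY : Y < S.val n := by
      by_contra hle
      exact hcn (by rw [remCoeff, if_pos (not_lt.1 hle)])
    rw [mem_below] at hn
    have hY0 : 0 < Y := by linarith
    have e1 : S.val n ^ (2 - 2 * σ) ≤ Y ^ (4 * (1 - σ)) := by
      refine (Real.rpow_le_rpow hv.le hn (by linarith)).trans_eq ?_
      rw [← Real.rpow_natCast_mul hY0.le]
      congr 1
      push_cast
      ring
    have e2 : Real.exp L * S.val n ^ (1 + θ - 2 * σ) ≤ S.val n ^ (2 - 2 * σ) := by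
      have : Real.exp L ≤ S.val n ^ (1 - θ) :=
        hTY.trans (Real.rpow_le_rpow hY0.le hnY.le h0.le)
      refine (mul_le_mul_of_nonneg_right this (by positivity)).trans_eq ?_
      rw [← Real.rpow_add hv]
      congr 1
      ring
    linarith

/-- Mean square of `ζ` times a Dirichlet polynomial on the line `1 - (1 - θ) / 4`. -/
lemma IsZeta.exists_integral_mul_le {ζ : ℂ → ℂ} (hζ : S.IsZeta θ ζ) (h : S.WellBehaved A θ K₀) :
    ∃ C : ℝ, 0 < C ∧ ∀ (L B x y : ℝ) (b : (ℕ →₀ ℕ) → ℂ), 1 ≤ L → 0 ≤ B →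
      (∀ n ∈ S.below (Real.exp (L / (1 - θ))), ‖b n‖ ≤ B) → -Real.exp L ≤ x → x ≤ y →
      y ≤ Real.exp L → (∀ t ∈ Icc x y, 1 ≤ |t|) →
      ∫ t in x..y, ‖ζ ((1 - (1 - θ) / 4 : ℝ) + t * Complex.I) *
        S.dirPoly (Real.exp (L / (1 - θ))) b ((1 - (1 - θ) / 4 : ℝ) + t * Complex.I)‖ ^ 2 ≤
        C * B ^ 2 * L ^ 4 * Real.exp L := by
  obtain ⟨C, hC, hmix⟩ := h.exists_integral_mixed_le
  have hθ0 : 0 ≤ θ := h.2.1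
  have hθ1 : θ < 1 := h.2.2.1
  have h0 : 0 < 1 - θ := by linarith
  refine ⟨C * 3, by positivity, ?_⟩
  intro L B x y b hL hB hb hx hxy hy hxy1
  obtain ⟨hY1, -, -⟩ := h.log_add_one_le hL
  set σ := 1 - (1 - θ) / 4 with hσdef
  have hYT : Real.exp (L / (1 - θ)) ^ (4 * (1 - σ)) = Real.exp L := by
    rw [← Real.exp_mul]
    congr 1
    rw [hσdef]
    field_simp
    ring
  have key := hmix L B (2 * Real.exp L) σ x y b (S.prodCoeff (Real.exp (L / (1 - θ))) b)
    hL hB (by positivity) hb (norm_prodCoeff_le hb hB) ?_ (by rw [hσdef]; linarith)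
    (by rw [hσdef]; linarith) hx hxy hy hxy1
  · rw [hYT] at key
    set Y := Real.exp (L / (1 - θ)) with hY
    have hσ : θ < σ := by rw [hσdef]; linarith
    have hcd : ∀ (Z : ℝ) (b : (ℕ →₀ ℕ) → ℂ),
        Continuous fun t : ℝ => S.dirPoly Z b (σ + t * Complex.I) := fun Z b =>
      (differentiable_dirPoly Z b).continuous.comp (by fun_prop)
    refine le_trans (intervalIntegral.integral_mono_on hxy ?_ ?_ fun t ht => ?_) (key.trans_eq (by ring))
    · refine ContinuousOn.intervalIntegrable ?_
      rw [uIcc_of_le hxy]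
      exact ((hζ.continuousOn_line hσ hxy1).mul (hcd Y _).continuousOn).norm.pow 2
    · refine ContinuousOn.intervalIntegrable ?_
      rw [uIcc_of_le hxy]
      exact (((hcd _ _).norm.pow 2).const_mul 2).continuousOn.add
        ((((h.continuous_zetaTail_line hY1.le hσ hxy1).mul
          (hcd Y _).continuousOn).norm.pow 2).const_mul 2)
    · have h1 : (σ + t * Complex.I : ℂ) ≠ 1 := by
        intro h0
        have h1 := congrArg Complex.im h0
        simp at h1
        have := hxy1 t ht
        rw [h1] at this
        simp at this
        linarith
      rw [hζ.eq_zetaRep h (by simpa using hσ) h1 hY1.le, zetaRep_eq, ← zetaSum_mul_dirPoly hY1.le]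
      set s : ℂ := σ + t * Complex.I
      rw [add_mul]
      have := norm_add_le (S.zetaSum Y s * S.dirPoly Y b s) (S.zetaTail A Y s * S.dirPoly Y b s)
      set u := ‖S.zetaSum Y s * S.dirPoly Y b s‖
      set v := ‖S.zetaTail A Y s * S.dirPoly Y b s‖
      have := pow_le_pow_left₀ (norm_nonneg _) this 2
      nlinarith [sq_nonneg (u - v)]
  · intro n hn _
    set Y := Real.exp (L / (1 - θ)) with hY
    have hv := S.val_pos n
    rw [mem_below] at hn
    have hY0 : 0 < Y := by linarith
    have e1 : S.val n ^ (2 - 2 * σ) ≤ Real.exp L := by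
      rw [← hYT]
      refine (Real.rpow_le_rpow hv.le hn (by linarith)).trans_eq ?_
      rw [← Real.rpow_natCast_mul hY0.le]
      congr 1
      push_cast
      ring
    have e2 : Real.exp L * S.val n ^ (1 + θ - 2 * σ) ≤ Real.exp L := by
      refine mul_le_of_le_one_right (Real.exp_pos L).le ?_
      exact Real.rpow_le_one_of_one_le_of_nonpos (S.one_le_val n) (by rw [hσdef]; linarith)
    linarith

/-- The Gaussian-damped kernel `exp(s² / (2 T²) + s y)`. -/
noncomputable def gker (T y : ℝ) (s : ℂ) : ℂ :=
  Complex.exp (s ^ 2 / (2 * (T : ℂ) ^ 2) + s * y)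

/-- The centred Gaussian density of standard deviation `1 / T`. -/
noncomputable def gauss (T v : ℝ) : ℝ :=
  T / √(2 * Real.pi) * Real.exp (-(T ^ 2 * v ^ 2 / 2))

theorem gauss_nonneg {T : ℝ} (hT : 0 ≤ T) (v : ℝ) : 0 ≤ gauss T v := by
  unfold gauss; positivity

theorem norm_gker (T y σ t : ℝ) :
    ‖gker T y (σ + t * Complex.I)‖ = Real.exp ((σ ^ 2 - t ^ 2) / (2 * T ^ 2) + σ * y) := by
  unfold gker
  rw [Complex.norm_exp]
  congr 1
  have h1 : ((σ : ℂ) + t * Complex.I) ^ 2 = ((σ ^ 2 - t ^ 2 : ℝ) : ℂ) + (2 * σ * t : ℝ) * Complex.I := by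
    push_cast
    linear_combination (t : ℂ) ^ 2 * Complex.I_sq
  have h2 : (2 * (T : ℂ) ^ 2) = ((2 * T ^ 2 : ℝ) : ℂ) := by push_cast; ring
  rw [h1, h2, Complex.add_re, Complex.div_ofReal_re, Complex.add_re, Complex.re_ofReal_mul,
    Complex.ofReal_re]
  simp

theorem differentiable_gker (T y : ℝ) : Differentiable ℂ (gker T y) := by
  unfold gker; fun_prop

theorem hasDerivAt_gker (T y : ℝ) (s : ℂ) :
    HasDerivAt (gker T y) ((s / (T : ℂ) ^ 2 + y) * gker T y s) s := by
  have h : HasDerivAt (fun s : ℂ => s ^ 2 / (2 * (T : ℂ) ^ 2) + s * y)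
      ((2 * s) / (2 * (T : ℂ) ^ 2) + 1 * y) s := by
    have := ((hasDerivAt_id s).pow 2).div_const (2 * (T : ℂ) ^ 2)
    refine (this.add ((hasDerivAt_id s).mul_const (y : ℂ))).congr_deriv ?_
    simp
  refine h.cexp.congr_deriv ?_
  unfold gker
  rw [mul_div_mul_left _ _ two_ne_zero]
  ring

theorem integrable_gauss {T : ℝ} (hT : 0 < T) : Integrable (gauss T) := by
  unfold gauss
  have := (integrable_exp_neg_mul_sq (b := T ^ 2 / 2) (by positivity)).const_mul (T / √(2 * Real.pi))
  refine this.congr (Eventually.of_forall fun v => ?_)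
  simp only
  congr 2; ring

theorem integral_gauss {T : ℝ} (hT : 0 < T) : ∫ v, gauss T v = 1 := by
  unfold gauss
  rw [integral_const_mul]
  have h : (fun v : ℝ => Real.exp (-(T ^ 2 * v ^ 2 / 2)))
      = fun v => Real.exp (-(T ^ 2 / 2) * v ^ 2) := by
    funext v; congr 1; ring
  rw [h, integral_gaussian]
  have h2 : Real.pi / (T ^ 2 / 2) = (√(2 * Real.pi) / T) ^ 2 := by
    rw [div_pow, Real.sq_sqrt (by positivity)]; field_simp
  rw [h2, Real.sqrt_sq (by positivity)]
  have := Real.pi_pos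
  field_simp

theorem exp_mul_gauss {T : ℝ} (hT : 0 < T) (y v : ℝ) :
    Real.exp v * gauss T (y - v) = Real.exp (y + 1 / (2 * T ^ 2)) * gauss T (v - (y + 1 / T ^ 2)) := by
  unfold gauss
  rw [mul_left_comm, mul_left_comm (Real.exp (y + 1 / (2 * T ^ 2))), ← Real.exp_add, ← Real.exp_add]
  congr 2
  field_simp
  ring

theorem integrable_exp_mul_gauss {T : ℝ} (hT : 0 < T) (y : ℝ) :
    Integrable fun v => Real.exp v * gauss T (y - v) := by
  simp_rw [exp_mul_gauss hT]
  exact ((integrable_gauss hT).comp_sub_right _).const_mul _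

theorem integral_exp_mul_gauss {T : ℝ} (hT : 0 < T) (y : ℝ) :
    ∫ v, Real.exp v * gauss T (y - v) = Real.exp (y + 1 / (2 * T ^ 2)) := by
  simp_rw [exp_mul_gauss hT]
  rw [integral_const_mul, integral_sub_right_eq_self (gauss T), integral_gauss hT, mul_one]

theorem abs_integral_Ioi_exp_mul_gauss_sub_le {T : ℝ} (hT : 0 < T) (y : ℝ) :
    |(∫ v in Ioi (0 : ℝ), Real.exp v * gauss T (y - v)) - Real.exp y|
      ≤ Real.exp y * (Real.exp (1 / (2 * T ^ 2)) - 1) + 1 := by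
  have h1 := integral_add_compl (s := Ioi (0 : ℝ)) measurableSet_Ioi (integrable_exp_mul_gauss hT y)
  rw [integral_exp_mul_gauss hT, Real.exp_add] at h1
  have hnn : ∀ v, 0 ≤ Real.exp v * gauss T (y - v) := fun v =>
    mul_nonneg (Real.exp_pos _).le (gauss_nonneg hT.le _)
  have h2 : 0 ≤ ∫ v in (Ioi (0 : ℝ))ᶜ, Real.exp v * gauss T (y - v) :=
    integral_nonneg hnn
  have h3 : ∫ v in (Ioi (0 : ℝ))ᶜ, Real.exp v * gauss T (y - v) ≤ 1 := by
    have hi : Integrable fun v => gauss T (y - v) := (integrable_gauss hT).comp_sub_left y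
    calc ∫ v in (Ioi (0 : ℝ))ᶜ, Real.exp v * gauss T (y - v)
        ≤ ∫ v in (Ioi (0 : ℝ))ᶜ, gauss T (y - v) := by
          refine setIntegral_mono_on (integrable_exp_mul_gauss hT y).integrableOn hi.integrableOn
            measurableSet_Ioi.compl fun v hv => ?_
          have hv0 : v ≤ 0 := by simpa using hv
          exact mul_le_of_le_one_left (gauss_nonneg hT.le _) (Real.exp_le_one_iff.2 hv0)
      _ ≤ ∫ v, gauss T (y - v) :=
          setIntegral_le_integral hi (Eventually.of_forall fun v => gauss_nonneg hT.le _)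
      _ = 1 := by rw [integral_sub_left_eq_self (gauss T), integral_gauss hT]
  have h4 : 1 ≤ Real.exp (1 / (2 * T ^ 2)) := Real.one_le_exp (by positivity)
  have h5 : 0 ≤ Real.exp y * (Real.exp (1 / (2 * T ^ 2)) - 1) :=
    mul_nonneg (Real.exp_pos _).le (by linarith)
  rw [abs_le]; constructor <;> nlinarith

theorem integrable_norm_gker {T : ℝ} (hT : 0 < T) (y σ : ℝ) :
    Integrable fun t : ℝ => ‖gker T y (σ + t * Complex.I)‖ := by
  simp_rw [norm_gker]
  have := (integrable_exp_neg_mul_sq (b := 1 / (2 * T ^ 2)) (by positivity)).const_mul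
    (Real.exp (σ ^ 2 / (2 * T ^ 2) + σ * y))
  refine this.congr (Eventually.of_forall fun t => ?_)
  simp only
  rw [← Real.exp_add]
  congr 1; ring

theorem continuous_gker_line (T y σ : ℝ) : Continuous fun t : ℝ => gker T y (σ + t * Complex.I) :=
  (differentiable_gker T y).continuous.comp (by fun_prop)

theorem integrable_gker {T : ℝ} (hT : 0 < T) (y σ : ℝ) :
    Integrable fun t : ℝ => gker T y (σ + t * Complex.I) :=
  (integrable_norm_iff (continuous_gker_line T y σ).aestronglyMeasurable).1
    (integrable_norm_gker hT y σ)

theorem integral_gker_mul_exp {T : ℝ} (hT : 0 < T) (y c v : ℝ) :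
    ∫ t : ℝ, gker T y (c + t * Complex.I) * Complex.exp (-((c + t * Complex.I) * v))
      = ((2 * Real.pi * gauss T (y - v) : ℝ) : ℂ) := by
  have hT2 : (T : ℂ) ≠ 0 := by exact_mod_cast hT.ne'
  have h1 : ∀ t : ℝ, gker T y (c + t * Complex.I) * Complex.exp (-((c + t * Complex.I) * v))
      = Complex.exp (((-(1 / (2 * T ^ 2)) : ℝ) : ℂ) * (t : ℂ) ^ 2
        + ((c / T ^ 2 + (y - v) : ℝ) * Complex.I) * t + ((c ^ 2 / (2 * T ^ 2) + c * (y - v) : ℝ) : ℂ)) := by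
    intro t
    unfold gker
    rw [← Complex.exp_add]
    congr 1
    push_cast
    field_simp
    linear_combination (t : ℂ) ^ 2 * Complex.I_sq
  simp_rw [h1]
  rw [integral_cexp_quadratic]
  · have h2 : (Real.pi : ℂ) / -((-(1 / (2 * T ^ 2)) : ℝ) : ℂ) = ((√(2 * Real.pi) * T) ^ 2 : ℝ) := by
      rw [mul_pow, Real.sq_sqrt (by positivity)]
      push_cast; field_simp
    have h3 : ((((√(2 * Real.pi) * T) ^ 2 : ℝ)) : ℂ) ^ (1 / 2 : ℂ) = ((√(2 * Real.pi) * T : ℝ) : ℂ) := by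
      have : (1 / 2 : ℂ) = ((1 / 2 : ℝ) : ℂ) := by push_cast; rfl
      rw [this, ← Complex.ofReal_cpow (by positivity), ← Real.sqrt_eq_rpow, Real.sqrt_sq (by positivity)]
    have h4 : ((c ^ 2 / (2 * T ^ 2) + c * (y - v) : ℝ) : ℂ)
        - ((c / T ^ 2 + (y - v) : ℝ) * Complex.I) ^ 2 / (4 * ((-(1 / (2 * T ^ 2)) : ℝ) : ℂ))
        = ((-(T ^ 2 * (y - v) ^ 2 / 2) : ℝ) : ℂ) := by
      rw [mul_pow, Complex.I_sq]
      push_cast; field_simp; ring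
    rw [h2, h3, h4, ← Complex.ofReal_exp, ← Complex.ofReal_mul]
    congr 1
    unfold gauss
    have h5 : (√(2 * Real.pi)) ^ 2 = 2 * Real.pi := Real.sq_sqrt (by positivity)
    have h6 : 0 < √(2 * Real.pi) := Real.sqrt_pos.2 (by positivity)
    rw [← mul_assoc]
    congr 1
    field_simp
    linarith
  · rw [Complex.ofReal_re]
    have : 0 < 1 / (2 * T ^ 2) := by positivity
    linarith

/-- The von Mangoldt sum smoothed by the Gaussian density on the logarithmic scale. -/
noncomputable def smooth (S : BeurlingSystem) (T y : ℝ) : ℝ :=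
  ∑' n, S.vonMangoldt n * gauss T (y - Real.log (S.val n))

lemma val_cpow_eq_exp (n : ℕ →₀ ℕ) (s : ℂ) :
    (S.val n : ℂ) ^ (-s) = Complex.exp (-(s * (Real.log (S.val n) : ℝ))) := by
  rw [Complex.cpow_def_of_ne_zero (by exact_mod_cast (S.val_pos n).ne'),
    Complex.ofReal_log (S.val_pos n).le]
  congr 1; ring

lemma WellBehaved.hasSum_smooth (h : S.WellBehaved A θ K₀) {c T : ℝ} (hc : 1 < c) (hT : 0 < T)
    (y : ℝ) : HasSum (fun n => ((2 * Real.pi * (S.vonMangoldt n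
      * gauss T (y - Real.log (S.val n))) : ℝ) : ℂ))
      (∫ t : ℝ, S.logDer (c + t * Complex.I) * gker T y (c + t * Complex.I)) := by
  have hval : Countable (ℕ →₀ ℕ) := inferInstance
  have hnorm : ∀ (n : ℕ →₀ ℕ) (t : ℝ), ‖(S.vonMangoldt n : ℂ) * (S.val n : ℂ) ^ (-((c : ℂ) + t * Complex.I))
      * gker T y (c + t * Complex.I)‖ = S.vonMangoldt n * S.val n ^ (-c)
        * ‖gker T y (c + t * Complex.I)‖ := by
    intro n t
    rw [norm_mul, norm_ofReal_mul_cpow, abs_of_nonneg (vonMangoldt_nonneg n)]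
    simp
  have hcont : ∀ n : ℕ →₀ ℕ, Continuous fun t : ℝ =>
      (S.vonMangoldt n : ℂ) * (S.val n : ℂ) ^ (-((c : ℂ) + t * Complex.I))
      * gker T y (c + t * Complex.I) := by
    intro n
    simp_rw [val_cpow_eq_exp]
    exact (by fun_prop : Continuous fun t : ℝ => (S.vonMangoldt n : ℂ) *
      Complex.exp (-(((c : ℂ) + t * Complex.I) * (Real.log (S.val n) : ℝ)))).mul
        (continuous_gker_line T y c)
  have h1 := hasSum_integral_of_summable_integral_norm (μ := (volume : Measure ℝ))
    (F := fun (n : ℕ →₀ ℕ) (t : ℝ) =>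
      (S.vonMangoldt n : ℂ) * (S.val n : ℂ) ^ (-((c : ℂ) + t * Complex.I))
      * gker T y (c + t * Complex.I))
    (fun n => by
      refine (integrable_norm_iff (hcont n).aestronglyMeasurable).1 ?_
      simp_rw [hnorm]
      exact (integrable_norm_gker hT y c).const_mul _)
    (by
      simp_rw [hnorm, integral_const_mul]
      exact (h.summable_vonMangoldt hc).mul_right _)
  have h2 : ∀ n : ℕ →₀ ℕ, ∫ t : ℝ, (S.vonMangoldt n : ℂ) * (S.val n : ℂ) ^ (-((c : ℂ) + t * Complex.I))
      * gker T y (c + t * Complex.I)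
      = ((2 * Real.pi * (S.vonMangoldt n * gauss T (y - Real.log (S.val n))) : ℝ) : ℂ) := by
    intro n
    have := integral_gker_mul_exp hT y c (Real.log (S.val n))
    simp_rw [val_cpow_eq_exp, mul_assoc]
    rw [integral_const_mul]
    simp_rw [mul_comm (Complex.exp _)]
    rw [this]
    push_cast; ring
  simp_rw [h2] at h1
  have h3 : ∀ t : ℝ, S.logDer (c + t * Complex.I) * gker T y (c + t * Complex.I)
      = ∑' n, (S.vonMangoldt n : ℂ) * (S.val n : ℂ) ^ (-((c : ℂ) + t * Complex.I))
      * gker T y (c + t * Complex.I) := fun t => by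
    rw [tsum_mul_right]; rfl
  simp_rw [h3]
  exact h1

lemma WellBehaved.summable_smooth (h : S.WellBehaved A θ K₀) {T : ℝ} (hT : 0 < T) (y : ℝ) :
    Summable fun n => S.vonMangoldt n * gauss T (y - Real.log (S.val n)) := by
  have h1 := (h.hasSum_smooth (c := 2) (by norm_num) hT y).summable
  have h2 := (Complex.summable_ofReal).1 h1
  exact (summable_mul_left_iff (by positivity)).1 h2

lemma WellBehaved.integral_logDer_mul (h : S.WellBehaved A θ K₀) {c T : ℝ} (hc : 1 < c)
    (hT : 0 < T) (y : ℝ) :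
    ∫ t : ℝ, S.logDer (c + t * Complex.I) * gker T y (c + t * Complex.I)
      = ((2 * Real.pi * S.smooth T y : ℝ) : ℂ) := by
  have h1 := h.hasSum_smooth hc hT y
  have h2 := Complex.hasSum_ofReal.2 ((h.summable_smooth hT y).hasSum.mul_left (2 * Real.pi))
  exact h1.unique h2

lemma integral_gker_div {c T : ℝ} (hc : 1 < c) (hT : 0 < T) (y : ℝ) :
    ∫ t : ℝ, 1 / ((c : ℂ) + t * Complex.I - 1) * gker T y (c + t * Complex.I)
      = ((2 * Real.pi * ∫ v in Ioi (0 : ℝ), Real.exp v * gauss T (y - v) : ℝ) : ℂ) := by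
  have h1 : ∀ t : ℝ, 1 / ((c : ℂ) + t * Complex.I - 1) * gker T y (c + t * Complex.I)
      = ∫ v in Ioi (0 : ℝ), gker T y (c + t * Complex.I) *
        Complex.exp (-((c : ℂ) + t * Complex.I - 1) * v) := by
    intro t
    rw [integral_const_mul, integral_exp_mul_complex_Ioi (by simp; linarith)]
    simp only [Complex.ofReal_zero, mul_zero, Complex.exp_zero]
    rw [mul_comm, neg_div_neg_eq]
  simp_rw [h1]
  rw [integral_integral_swap]
  · rw [← integral_const_mul, ← integral_complex_ofReal]
    refine setIntegral_congr_fun measurableSet_Ioi fun v _ => ?_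
    have h2 : ∀ t : ℝ, gker T y (c + t * Complex.I) * Complex.exp (-((c : ℂ) + t * Complex.I - 1) * v)
        = Complex.exp v * (gker T y (c + t * Complex.I) *
          Complex.exp (-(((c : ℂ) + t * Complex.I) * v))) := by
      intro t
      rw [mul_left_comm, ← Complex.exp_add]
      congr 2; ring
    simp_rw [h2]
    rw [integral_const_mul, integral_gker_mul_exp hT]
    push_cast; ring
  · have hexp : Integrable (fun v : ℝ => Real.exp (-(c - 1) * v)) (volume.restrict (Ioi 0)) :=
      integrableOn_exp_mul_Ioi (by linarith) 0
    refine Integrable.mono' ((integrable_norm_gker hT y c).mul_prod hexp) ?_ ?_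
    · refine Continuous.aestronglyMeasurable ?_
      refine ((continuous_gker_line T y c).comp continuous_fst).mul ?_
      fun_prop
    · refine Eventually.of_forall fun q => ?_
      simp only [Function.uncurry, norm_mul, Complex.norm_exp]
      simp

lemma IsZeta.exists_norm_logDerReg_le_div {ζ : ℂ → ℂ} (hζ : S.IsZeta θ ζ)
    (h : S.WellBehaved A θ K₀) : ∃ C : ℝ, 0 < C ∧ ∀ c t : ℝ, 1 < c → c ≤ 2 →
      ‖S.logDerReg A (c + t * Complex.I)‖ ≤ C / (c - 1) := by
  obtain ⟨η, C, hη, hC, hb⟩ := hζ.exists_logDerReg_bound h 1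
  refine ⟨C + 2, by linarith, fun c t hc hc2 => ?_⟩
  have hc0 : 0 < c - 1 := by linarith
  have h1 : S.logDerReg A (c + t * Complex.I)
      = S.logDer (c + t * Complex.I) - 1 / ((c : ℂ) + t * Complex.I - 1) := by
    rw [hζ.logDer_eq_reg h (by simpa using hc)]; ring
  have h2 : ‖S.logDer (c + t * Complex.I)‖ ≤ C + 1 / (c - 1) := by
    refine (h.norm_logDer_le (by simpa using hc)).trans ?_
    have h3 : ‖S.logDer (c : ℂ)‖ = ∑' n, S.vonMangoldt n * S.val n ^ (-c) := by
      rw [logDer_ofReal, Complex.norm_real, Real.norm_eq_abs, abs_of_nonneg]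
      exact tsum_nonneg fun n => mul_nonneg (vonMangoldt_nonneg n)
        (Real.rpow_nonneg (S.val_pos n).le _)
    have h4 : (((c : ℂ) + t * Complex.I).re) = c := by simp
    rw [h4, ← h3, hζ.logDer_eq_reg h (by simpa using hc)]
    refine (norm_add_le _ _).trans (add_le_add (hb _ (by simp; linarith) (by simpa using hc2)
      (by simp)) ?_)
    have : (c : ℂ) - 1 = ((c - 1 : ℝ) : ℂ) := by push_cast; rfl
    rw [this, norm_div, norm_one, Complex.norm_real, Real.norm_eq_abs, abs_of_pos hc0]
  have h5 : ‖1 / ((c : ℂ) + t * Complex.I - 1)‖ ≤ 1 / (c - 1) := by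
    rw [norm_div, norm_one]
    refine one_div_le_one_div_of_le hc0 ?_
    have := Complex.re_le_norm ((c : ℂ) + t * Complex.I - 1)
    simpa using this
  rw [h1]
  refine (norm_sub_le _ _).trans ((add_le_add h2 h5).trans ?_)
  rw [le_div_iff₀ hc0]
  have : (C + 1 / (c - 1) + 1 / (c - 1)) * (c - 1) = C * (c - 1) + 2 := by field_simp; ring
  rw [this]
  nlinarith

lemma IsZeta.continuous_logDerReg_line {ζ : ℂ → ℂ} (hζ : S.IsZeta θ ζ)
    (h : S.WellBehaved A θ K₀) {c : ℝ} (hc : 1 ≤ c) :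
    Continuous fun t : ℝ => S.logDerReg A (c + t * Complex.I) := by
  rw [continuous_iff_continuousAt]
  intro t
  have h1 : (1 : ℝ) ≤ ((c : ℂ) + t * Complex.I).re := by simpa using hc
  have h2 := (h.continuousAt_logDerReg (by linarith [h.2.2.1])
    (hζ.zetaReg_ne_zero h h1)).continuousAt
  exact ContinuousAt.comp (f := fun t : ℝ => (c : ℂ) + t * Complex.I) h2 (by fun_prop)

lemma IsZeta.integrable_logDerReg_mul {ζ : ℂ → ℂ} (hζ : S.IsZeta θ ζ) (h : S.WellBehaved A θ K₀)
    {c T : ℝ} (hc : 1 < c) (hc2 : c ≤ 2) (hT : 0 < T) (y : ℝ) :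
    Integrable fun t : ℝ => S.logDerReg A (c + t * Complex.I) * gker T y (c + t * Complex.I) := by
  obtain ⟨C, -, hC⟩ := hζ.exists_norm_logDerReg_le_div h
  exact (integrable_gker hT y c).bdd_mul
    (hζ.continuous_logDerReg_line h hc.le).aestronglyMeasurable
    (Eventually.of_forall fun t => hC c t hc hc2)

lemma IsZeta.integral_logDerReg_mul {ζ : ℂ → ℂ} (hζ : S.IsZeta θ ζ) (h : S.WellBehaved A θ K₀)
    {c T : ℝ} (hc : 1 < c) (hc2 : c ≤ 2) (hT : 0 < T) (y : ℝ) :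
    ∫ t : ℝ, S.logDerReg A (c + t * Complex.I) * gker T y (c + t * Complex.I)
      = ((2 * Real.pi * (S.smooth T y - ∫ v in Ioi (0 : ℝ), Real.exp v * gauss T (y - v)) : ℝ) : ℂ) := by
  have hne : ∀ t : ℝ, (c : ℂ) + t * Complex.I - 1 ≠ 0 := fun t h0 => by
    have := congrArg Complex.re h0
    simp at this; linarith
  have h1 : Integrable fun t : ℝ => 1 / ((c : ℂ) + t * Complex.I - 1) * gker T y (c + t * Complex.I) := by
    refine (integrable_gker hT y c).bdd_mul (c := 1 / (c - 1))
      (Continuous.aestronglyMeasurable (Continuous.div (by fun_prop) (by fun_prop) hne))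
      (Eventually.of_forall fun t => ?_)
    rw [norm_div, norm_one]
    refine one_div_le_one_div_of_le (by linarith) ?_
    have := Complex.re_le_norm ((c : ℂ) + t * Complex.I - 1)
    simpa using this
  have h2 := integral_add (hζ.integrable_logDerReg_mul h hc hc2 hT y) h1
  have h3 : ∀ t : ℝ, S.logDerReg A (c + t * Complex.I) * gker T y (c + t * Complex.I)
      + 1 / ((c : ℂ) + t * Complex.I - 1) * gker T y (c + t * Complex.I)
      = S.logDer (c + t * Complex.I) * gker T y (c + t * Complex.I) := by
    intro t
    rw [hζ.logDer_eq_reg h (by simpa using hc)]; ring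
  simp_rw [h3] at h2
  rw [h.integral_logDer_mul hc hT y, integral_gker_div hc hT y] at h2
  rw [← sub_eq_iff_eq_add] at h2
  rw [← h2]
  push_cast; ring

/-- The smoothed sum differs from `exp y` by the contour integral, up to elementary terms. -/
lemma IsZeta.abs_smooth_sub_le {ζ : ℂ → ℂ} (hζ : S.IsZeta θ ζ) (h : S.WellBehaved A θ K₀)
    {c T : ℝ} (hc : 1 < c) (hc2 : c ≤ 2) (hT : 0 < T) (y : ℝ) :
    |S.smooth T y - Real.exp y| ≤
      ‖∫ t : ℝ, S.logDerReg A (c + t * Complex.I) * gker T y (c + t * Complex.I)‖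
        + (Real.exp y * (Real.exp (1 / (2 * T ^ 2)) - 1) + 1) := by
  have h1 := abs_integral_Ioi_exp_mul_gauss_sub_le hT y
  rw [hζ.integral_logDerReg_mul h hc hc2 hT y, Complex.norm_real, Real.norm_eq_abs, abs_mul,
    abs_of_pos Real.two_pi_pos]
  have h2 : |S.smooth T y - ∫ v in Ioi (0 : ℝ), Real.exp v * gauss T (y - v)| ≤ 2 * Real.pi *
      |S.smooth T y - ∫ v in Ioi (0 : ℝ), Real.exp v * gauss T (y - v)| :=
    le_mul_of_one_le_left (abs_nonneg _) (by nlinarith [Real.pi_gt_three])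
  calc |S.smooth T y - Real.exp y| = |(S.smooth T y - ∫ v in Ioi (0 : ℝ), Real.exp v * gauss T (y - v))
        + ((∫ v in Ioi (0 : ℝ), Real.exp v * gauss T (y - v)) - Real.exp y)| := by congr 1; ring
    _ ≤ _ := (abs_add_le _ _).trans (add_le_add h2 h1)

lemma norm_integral_shift_le {f : ℂ → ℂ} {a b x y D : ℝ} (hab : a ≤ b) (hba : b - a ≤ 1)
    (hxy : x ≤ y)
    (hf : ∀ s : ℂ, a ≤ s.re → s.re ≤ b → x ≤ s.im → s.im ≤ y → DifferentiableAt ℂ f s)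
    (hx : ∀ σ : ℝ, a ≤ σ → σ ≤ b → ‖f (σ + x * Complex.I)‖ ≤ D)
    (hy : ∀ σ : ℝ, a ≤ σ → σ ≤ b → ‖f (σ + y * Complex.I)‖ ≤ D) :
    ‖∫ t in x..y, f (b + t * Complex.I)‖ ≤ ‖∫ t in x..y, f (a + t * Complex.I)‖ + 2 * D := by
  have h := Complex.integral_boundary_rect_eq_zero_of_differentiableOn f ⟨a, x⟩ ⟨b, y⟩ (by
    intro s hs
    rw [uIcc_of_le hab, uIcc_of_le hxy, Complex.mem_reProdIm] at hs
    exact (hf s hs.1.1 hs.1.2 hs.2.1 hs.2.2).differentiableWithinAt)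
  simp only [smul_eq_mul] at h
  have hD : 0 ≤ D := (norm_nonneg _).trans (hx a le_rfl hab)
  have hh : ∀ z : ℝ, (∀ σ : ℝ, a ≤ σ → σ ≤ b → ‖f (σ + z * Complex.I)‖ ≤ D) →
      ‖∫ σ in a..b, f (σ + z * Complex.I)‖ ≤ D := by
    intro z hz
    refine (intervalIntegral.norm_integral_le_of_norm_le_const (C := D) fun σ hσ => ?_).trans ?_
    · rw [uIoc_of_le hab] at hσ
      exact hz σ hσ.1.le hσ.2
    · rw [abs_of_nonneg (by linarith)]
      nlinarith
  have h1 : Complex.I * ∫ t in x..y, f (b + t * Complex.I)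
      = Complex.I * (∫ t in x..y, f (a + t * Complex.I))
        - (∫ σ in a..b, f (σ + x * Complex.I)) + ∫ σ in a..b, f (σ + y * Complex.I) := by
    linear_combination h
  have h2 := congrArg norm h1
  rw [norm_mul, Complex.norm_I, one_mul] at h2
  rw [h2]
  refine (norm_add_le _ _).trans ((add_le_add ((norm_sub_le _ _).trans
    (add_le_add le_rfl (hh x hx))) (hh y hy)).trans (le_of_eq ?_))
  rw [norm_mul, Complex.norm_I, one_mul]; ring

lemma exp_two_le : Real.exp 2 ≤ 8 := by
  have h := Real.exp_one_lt_d9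
  have : Real.exp 2 = Real.exp 1 ^ 2 := by rw [← Real.exp_nat_mul]; norm_num
  rw [this]; nlinarith [Real.exp_pos 1]

lemma norm_gker_le {T y σ : ℝ} (hT : 1 ≤ T) (h0 : 0 ≤ σ) (h2 : σ ≤ 2) (t : ℝ) :
    ‖gker T y (σ + t * Complex.I)‖ ≤ 8 * Real.exp (σ * y) := by
  rw [norm_gker, Real.exp_add]
  refine mul_le_mul_of_nonneg_right ((Real.exp_le_exp.2 ?_).trans exp_two_le) (Real.exp_pos _).le
  rw [div_le_iff₀ (by positivity)]
  nlinarith [sq_nonneg t]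

lemma norm_gker_le_of_le {T T₁ y σ t : ℝ} (hT : 1 ≤ T) (h0 : 0 ≤ σ) (h2 : σ ≤ 2) (hT₁ : 0 ≤ T₁)
    (ht : T₁ ≤ |t|) : ‖gker T y (σ + t * Complex.I)‖
      ≤ 8 * Real.exp (σ * y) * Real.exp (-(T₁ ^ 2 / (4 * T ^ 2))) * Real.exp (-(1 / (4 * T ^ 2)) * t ^ 2) := by
  rw [norm_gker]
  have h3 : T₁ ^ 2 ≤ t ^ 2 := by rw [← sq_abs t]; gcongr
  have e : (σ ^ 2 - t ^ 2) / (2 * T ^ 2) + σ * y = σ ^ 2 / (2 * T ^ 2) + σ * y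
      + -(t ^ 2 / (4 * T ^ 2)) + -(1 / (4 * T ^ 2)) * t ^ 2 := by field_simp; ring
  rw [e, Real.exp_add, Real.exp_add, Real.exp_add]
  refine mul_le_mul_of_nonneg_right (mul_le_mul (mul_le_mul_of_nonneg_right
    ((Real.exp_le_exp.2 ?_).trans exp_two_le) (Real.exp_pos _).le) (Real.exp_le_exp.2 ?_)
    (Real.exp_pos _).le (by positivity)) (Real.exp_pos _).le
  · rw [div_le_iff₀ (by positivity)]; nlinarith
  · gcongr

lemma norm_gker_le_of_abs_eq {T T₁ y σ t : ℝ} (hT : 1 ≤ T) (h0 : 0 ≤ σ) (h2 : σ ≤ 2) (hT₁ : 0 ≤ T₁)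
    (ht : T₁ ≤ |t|) : ‖gker T y (σ + t * Complex.I)‖
      ≤ 8 * Real.exp (σ * y) * Real.exp (-(T₁ ^ 2 / (4 * T ^ 2))) := by
  refine (norm_gker_le_of_le hT h0 h2 hT₁ ht).trans (mul_le_of_le_one_right (by positivity) ?_)
  rw [Real.exp_le_one_iff]
  have : 0 ≤ 1 / (4 * T ^ 2) * t ^ 2 := by positivity
  linarith

/-- The part of the contour integral far from the real axis is negligible. -/
lemma IsZeta.exists_integral_tail_le {ζ : ℂ → ℂ} (hζ : S.IsZeta θ ζ) (h : S.WellBehaved A θ K₀) :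
    ∃ C : ℝ, 0 < C ∧ ∀ T T₁ y : ℝ, 1 ≤ T → 1 ≤ y → 0 ≤ T₁ →
      ‖∫ t : ℝ, S.logDerReg A ((1 + 1 / y : ℝ) + t * Complex.I)
        * gker T y ((1 + 1 / y : ℝ) + t * Complex.I)‖ ≤
      ‖∫ t in -T₁..T₁, S.logDerReg A ((1 + 1 / y : ℝ) + t * Complex.I)
        * gker T y ((1 + 1 / y : ℝ) + t * Complex.I)‖
        + C * y * Real.exp y * T * Real.exp (-(T₁ ^ 2 / (4 * T ^ 2))) := by
  obtain ⟨C, hC, hb⟩ := hζ.exists_norm_logDerReg_le_div h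
  refine ⟨C * 8 * Real.exp 1 * 4, by positivity, fun T T₁ y hT hy hT₁ => ?_⟩
  set c : ℝ := 1 + 1 / y with hc
  have hy0 : 0 < y := by linarith
  have hc1 : 1 < c := by rw [hc]; have : 0 < 1 / y := by positivity
                         linarith
  have hc2 : c ≤ 2 := by rw [hc]; have : 1 / y ≤ 1 := by rw [div_le_one hy0]; exact hy
                         linarith
  set f : ℝ → ℂ := fun t => S.logDerReg A (c + t * Complex.I) * gker T y (c + t * Complex.I) with hf
  have hi : Integrable f := hζ.integrable_logDerReg_mul h hc1 hc2 (by linarith) y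
  have h1 := integral_add_compl (s := Ioc (-T₁) T₁) measurableSet_Ioc hi
  rw [← intervalIntegral.integral_of_le (by linarith)] at h1
  rw [← h1]
  refine (norm_add_le _ _).trans (add_le_add le_rfl ?_)
  set q : ℝ := C * y * (8 * Real.exp (y + 1) * Real.exp (-(T₁ ^ 2 / (4 * T ^ 2)))) with hq
  have hpt : ∀ t ∈ (Ioc (-T₁) T₁)ᶜ, ‖f t‖ ≤ q * Real.exp (-(1 / (4 * T ^ 2)) * t ^ 2) := by
    intro t ht
    have ht1 : T₁ ≤ |t| := by
      by_contra! hlt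
      exact ht ⟨(abs_lt.1 hlt).1, (abs_lt.1 hlt).2.le⟩
    rw [hf]; simp only [norm_mul]
    have h2 := hb c t hc1 hc2
    have h3 : C / (c - 1) = C * y := by rw [hc]; field_simp; ring
    rw [h3] at h2
    have h4 := norm_gker_le_of_le (y := y) hT (by linarith) hc2 hT₁ ht1
    have h5 : c * y = y + 1 := by rw [hc]; field_simp
    rw [h5] at h4
    refine (mul_le_mul h2 h4 (norm_nonneg _) (by positivity)).trans (le_of_eq ?_)
    rw [hq]; ring
  have hg : Integrable fun t : ℝ => q * Real.exp (-(1 / (4 * T ^ 2)) * t ^ 2) :=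
    (integrable_exp_neg_mul_sq (by positivity)).const_mul q
  calc ‖∫ t in (Ioc (-T₁) T₁)ᶜ, f t‖
      ≤ ∫ t in (Ioc (-T₁) T₁)ᶜ, q * Real.exp (-(1 / (4 * T ^ 2)) * t ^ 2) :=
        norm_integral_le_of_norm_le hg.integrableOn
          ((ae_restrict_iff' measurableSet_Ioc.compl).2 (Eventually.of_forall hpt))
    _ ≤ ∫ t, q * Real.exp (-(1 / (4 * T ^ 2)) * t ^ 2) :=
        setIntegral_le_integral hg (Eventually.of_forall fun t => by
          simp only [Pi.zero_apply]; positivity)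
    _ = q * √(Real.pi / (1 / (4 * T ^ 2))) := by rw [integral_const_mul, integral_gaussian]
    _ ≤ q * (4 * T) := by
        refine mul_le_mul_of_nonneg_left (Real.sqrt_le_iff.2 ⟨by positivity, ?_⟩) (by positivity)
        have : Real.pi / (1 / (4 * T ^ 2)) = Real.pi * (4 * T ^ 2) := by field_simp
        rw [this]
        nlinarith [Real.pi_lt_four, sq_nonneg T]
    _ = _ := by rw [hq, Real.exp_add]; ring

/-- A primitive of the mollified logarithmic derivative, up to `primRem`. -/
noncomputable def prim (S : BeurlingSystem) (ζ : ℂ → ℂ) (Y T y : ℝ) (s : ℂ) : ℂ :=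
  (2 * (ζ s * S.moe Y s) - (ζ s * S.moe Y s) ^ 2 / 2) * gker T y s

/-- The holomorphic remainder left after integrating the mollified logarithmic derivative. -/
noncomputable def primRem (S : BeurlingSystem) (ζ : ℂ → ℂ) (Y T y : ℝ) (s : ℂ) : ℂ :=
  ((2 - ζ s * S.moe Y s) * (ζ s * S.moeDer Y s)
    + (2 * (ζ s * S.moe Y s) - (ζ s * S.moe Y s) ^ 2 / 2) * (s / (T : ℂ) ^ 2 + y)
    - 1 / (s - 1)) * gker T y s

lemma IsZeta.hasDerivAt_prim {ζ : ℂ → ℂ} (hζ : S.IsZeta θ ζ) (h : S.WellBehaved A θ K₀)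
    (Y T y : ℝ) {s : ℂ} (hs : θ < s.re) (hs1 : s ≠ 1) (h0 : ζ s ≠ 0) :
    HasDerivAt (S.prim ζ Y T y)
      ((S.logDerReg A s + 1 / (s - 1)) * (1 - ζ s * S.moe Y s) ^ 2 * gker T y s
        + S.primRem ζ Y T y s - S.logDerReg A s * gker T y s) s := by
  have h1 := (hζ.differentiableAt hs hs1).hasDerivAt
  have hf := h1.mul (hasDerivAt_moe (S := S) Y s)
  have h2 := ((hf.const_mul (2 : ℂ)).sub ((hf.pow 2).div_const 2)).mul (hasDerivAt_gker T y s)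
  refine h2.congr_deriv ?_
  have h3 : deriv ζ s = -(S.logDerReg A s + 1 / (s - 1)) * ζ s := by
    rw [hζ.logDerReg_eq h hs hs1 h0]; field_simp; ring
  rw [h3]
  simp only [primRem, Pi.mul_apply, Pi.sub_apply, Pi.pow_apply]
  push_cast
  ring

lemma IsZeta.differentiableAt_primRem {ζ : ℂ → ℂ} (hζ : S.IsZeta θ ζ)
    (Y T y : ℝ) {s : ℂ} (hs : θ < s.re) (hs1 : s ≠ 1) :
    DifferentiableAt ℂ (S.primRem ζ Y T y) s := by
  have h1 := hζ.differentiableAt hs hs1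
  have h2 := (hasDerivAt_moe (S := S) Y s).differentiableAt
  have h3 : DifferentiableAt ℂ (S.moeDer Y) s := differentiable_dirPoly _ _ _
  have h4 := (differentiable_gker T y) s
  have h5 : s - 1 ≠ 0 := sub_ne_zero.2 hs1
  have h6 : DifferentiableAt ℂ (fun s : ℂ => 1 / (s - 1)) s := by
    simp only [one_div]
    exact (differentiableAt_id.sub_const 1).inv h5
  have h7 : DifferentiableAt ℂ (fun s : ℂ => s / (T : ℂ) ^ 2 + y) s := by fun_prop
  have hf := h1.mul h2
  exact (((((differentiableAt_const (2 : ℂ)).sub hf).mul (h1.mul h3)).add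
    (((hf.const_mul 2).sub ((hf.pow 2).div_const 2)).mul h7)).sub h6).mul h4

lemma ne_one_of_one_le_im {s : ℂ} (h : 1 ≤ |s.im|) : s ≠ 1 := by
  rintro rfl; simp at h; linarith

/-- Integration by parts along a vertical segment. -/
lemma IsZeta.norm_integral_logDerReg_le {ζ : ℂ → ℂ} (hζ : S.IsZeta θ ζ) (h : S.WellBehaved A θ K₀)
    (Y T y : ℝ) {σ a b G E : ℝ} (hσ : θ < σ) (hab : a ≤ b) (ht : ∀ t ∈ Icc a b, 1 ≤ |t|)
    (h0 : ∀ t ∈ Icc a b, S.zetaReg A (σ + t * Complex.I) ≠ 0)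
    (hG : ∀ t ∈ Icc a b, ‖deriv ζ (σ + t * Complex.I) / ζ (σ + t * Complex.I)‖ ≤ G)
    (hE : ∀ t ∈ Icc a b, ‖gker T y (σ + t * Complex.I)‖ ≤ E) :
    ‖∫ t in a..b, S.logDerReg A (σ + t * Complex.I) * gker T y (σ + t * Complex.I)‖ ≤
      G * E * (∫ t in a..b, ‖1 - ζ (σ + t * Complex.I) * S.moe Y (σ + t * Complex.I)‖ ^ 2)
      + ‖S.prim ζ Y T y (σ + a * Complex.I)‖ + ‖S.prim ζ Y T y (σ + b * Complex.I)‖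
      + ‖∫ t in a..b, S.primRem ζ Y T y (σ + t * Complex.I)‖ := by
  have hre : ∀ t : ℝ, ((σ : ℂ) + t * Complex.I).re = σ := by intro t; simp
  have him : ∀ t : ℝ, ((σ : ℂ) + t * Complex.I).im = t := by intro t; simp
  have hre' : ∀ t : ℝ, θ < ((σ : ℂ) + t * Complex.I).re := fun t => by rw [hre]; exact hσ
  have hne : ∀ t ∈ Icc a b, (σ : ℂ) + t * Complex.I ≠ 1 := fun t h1 =>
    ne_one_of_one_le_im (by rw [him]; exact ht t h1)
  have hζ0 : ∀ t ∈ Icc a b, ζ ((σ : ℂ) + t * Complex.I) ≠ 0 := by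
    intro t h1 h2
    apply h0 t h1
    rw [hζ.zetaReg_eq h (hre' t) (hne t h1), h2, mul_zero]
  have hline : Continuous fun t : ℝ => (σ : ℂ) + t * Complex.I := by fun_prop
  have hcomp : ∀ f : ℂ → ℂ, (∀ t ∈ Icc a b, ContinuousAt f ((σ : ℂ) + t * Complex.I)) →
      ContinuousOn (fun t : ℝ => f ((σ : ℂ) + t * Complex.I)) (uIcc a b) := by
    intro f hf t h1
    rw [uIcc_of_le hab] at h1
    exact (ContinuousAt.comp (f := fun t : ℝ => (σ : ℂ) + t * Complex.I)
      (hf t h1) hline.continuousAt).continuousWithinAt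
  have cF := hcomp (S.logDerReg A) fun t h1 =>
    (h.continuousAt_logDerReg (hre' t) (h0 t h1)).continuousAt
  have cE := hcomp (gker T y) fun t _ => (differentiable_gker T y).continuous.continuousAt
  have cζ := hcomp ζ fun t h1 => (hζ.differentiableAt (hre' t) (hne t h1)).continuousAt
  have cM := hcomp (S.moe Y) fun t _ => (hasDerivAt_moe (S := S) Y _).continuousAt
  have cK := hcomp (S.primRem ζ Y T y) fun t h1 =>
    (hζ.differentiableAt_primRem Y T y (hre' t) (hne t h1)).continuousAt
  have cI := hcomp (fun s => 1 / (s - 1)) fun t h1 => by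
    refine ContinuousAt.div continuousAt_const (by fun_prop) (sub_ne_zero.2 (hne t h1))
  set F : ℝ → ℂ := fun t => S.logDerReg A (σ + t * Complex.I) * gker T y (σ + t * Complex.I) with hF
  set R : ℝ → ℂ := fun t => (S.logDerReg A (σ + t * Complex.I) + 1 / ((σ + t * Complex.I : ℂ) - 1))
    * (1 - ζ (σ + t * Complex.I) * S.moe Y (σ + t * Complex.I)) ^ 2
    * gker T y (σ + t * Complex.I) with hR
  set K : ℝ → ℂ := fun t => S.primRem ζ Y T y (σ + t * Complex.I) with hK
  have cF' : ContinuousOn F (uIcc a b) := cF.mul cE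
  have cR' : ContinuousOn R (uIcc a b) :=
    ((cF.add cI).mul ((continuousOn_const.sub (cζ.mul cM)).pow 2)).mul cE
  have hderiv : ∀ t ∈ uIcc a b, HasDerivAt (fun t : ℝ => -Complex.I * S.prim ζ Y T y (σ + t * Complex.I))
      (R t + K t - F t) t := by
    intro t h1
    rw [uIcc_of_le hab] at h1
    have h2 := hζ.hasDerivAt_prim h Y T y (hre' t) (hne t h1) (hζ0 t h1)
    have h3 : HasDerivAt (fun t : ℝ => (σ : ℂ) + t * Complex.I) Complex.I t := by
      have := (((hasDerivAt_id t).ofReal_comp).mul_const Complex.I).const_add (σ : ℂ)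
      simpa using this
    have h4 := (h2.comp t h3).const_mul (-Complex.I)
    refine h4.congr_deriv ?_
    simp only [hR, hK, hF]
    linear_combination (-((S.logDerReg A (σ + t * Complex.I) + 1 / ((σ + t * Complex.I : ℂ) - 1))
      * (1 - ζ (σ + t * Complex.I) * S.moe Y (σ + t * Complex.I)) ^ 2
      * gker T y (σ + t * Complex.I) + S.primRem ζ Y T y (σ + t * Complex.I)
      - S.logDerReg A (σ + t * Complex.I) * gker T y (σ + t * Complex.I))) * Complex.I_sq
  have iF : IntervalIntegrable F volume a b := cF'.intervalIntegrable
  have iR : IntervalIntegrable R volume a b := cR'.intervalIntegrable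
  have iK : IntervalIntegrable K volume a b := cK.intervalIntegrable
  have h5 := intervalIntegral.integral_eq_sub_of_hasDerivAt hderiv ((iR.add iK).sub iF)
  rw [intervalIntegral.integral_sub (iR.add iK) iF, intervalIntegral.integral_add iR iK] at h5
  have h6 : ∫ t in a..b, F t = (∫ t in a..b, R t) + (∫ t in a..b, K t)
      + Complex.I * S.prim ζ Y T y (σ + b * Complex.I) - Complex.I * S.prim ζ Y T y (σ + a * Complex.I) := by
    linear_combination -h5
  have h7 : ‖∫ t in a..b, R t‖ ≤ G * E *
      (∫ t in a..b, ‖1 - ζ (σ + t * Complex.I) * S.moe Y (σ + t * Complex.I)‖ ^ 2) := by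
    rw [← intervalIntegral.integral_const_mul]
    refine intervalIntegral.norm_integral_le_of_norm_le hab (Eventually.of_forall fun t h1 => ?_) ?_
    · have h1' : t ∈ Icc a b := Ioc_subset_Icc_self h1
      have h8 : S.logDerReg A (σ + t * Complex.I) + 1 / ((σ + t * Complex.I : ℂ) - 1)
          = -(deriv ζ (σ + t * Complex.I) / ζ (σ + t * Complex.I)) := by
        rw [hζ.logDerReg_eq h (hre' t) (hne t h1') (hζ0 t h1')]; ring
      simp only [hR]
      rw [h8, norm_mul, norm_mul, norm_neg, norm_pow]
      have h9 := hG t h1'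
      have h10 := hE t h1'
      calc _ = (‖deriv ζ (σ + t * Complex.I) / ζ (σ + t * Complex.I)‖ * ‖gker T y (σ + t * Complex.I)‖)
            * ‖1 - ζ (σ + t * Complex.I) * S.moe Y (σ + t * Complex.I)‖ ^ 2 := by ring
        _ ≤ _ := mul_le_mul_of_nonneg_right (mul_le_mul h9 h10 (norm_nonneg _)
            ((norm_nonneg _).trans h9)) (by positivity)
    · exact (continuousOn_const.mul ((continuousOn_const.sub (cζ.mul cM)).norm.pow 2)).intervalIntegrable
  rw [h6]
  refine (norm_sub_le _ _).trans ?_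
  refine (add_le_add ((norm_add_le _ _).trans (add_le_add (norm_add_le _ _) le_rfl)) le_rfl).trans ?_
  simp only [norm_mul, Complex.norm_I, one_mul]
  linarith

lemma norm_moment_le {f g r w : ℂ} {X q y : ℝ} (hX : 1 ≤ X) (hq : 2 ≤ q) (hy : 1 ≤ y)
    (hf : ‖f‖ ≤ X) (hg : ‖g‖ ≤ X) (hr : ‖r‖ ≤ 1 + q + y) (hw : ‖w‖ ≤ 1) :
    ‖2 * f - f ^ 2 / 2‖ ≤ 13 * X ^ 2 * (q * y) ∧
    ‖(2 - f) * g + (2 * f - f ^ 2 / 2) * r - w‖ ≤ 13 * X ^ 2 * (q * y) := by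
  have hXX : X ≤ X ^ 2 := by nlinarith
  have h1X : 1 ≤ X ^ 2 := by nlinarith
  have hqy : 2 ≤ q * y := by nlinarith
  have h1 : ‖2 * f - f ^ 2 / 2‖ ≤ 3 * X ^ 2 := by
    refine (norm_sub_le _ _).trans ?_
    rw [norm_mul, norm_div, norm_pow]
    simp only [Complex.norm_ofNat]
    have : ‖f‖ ^ 2 ≤ X ^ 2 := by gcongr
    nlinarith
  have h2 : ‖(2 - f) * g‖ ≤ 3 * X ^ 2 := by
    rw [norm_mul]
    have h3 : ‖2 - f‖ ≤ 2 + X := by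
      refine (norm_sub_le _ _).trans ?_
      simp only [Complex.norm_ofNat]
      linarith
    refine (mul_le_mul h3 hg (norm_nonneg _) (by linarith)).trans ?_
    nlinarith
  have h4 : ‖r‖ ≤ 3 * (q * y) := hr.trans (by nlinarith)
  have h5 : ‖(2 * f - f ^ 2 / 2) * r‖ ≤ 3 * X ^ 2 * (3 * (q * y)) := by
    rw [norm_mul]
    exact mul_le_mul h1 h4 (norm_nonneg _) (by positivity)
  refine ⟨h1.trans (by nlinarith), ?_⟩
  refine (norm_sub_le _ _).trans ((add_le_add ((norm_add_le _ _).trans (add_le_add h2 h5)) hw).trans ?_)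
  nlinarith

lemma norm_one_div_sub_one_le {s : ℂ} (h : 1 ≤ |s.im|) : ‖1 / (s - 1)‖ ≤ 1 := by
  have h1 := Complex.abs_im_le_norm (s - 1)
  simp only [Complex.sub_im, Complex.one_im, sub_zero] at h1
  rw [norm_div, norm_one]
  exact (div_le_one (by linarith)).2 (by linarith)

lemma norm_div_sq_le {T : ℝ} (hT : 1 ≤ T) (s : ℂ) (y : ℝ) (hy : 0 ≤ y) :
    ‖s / (T : ℂ) ^ 2 + y‖ ≤ ‖s‖ + y := by
  refine (norm_add_le _ _).trans (add_le_add ?_ (le_of_eq (by simp [abs_of_nonneg hy])))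
  rw [norm_div, norm_pow, Complex.norm_real, Real.norm_eq_abs, abs_of_nonneg (by linarith)]
  exact div_le_self (norm_nonneg _) (by nlinarith)

lemma norm_line_le {σ : ℝ} (h0 : 0 ≤ σ) (h1 : σ ≤ 1) (t : ℝ) :
    ‖(σ : ℂ) + t * Complex.I‖ ≤ 1 + |t| := by
  refine (norm_add_le _ _).trans (add_le_add ?_ (by simp))
  rw [Complex.norm_real, Real.norm_eq_abs, abs_of_nonneg h0]; exact h1

lemma IsZeta.exists_norm_prim_le {ζ : ℂ → ℂ} (hζ : S.IsZeta θ ζ) (h : S.WellBehaved A θ K₀) :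
    ∃ C : ℝ, 0 < C ∧ ∀ L y T σ t : ℝ, 1 ≤ L → L ≤ y → 1 ≤ T → 1 - (1 - θ) / 4 ≤ σ → σ ≤ 1 →
      2 ≤ |t| →
      ‖S.prim ζ (Real.exp (L / (1 - θ))) T y (σ + t * Complex.I)‖ ≤ C * |t| ^ 3 * y ^ 5 *
        (Real.exp (L / (1 - θ)) ^ (1 - σ)) ^ 2 * ‖gker T y (σ + t * Complex.I)‖ ∧
      ‖S.primRem ζ (Real.exp (L / (1 - θ))) T y (σ + t * Complex.I)‖ ≤ C * |t| ^ 3 * y ^ 5 *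
        (Real.exp (L / (1 - θ)) ^ (1 - σ)) ^ 2 * ‖gker T y (σ + t * Complex.I)‖ := by
  obtain ⟨C, hC, hb⟩ := h.exists_norm_dirPoly_le
  have hA := h.1
  have hθ0 := h.2.1
  have hθ := h.2.2.1
  have hK := h.2.2.2.1
  have hθp : 0 < 1 - θ := by linarith
  set C₁ : ℝ := 2 * A + 2 * (K₀ / ((1 - θ) / 2)) with hC₁
  have hC₁0 : 0 < C₁ := by positivity
  set C₂ : ℝ := 1 + C₁ * C + C₁ * (C * (1 / (1 - θ))) with hC₂
  have hC₂1 : 1 ≤ C₂ := by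
    have : 0 ≤ C₁ * C + C₁ * (C * (1 / (1 - θ))) := by positivity
    linarith
  refine ⟨13 * C₂ ^ 2, by positivity, fun L y T σ t hL hLy hT hσ hσ1 ht => ?_⟩
  set Y := Real.exp (L / (1 - θ)) with hY
  set s : ℂ := σ + t * Complex.I with hs
  have hre : s.re = σ := by simp [hs]
  have him : s.im = t := by simp [hs]
  have hσ0 : 0 ≤ σ := by linarith
  set V := Y ^ (1 - σ) with hV
  have hY1 : 1 ≤ Y := Real.one_le_exp (by positivity)
  have hV1 : 1 ≤ V := Real.one_le_rpow hY1 (by linarith)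
  set X := C₂ * |t| * y ^ 2 * V with hX
  have hy1 : 1 ≤ y := hL.trans hLy
  have hs1 : ‖s‖ ≤ 1 + |t| := norm_line_le hσ0 hσ1 t
  have hz : ‖ζ s‖ ≤ C₁ * |t| := by
    refine (hζ.norm_le h (s := s) (by rw [hre]; linarith) ?_).trans ?_
    · have := Complex.abs_im_le_norm (s - 1)
      simp only [Complex.sub_im, Complex.one_im, sub_zero, him] at this
      linarith
    · rw [hre]
      have h1 : K₀ / (σ - θ) ≤ K₀ / ((1 - θ) / 2) := by
        refine div_le_div_of_nonneg_left hK (by linarith) (by linarith)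
      have h2 : ‖s‖ * (K₀ / (σ - θ)) ≤ (2 * |t|) * (K₀ / ((1 - θ) / 2)) :=
        mul_le_mul (by linarith) h1 (div_nonneg hK (by linarith)) (by positivity)
      rw [hC₁]
      nlinarith
  have hLy2 : L ≤ y ^ 2 := by nlinarith
  have hL2 : L ^ 2 ≤ y ^ 2 := by gcongr
  have hf : ‖ζ s * S.moe Y s‖ ≤ X := by
    have h1 := hb L 1 (fun n => (gMoebius n : ℂ)) s hL zero_le_one
      (fun n hn => norm_gMoebius_le n) (by rw [hre]; exact hσ1)
    rw [hre, mul_one] at h1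
    rw [norm_mul]
    calc ‖ζ s‖ * ‖S.moe Y s‖ ≤ (C₁ * |t|) * (C * L * V) :=
          mul_le_mul hz h1 (norm_nonneg _) (by positivity)
      _ ≤ (C₁ * |t|) * (C * y ^ 2 * V) := by gcongr
      _ = (C₁ * C) * |t| * y ^ 2 * V := by ring
      _ ≤ X := by
          rw [hX]; gcongr
          rw [hC₂]
          have : 0 ≤ C₁ * (C * (1 / (1 - θ))) := by positivity
          linarith
  have hg : ‖ζ s * S.moeDer Y s‖ ≤ X := by
    have h1 := hb L (1 / (1 - θ) * L) (fun n => -((Real.log (S.val n) : ℂ) * (gMoebius n : ℂ))) s hL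
      (by positivity) h.norm_log_gMoebius_le (by rw [hre]; exact hσ1)
    rw [hre] at h1
    rw [norm_mul]
    calc ‖ζ s‖ * ‖S.moeDer Y s‖ ≤ (C₁ * |t|) * (C * (1 / (1 - θ) * L) * L * V) :=
          mul_le_mul hz h1 (norm_nonneg _) (by positivity)
      _ = C₁ * (C * (1 / (1 - θ))) * |t| * L ^ 2 * V := by ring
      _ ≤ X := by
          rw [hX]; gcongr
          rw [hC₂]
          have : 0 ≤ C₁ * C := by positivity
          linarith
  have hX1 : 1 ≤ X := by
    rw [hX]
    refine one_le_mul_of_one_le_of_one_le (one_le_mul_of_one_le_of_one_le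
      (one_le_mul_of_one_le_of_one_le hC₂1 (by linarith)) (one_le_pow₀ hy1)) hV1
  obtain ⟨h1, h2⟩ := norm_moment_le (r := s / (T : ℂ) ^ 2 + y) (w := 1 / (s - 1)) hX1 ht hy1 hf hg
    ((norm_div_sq_le hT s y (by linarith)).trans (by linarith))
    (norm_one_div_sub_one_le (by rw [him]; linarith))
  have e : 13 * X ^ 2 * (|t| * y) = 13 * C₂ ^ 2 * |t| ^ 3 * y ^ 5 * V ^ 2 := by rw [hX]; ring
  rw [e] at h1 h2
  constructor
  · rw [prim, norm_mul]
    exact mul_le_mul_of_nonneg_right h1 (norm_nonneg _)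
  · rw [primRem, norm_mul]
    exact mul_le_mul_of_nonneg_right h2 (norm_nonneg _)

lemma norm_moment_le_sq {f g r w : ℂ} {y : ℝ} (hy : 1 ≤ y) (hr : ‖r‖ ≤ 66 * y) (hw : ‖w‖ ≤ 1) :
    ‖(2 - f) * g + (2 * f - f ^ 2 / 2) * r - w‖ ≤ 140 * y * (1 + ‖f‖ ^ 2 + ‖g‖ ^ 2) := by
  have h1 : ‖2 * f - f ^ 2 / 2‖ ≤ 2 + ‖f‖ ^ 2 := by
    refine (norm_sub_le _ _).trans ?_
    rw [norm_mul, norm_div, norm_pow]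
    simp only [Complex.norm_ofNat]
    nlinarith [sq_nonneg (‖f‖ - 2)]
  have h2 : ‖(2 - f) * g‖ ≤ 4 + ‖f‖ ^ 2 + ‖g‖ ^ 2 := by
    rw [norm_mul]
    have h3 : ‖2 - f‖ ≤ 2 + ‖f‖ := by
      refine (norm_sub_le _ _).trans ?_
      simp only [Complex.norm_ofNat]
      exact le_rfl
    refine (mul_le_mul_of_nonneg_right h3 (norm_nonneg _)).trans ?_
    nlinarith [sq_nonneg (2 + ‖f‖ - ‖g‖), sq_nonneg (‖f‖ - 2), sq_nonneg ‖g‖]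
  have h5 : ‖(2 * f - f ^ 2 / 2) * r‖ ≤ (2 + ‖f‖ ^ 2) * (66 * y) := by
    rw [norm_mul]
    exact mul_le_mul h1 hr (norm_nonneg _) (by positivity)
  refine (norm_sub_le _ _).trans ((add_le_add ((norm_add_le _ _).trans (add_le_add h2 h5)) hw).trans ?_)
  have h6 : ‖f‖ ^ 2 ≤ y * ‖f‖ ^ 2 := le_mul_of_one_le_left (by positivity) hy
  have h7 : ‖g‖ ^ 2 ≤ y * ‖g‖ ^ 2 := le_mul_of_one_le_left (by positivity) hy
  nlinarith [sq_nonneg ‖f‖, sq_nonneg ‖g‖]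

lemma IsZeta.exists_integral_primRem_le {ζ : ℂ → ℂ} (hζ : S.IsZeta θ ζ)
    (h : S.WellBehaved A θ K₀) :
    ∃ C : ℝ, 0 < C ∧ ∀ L y T a b : ℝ, 1 ≤ L → L ≤ y → 1 ≤ T → Real.exp L ≤ 64 * T ^ 2 → a ≤ b →
      (∀ t ∈ Icc a b, 2 ≤ |t| ∧ |t| ≤ Real.exp L) →
      ‖∫ t in a..b, S.primRem ζ (Real.exp (L / (1 - θ))) T y ((1 - (1 - θ) / 4 : ℝ) + t * Complex.I)‖
        ≤ C * y ^ 7 * Real.exp ((1 - (1 - θ) / 4) * y) * Real.exp L := by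
  obtain ⟨C, hC, hb⟩ := hζ.exists_integral_mul_le h
  have hθ0 := h.2.1
  have hθ := h.2.2.1
  have hθp : 0 < 1 - θ := by linarith
  set q := 1 / (1 - θ) with hq
  have hq0 : 0 < q := by positivity
  refine ⟨8 * 140 * (2 + C + C * q ^ 2), by positivity, fun L y T a b hL hLy hT hLT hab ht => ?_⟩
  set Y := Real.exp (L / (1 - θ)) with hY
  set σ : ℝ := 1 - (1 - θ) / 4 with hσ
  have hσθ : θ < σ := by rw [hσ]; linarith
  have hσ0 : 0 ≤ σ := by linarith
  have hσ1 : σ ≤ 1 := by rw [hσ]; linarith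
  have hy1 : 1 ≤ y := hL.trans hLy
  have ha := abs_le.1 (ht a (left_mem_Icc.2 hab)).2
  have hbb := abs_le.1 (ht b (right_mem_Icc.2 hab)).2
  have ht1 : ∀ t ∈ Icc a b, 1 ≤ |t| := fun t h1 => by linarith [(ht t h1).1]
  have i1 := hb L 1 a b (fun n => (gMoebius n : ℂ)) hL zero_le_one (fun n _ => norm_gMoebius_le n)
    ha.1 hab hbb.2 ht1
  have i2 := hb L (q * L) a b (fun n => -((Real.log (S.val n) : ℂ) * (gMoebius n : ℂ))) hL
    (by positivity) h.norm_log_gMoebius_le ha.1 hab hbb.2 ht1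
  have cζ := hζ.continuousOn_line hσθ ht1
  have hcd : ∀ (Z : ℝ) (b : (ℕ →₀ ℕ) → ℂ),
      Continuous fun t : ℝ => S.dirPoly Z b (σ + t * Complex.I) := fun Z b =>
    (differentiable_dirPoly Z b).continuous.comp (by fun_prop)
  have c1 : IntervalIntegrable (fun t : ℝ => ‖ζ (σ + t * Complex.I) * S.moe Y (σ + t * Complex.I)‖ ^ 2)
      volume a b := by
    refine ContinuousOn.intervalIntegrable ?_
    rw [uIcc_of_le hab]
    exact (cζ.mul (hcd Y _).continuousOn).norm.pow 2
  have c2 : IntervalIntegrable (fun t : ℝ => ‖ζ (σ + t * Complex.I) * S.moeDer Y (σ + t * Complex.I)‖ ^ 2)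
      volume a b := by
    refine ContinuousOn.intervalIntegrable ?_
    rw [uIcc_of_le hab]
    exact (cζ.mul (hcd Y _).continuousOn).norm.pow 2
  have c0 : IntervalIntegrable (fun _ : ℝ => (1 : ℝ)) volume a b := intervalIntegrable_const
  have hpt : ∀ t ∈ Ioc a b, ‖S.primRem ζ Y T y (σ + t * Complex.I)‖ ≤
      8 * Real.exp (σ * y) * (140 * y) * (1 + ‖ζ (σ + t * Complex.I) * S.moe Y (σ + t * Complex.I)‖ ^ 2
        + ‖ζ (σ + t * Complex.I) * S.moeDer Y (σ + t * Complex.I)‖ ^ 2) := by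
    intro t h1
    have h1' := Ioc_subset_Icc_self h1
    have hr : ‖(σ + t * Complex.I : ℂ) / (T : ℂ) ^ 2 + y‖ ≤ 66 * y := by
      refine (norm_add_le _ _).trans ?_
      rw [norm_div, norm_pow, Complex.norm_real, Complex.norm_real, Real.norm_eq_abs,
        Real.norm_eq_abs, abs_of_nonneg (by linarith : 0 ≤ T), abs_of_nonneg (by linarith : 0 ≤ y)]
      have h2 := norm_line_le hσ0 hσ1 t
      have h3 : ‖(σ + t * Complex.I : ℂ)‖ / T ^ 2 ≤ 65 := by
        rw [div_le_iff₀ (by positivity)]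
        nlinarith [(ht t h1').2]
      linarith
    rw [primRem, norm_mul]
    refine (mul_le_mul (norm_moment_le_sq hy1 hr (norm_one_div_sub_one_le (by simpa using ht1 t h1')))
      (norm_gker_le (y := y) hT hσ0 (by linarith) t) (norm_nonneg _) (by positivity)).trans (le_of_eq ?_)
    ring
  refine (intervalIntegral.norm_integral_le_of_norm_le hab (Eventually.of_forall hpt)
    (((c0.add c1).add c2).const_mul _)).trans ?_
  rw [intervalIntegral.integral_const_mul, intervalIntegral.integral_add (c0.add c1) c2,
    intervalIntegral.integral_add c0 c1, intervalIntegral.integral_const]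
  have hLy4 : L ^ 4 ≤ y ^ 6 :=
    (pow_le_pow_left₀ (by linarith) hLy 4).trans (pow_le_pow_right₀ hy1 (by norm_num))
  have hLy6 : L ^ 6 ≤ y ^ 6 := pow_le_pow_left₀ (by linarith) hLy 6
  have h1y6 : 1 ≤ y ^ 6 := one_le_pow₀ hy1
  have hE := Real.exp_pos L
  have j0 : (b - a) • (1 : ℝ) ≤ 2 * y ^ 6 * Real.exp L := by
    rw [smul_eq_mul, mul_one]
    nlinarith
  have j1 : C * (1 : ℝ) ^ 2 * L ^ 4 * Real.exp L ≤ C * y ^ 6 * Real.exp L := by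
    rw [one_pow, mul_one]; gcongr
  have j2 : C * (q * L) ^ 2 * L ^ 4 * Real.exp L ≤ C * q ^ 2 * y ^ 6 * Real.exp L := by
    have : C * (q * L) ^ 2 * L ^ 4 * Real.exp L = C * q ^ 2 * L ^ 6 * Real.exp L := by ring
    rw [this]; gcongr
  refine (mul_le_mul_of_nonneg_left (add_le_add (add_le_add j0 (i1.trans j1)) (i2.trans j2))
    (by positivity)).trans (le_of_eq ?_)
  ring

/-- The three error terms of the contour argument. -/
noncomputable def errTerm (θ d L y T : ℝ) : ℝ :=
  Real.exp (y - 8 / 9 * width d L * y + 4 * (8 / 9 * width d L) * (L / (1 - θ)))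
    + Real.exp y * (Real.exp L ^ 3 * Real.exp (-(Real.exp L ^ 2 / (4 * T ^ 2))))
    + Real.exp ((1 - (1 - θ) / 4) * y) * Real.exp L

lemma width_pos {d L : ℝ} (hd : 0 < d) (hL : 3 ≤ L) : 0 < width d L := by
  unfold width
  have : 0 < Real.log L := Real.log_pos (by linarith)
  positivity

lemma rpow_sq_mul_exp_le {θ L y σ η : ℝ} (hθ : θ < 1) (hL : 0 ≤ L) (hLy : 2 * (L / (1 - θ)) ≤ y)
    (hη : 0 ≤ η) (hσ : σ ≤ 1 - η) :
    (Real.exp (L / (1 - θ)) ^ (1 - σ)) ^ 2 * Real.exp (σ * y)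
      ≤ Real.exp (y - η * y + 4 * η * (L / (1 - θ))) ∧
    (Real.exp (L / (1 - θ)) ^ (1 - σ)) ^ 2 * Real.exp (σ * y) ≤ Real.exp y := by
  have hq : 0 ≤ L / (1 - θ) := div_nonneg hL (by linarith)
  have e : (Real.exp (L / (1 - θ)) ^ (1 - σ)) ^ 2 * Real.exp (σ * y)
      = Real.exp (y - (1 - σ) * (y - 2 * (L / (1 - θ)))) := by
    rw [← Real.exp_mul, ← Real.exp_nat_mul, ← Real.exp_add]
    congr 1; push_cast; ring
  rw [e]
  constructor <;> rw [Real.exp_le_exp]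
  · have h1 : η * (y - 2 * (L / (1 - θ))) ≤ (1 - σ) * (y - 2 * (L / (1 - θ))) :=
      mul_le_mul_of_nonneg_right (by linarith) (by linarith)
    have h2 : 0 ≤ η * (L / (1 - θ)) := mul_nonneg hη hq
    linarith
  · have := mul_nonneg (by linarith : 0 ≤ 1 - σ) (by linarith : 0 ≤ y - 2 * (L / (1 - θ)))
    linarith

/-- The contour integral of the regularised logarithmic derivative over a vertical segment. -/
lemma IsZeta.exists_integral_segment_le {ζ : ℂ → ℂ} (hζ : S.IsZeta θ ζ) (h : S.WellBehaved A θ K₀)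
    {d η₀ : ℝ} (hd : 0 < d) (hη₀ : ∀ L : ℝ, 3 ≤ L → width d L ≤ η₀ →
      ∀ s : ℂ, 1 - width d L < s.re → |s.im| ≤ Real.exp L + 1 → S.zetaReg A s ≠ 0) :
    ∃ C : ℝ, 0 < C ∧ ∀ L y T a b : ℝ, 3 ≤ L → width d L ≤ η₀ → width d L ≤ 1 / 4 →
      width d L ≤ (1 - θ) / 4 → L ≤ y → 1 ≤ T → Real.exp L ≤ 64 * T ^ 2 →
      2 * (L / (1 - θ)) ≤ y → a ≤ b →
      (∀ t ∈ Icc a b, 2 ≤ |t| ∧ |t| ≤ Real.exp L) → (|a| = 2 ∨ |a| = Real.exp L) →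
      (|b| = 2 ∨ |b| = Real.exp L) →
      ‖∫ t in a..b, S.logDerReg A ((1 - 8 / 9 * width d L : ℝ) + t * Complex.I)
        * gker T y ((1 - 8 / 9 * width d L : ℝ) + t * Complex.I)‖ ≤ C * y ^ 7 * errTerm θ d L y T := by
  obtain ⟨C₁, hC₁, hb₁⟩ := hζ.exists_norm_prim_le h
  obtain ⟨C₂, hC₂, hb₂⟩ := hζ.exists_logDeriv_bound h hd hη₀
  obtain ⟨C₃, hC₃, hb₃⟩ := hζ.exists_integral_rem_le h
  obtain ⟨C₄, hC₄, hb₄⟩ := hζ.exists_integral_primRem_le h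
  have hθ0 := h.2.1
  have hθ := h.2.2.1
  have hθp : 0 < 1 - θ := by linarith
  refine ⟨8 * C₂ * C₃ + 4 * (64 * C₁) + C₄, by positivity, ?_⟩
  intro L y T a b hL hw₀ hw₁ hw₂ hLy hT hLT hLθ hab ht ha hb
  set w := width d L with hwdef
  have hw : 0 < w := width_pos hd hL
  set η := 8 / 9 * w with hη
  have hη0 : 0 < η := by positivity
  have hηw : η < w := by rw [hη]; linarith
  set σ : ℝ := 1 - η with hσ
  set κ : ℝ := (1 - θ) / 4 with hκ
  have hy3 : 3 ≤ y := hL.trans hLy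
  have hy1 : 1 ≤ y := by linarith
  set Φ := Real.exp (y - η * y + 4 * η * (L / (1 - θ))) with hΦ
  set Ψ := Real.exp y * (Real.exp L ^ 3 * Real.exp (-(Real.exp L ^ 2 / (4 * T ^ 2)))) with hΨ
  set Ω := Real.exp ((1 - κ) * y) * Real.exp L with hΩ
  have hΦ0 : 0 < Φ := Real.exp_pos _
  have hΨ0 : 0 < Ψ := by positivity
  have hΩ0 : 0 < Ω := by positivity
  have hend : ∀ p : ℝ, (|p| = 2 ∨ |p| = Real.exp L) → ∀ r : ℝ, 1 - κ ≤ r → r ≤ σ →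
      C₁ * |p| ^ 3 * y ^ 5 * (Real.exp (L / (1 - θ)) ^ (1 - r)) ^ 2 * ‖gker T y (r + p * Complex.I)‖
        ≤ 64 * C₁ * y ^ 5 * (Φ + Ψ) := by
    intro p hp r hr hr1
    have hr0 : 0 ≤ r := by rw [hκ] at hr; linarith
    obtain ⟨e1, e2⟩ := rpow_sq_mul_exp_le hθ (by linarith : 0 ≤ L) hLθ hη0.le hr1
    rcases hp with hp | hp
    · have h1 := norm_gker_le (y := y) hT hr0 (by linarith) p
      rw [hp]
      calc _ ≤ C₁ * 2 ^ 3 * y ^ 5 * (Real.exp (L / (1 - θ)) ^ (1 - r)) ^ 2 * (8 * Real.exp (r * y)) :=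
            mul_le_mul_of_nonneg_left h1 (by positivity)
        _ = 64 * C₁ * y ^ 5 * ((Real.exp (L / (1 - θ)) ^ (1 - r)) ^ 2 * Real.exp (r * y)) := by ring
        _ ≤ _ := by gcongr; linarith
    · have h1 := norm_gker_le_of_abs_eq (y := y) hT hr0 (by linarith) (Real.exp_pos L).le hp.ge
      rw [hp]
      calc _ ≤ C₁ * Real.exp L ^ 3 * y ^ 5 * (Real.exp (L / (1 - θ)) ^ (1 - r)) ^ 2
              * (8 * Real.exp (r * y) * Real.exp (-(Real.exp L ^ 2 / (4 * T ^ 2)))) :=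
            mul_le_mul_of_nonneg_left h1 (by positivity)
        _ = 8 * C₁ * y ^ 5 * (((Real.exp (L / (1 - θ)) ^ (1 - r)) ^ 2 * Real.exp (r * y))
              * (Real.exp L ^ 3 * Real.exp (-(Real.exp L ^ 2 / (4 * T ^ 2))))) := by ring
        _ ≤ 8 * C₁ * y ^ 5 * Ψ := by rw [hΨ]; gcongr
        _ ≤ _ := by
            gcongr
            · norm_num
            · linarith
  have hσκ : 1 - κ ≤ σ := by linarith
  have hσ1 : σ ≤ 1 := by linarith
  have hat := ht a (left_mem_Icc.2 hab)
  have hbt := ht b (right_mem_Icc.2 hab)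
  have ht1 : ∀ t ∈ Icc a b, 1 ≤ |t| := fun t h1 => by linarith [(ht t h1).1]
  have m1 := hζ.norm_integral_logDerReg_le h (Real.exp (L / (1 - θ))) T y (σ := σ) (a := a) (b := b)
    (G := C₂ * L ^ 2) (E := 8 * Real.exp (σ * y)) (by linarith) hab ht1
    (fun t h1 => hη₀ L hL hw₀ _ (by simp; linarith) (by simpa using by linarith [(ht t h1).2]))
    (fun t h1 => hb₂ L hL hw₀ hw₁ (by linarith) _ (by simp [hσ]; linarith) (by simp; linarith)
      (by simpa using (ht t h1).1) (by simpa using (ht t h1).2))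
    (fun t _ => norm_gker_le hT (by linarith) (by linarith) t)
  have m2 := hb₃ L σ a b (by linarith) (by linarith) hσ1 (abs_le.1 hat.2).1 hab (abs_le.1 hbt.2).2 ht1
  have m3 := norm_integral_shift_le (f := S.primRem ζ (Real.exp (L / (1 - θ))) T y)
    (a := 1 - κ) (b := σ) (x := a) (y := b) (D := 64 * C₁ * y ^ 5 * (Φ + Ψ)) hσκ (by linarith) hab
    (fun s h1 _ h2 h3 => hζ.differentiableAt_primRem _ T y (by linarith)
      (ne_one_of_one_le_im (ht1 _ ⟨h2, h3⟩)))
    (fun r h1 h2 => (hb₁ L y T r a (by linarith) hLy hT h1 (by linarith) hat.1).2.trans (hend a ha r h1 h2))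
    (fun r h1 h2 => (hb₁ L y T r b (by linarith) hLy hT h1 (by linarith) hbt.1).2.trans (hend b hb r h1 h2))
  have m4 := hb₄ L y T a b (by linarith) hLy hT hLT hab ht
  have m5 := (hb₁ L y T σ a (by linarith) hLy hT hσκ hσ1 hat.1).1.trans (hend a ha σ hσκ le_rfl)
  have m6 := (hb₁ L y T σ b (by linarith) hLy hT hσκ hσ1 hbt.1).1.trans (hend b hb σ hσκ le_rfl)
  have m7 : C₂ * L ^ 2 * (8 * Real.exp (σ * y)) * (∫ t in a..b, ‖1 - ζ (σ + t * Complex.I)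
      * S.moe (Real.exp (L / (1 - θ))) (σ + t * Complex.I)‖ ^ 2) ≤ 8 * C₂ * C₃ * y ^ 7 * Φ := by
    have e : Real.exp (σ * y) * Real.exp (L / (1 - θ)) ^ (4 * (1 - σ)) = Φ := by
      rw [← Real.exp_mul, ← Real.exp_add, hΦ, hσ]
      congr 1; ring
    have hL6 : L ^ 6 ≤ y ^ 7 :=
      (pow_le_pow_left₀ (by linarith) hLy 6).trans (pow_le_pow_right₀ hy1 (by norm_num))
    calc _ ≤ C₂ * L ^ 2 * (8 * Real.exp (σ * y)) * (C₃ * L ^ 4 * Real.exp (L / (1 - θ)) ^ (4 * (1 - σ))) :=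
          mul_le_mul_of_nonneg_left m2 (by positivity)
      _ = 8 * C₂ * C₃ * L ^ 6 * (Real.exp (σ * y) * Real.exp (L / (1 - θ)) ^ (4 * (1 - σ))) := by ring
      _ ≤ _ := by rw [e]; gcongr
  have h57 : y ^ 5 ≤ y ^ 7 := pow_le_pow_right₀ hy1 (by norm_num)
  have m8 : 64 * C₁ * y ^ 5 * (Φ + Ψ) ≤ 64 * C₁ * y ^ 7 * (Φ + Ψ) := by gcongr
  have m9 : C₄ * y ^ 7 * Real.exp ((1 - κ) * y) * Real.exp L = C₄ * y ^ 7 * Ω := by rw [hΩ]; ring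
  have hfin : errTerm θ d L y T = Φ + Ψ + Ω := by
    rw [errTerm]
  rw [hfin]
  rw [m9] at m4
  have n1 : 0 ≤ 8 * C₂ * C₃ * y ^ 7 * (Ψ + Ω) := by positivity
  have n2 : 0 ≤ 4 * (64 * C₁ * y ^ 7 * Ω) := by positivity
  have n3 : 0 ≤ C₄ * y ^ 7 * (Φ + Ψ) := by positivity
  have e : (8 * C₂ * C₃ + 4 * (64 * C₁) + C₄) * y ^ 7 * (Φ + Ψ + Ω)
      = 8 * C₂ * C₃ * y ^ 7 * Φ + 4 * (64 * C₁ * y ^ 7 * (Φ + Ψ)) + C₄ * y ^ 7 * Ω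
        + (8 * C₂ * C₃ * y ^ 7 * (Ψ + Ω) + 4 * (64 * C₁ * y ^ 7 * Ω) + C₄ * y ^ 7 * (Φ + Ψ)) := by ring
  rw [e]
  refine m1.trans ?_
  linarith only [m3, m4, m5, m6, m7, m8, n1, n2, n3]

set_option maxHeartbeats 1600000 in
/-- The smoothed prime number theorem with explicit error terms. -/
lemma IsZeta.exists_abs_smooth_sub_le {ζ : ℂ → ℂ} (hζ : S.IsZeta θ ζ) (h : S.WellBehaved A θ K₀)
    {d t₀ : ℝ} (hd : 0 < d)
    (hZ : ∀ ρ : ℂ, θ < ρ.re → ρ ≠ 1 → t₀ < ρ.im →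
      1 - d * Real.log (Real.log ρ.im) / Real.log ρ.im < ρ.re → ζ ρ ≠ 0) :
    ∃ C m : ℝ, 0 < C ∧ 0 < m ∧ ∀ L y T : ℝ, 3 ≤ L → width d L ≤ m → L ≤ y → 1 / y ≤ width d L →
      1 ≤ T → T ≤ Real.exp L → Real.exp L ≤ 64 * T ^ 2 → 2 * (L / (1 - θ)) ≤ y →
      |S.smooth T y - Real.exp y| ≤ C * y ^ 7 * errTerm θ d L y T
        + (Real.exp y * (Real.exp (1 / (2 * T ^ 2)) - 1) + 1) := by
  obtain ⟨η₀, hη₀, -, hzf⟩ := hζ.exists_zeroFree h hd hZ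
  obtain ⟨C₁, hC₁, hb₁⟩ := hζ.exists_integral_segment_le h hd hzf
  obtain ⟨C₂, hC₂, hb₂⟩ := hζ.exists_logDeriv_bound h hd hzf
  obtain ⟨C₃, hC₃, hb₃⟩ := hζ.exists_integral_tail_le h
  obtain ⟨η₁, C₄, hη₁, hC₄, hb₄⟩ := hζ.exists_logDerReg_bound h 2
  have hθ0 := h.2.1
  have hθ := h.2.2.1
  have hθp : 0 < 1 - θ := by linarith
  refine ⟨C₃ + 2 * (24 * (C₂ + 1)) + 2 * C₁ + 32 * C₄, min (min η₀ η₁) (min (1 / 4) ((1 - θ) / 4)),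
    by positivity, by positivity, ?_⟩
  intro L y T hL hwm hLy hyw hT hTL hLT hLθ
  simp only [le_min_iff] at hwm
  obtain ⟨⟨hw₀, hw₃⟩, hw₁, hw₂⟩ := hwm
  have hw : 0 < width d L := width_pos hd hL
  have hy3 : 3 ≤ y := hL.trans hLy
  have hy1 : 1 ≤ y := by linarith
  have hy0 : 0 < y := by linarith
  have hiy : 0 < 1 / y := by positivity
  have hT0 : 0 < T := by linarith
  refine (hζ.abs_smooth_sub_le h (c := 1 + 1 / y) (by linarith) (by linarith) hT0 y).trans
    (add_le_add ?_ le_rfl)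
  have m1 := hb₃ T (Real.exp L) y hT hy1 (Real.exp_pos L).le
  set σ : ℝ := 1 - 8 / 9 * width d L with hσ
  set f : ℂ → ℂ := fun s => S.logDerReg A s * gker T y s with hf
  set Φ := Real.exp (y - 8 / 9 * width d L * y + 4 * (8 / 9 * width d L) * (L / (1 - θ))) with hΦ
  set τ := Real.exp (-(Real.exp L ^ 2 / (4 * T ^ 2))) with hτ
  set Ψ := Real.exp y * (Real.exp L ^ 3 * τ) with hΨ
  set Ω := Real.exp ((1 - (1 - θ) / 4) * y) * Real.exp L with hΩ
  have hΦ0 : 0 < Φ := Real.exp_pos _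
  have hΨ0 : 0 < Ψ := by positivity
  have hΩ0 : 0 < Ω := by positivity
  have hfin : errTerm θ d L y T = Φ + Ψ + Ω := rfl
  have hexp3 : 3 ≤ Real.exp L := by linarith [Real.add_one_le_exp L]
  have hdiff : ∀ s : ℂ, σ ≤ s.re → |s.im| ≤ Real.exp L → DifferentiableAt ℂ f s := fun s h1 h2 =>
    (h.continuousAt_logDerReg (by linarith) (hzf L hL hw₀ s (by linarith) (by linarith))).mul
      (differentiable_gker T y s)
  have hτ3 : Real.exp y * τ ≤ Ψ := by
    rw [hΨ]
    have : 1 ≤ Real.exp L ^ 3 := one_le_pow₀ (by linarith)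
    have h0 : 0 < Real.exp y * τ := by positivity
    nlinarith
  have hhor : ∀ p : ℝ, |p| = Real.exp L → ∀ r : ℝ, σ ≤ r → r ≤ 1 + 1 / y →
      ‖f (r + p * Complex.I)‖ ≤ 24 * (C₂ + 1) * y ^ 2 * Ψ := by
    intro p hp r h1 h2
    have hre : ((r : ℂ) + p * Complex.I).re = r := by simp
    have him : ((r : ℂ) + p * Complex.I).im = p := by simp
    have hr0 : 0 ≤ r := by linarith
    have hne : (r : ℂ) + p * Complex.I ≠ 1 := ne_one_of_one_le_im (by rw [him, hp]; linarith)
    have hzr := hzf L hL hw₀ ((r : ℂ) + p * Complex.I) (by rw [hre]; linarith) (by rw [him, hp]; linarith)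
    have hθr : θ < ((r : ℂ) + p * Complex.I).re := by rw [hre]; linarith
    have hz0 : ζ ((r : ℂ) + p * Complex.I) ≠ 0 := by
      intro h0; apply hzr
      rw [hζ.zetaReg_eq h hθr hne, h0, mul_zero]
    have n1 := hb₂ L hL hw₀ hw₁ (by linarith) ((r : ℂ) + p * Complex.I) (by rw [hre]; exact h1)
      (by rw [hre]; linarith) (by rw [him, hp]; linarith) (by rw [him, hp])
    have n2 : ‖S.logDerReg A ((r : ℂ) + p * Complex.I)‖ ≤ (C₂ + 1) * y ^ 2 := by
      rw [hζ.logDerReg_eq h hθr hne hz0]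
      refine (norm_sub_le _ _).trans ?_
      rw [norm_neg]
      have n3 := norm_one_div_sub_one_le (s := (r : ℂ) + p * Complex.I) (by rw [him, hp]; linarith)
      have n4 : L ^ 2 ≤ y ^ 2 := by gcongr
      have n5 : 1 ≤ y ^ 2 := one_le_pow₀ hy1
      nlinarith
    have n6 := norm_gker_le_of_abs_eq (y := y) hT hr0 (by linarith : r ≤ 2) (Real.exp_pos L).le hp.ge
    have n7 : Real.exp (r * y) ≤ 3 * Real.exp y := by
      have : r * y ≤ 1 + y := by
        calc r * y ≤ (1 + 1 / y) * y := by gcongr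
          _ = 1 + y := by field_simp; ring
      calc Real.exp (r * y) ≤ Real.exp (1 + y) := Real.exp_le_exp.2 this
        _ = Real.exp 1 * Real.exp y := Real.exp_add _ _
        _ ≤ _ := by gcongr; linarith [Real.exp_one_lt_d9]
    rw [hf]; simp only [norm_mul]
    calc _ ≤ ((C₂ + 1) * y ^ 2) * (8 * Real.exp (r * y) * τ) :=
          mul_le_mul n2 n6 (norm_nonneg _) (by positivity)
      _ ≤ ((C₂ + 1) * y ^ 2) * (8 * (3 * Real.exp y) * τ) := by gcongr
      _ = 24 * (C₂ + 1) * y ^ 2 * (Real.exp y * τ) := by ring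
      _ ≤ _ := by gcongr
  have m2 := norm_integral_shift_le (f := f) (a := σ) (b := 1 + 1 / y) (x := -Real.exp L)
    (y := Real.exp L) (D := 24 * (C₂ + 1) * y ^ 2 * Ψ) (by linarith) (by linarith) (by linarith)
    (fun s h1 _ h2 h3 => hdiff s h1 (abs_le.2 ⟨h2, h3⟩))
    (hhor _ (by rw [abs_neg, abs_of_pos (Real.exp_pos L)]))
    (hhor _ (abs_of_pos (Real.exp_pos L)))
  have hcont : ContinuousOn (fun t : ℝ => f (σ + t * Complex.I)) (Icc (-Real.exp L) (Real.exp L)) := by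
    intro t h1
    have := (hdiff (σ + t * Complex.I) (by simp) (by simpa using abs_le.2 h1)).continuousAt
    exact (ContinuousAt.comp (f := fun t : ℝ => (σ : ℂ) + t * Complex.I) this
      (by fun_prop)).continuousWithinAt
  have hInt : ∀ a b : ℝ, -Real.exp L ≤ a → a ≤ b → b ≤ Real.exp L →
      IntervalIntegrable (fun t : ℝ => f (σ + t * Complex.I)) volume a b := by
    intro a b h1 h2 h3
    refine (hcont.mono ?_).intervalIntegrable
    rw [uIcc_of_le h2]
    exact Icc_subset_Icc h1 h3
  have m3 : ∫ t in -Real.exp L..Real.exp L, f (σ + t * Complex.I)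
      = (∫ t in -Real.exp L..(-2), f (σ + t * Complex.I)) + (∫ t in (-2 : ℝ)..2, f (σ + t * Complex.I))
        + ∫ t in (2 : ℝ)..Real.exp L, f (σ + t * Complex.I) := by
    rw [intervalIntegral.integral_add_adjacent_intervals, intervalIntegral.integral_add_adjacent_intervals]
    all_goals apply hInt <;> linarith
  have m4 := hb₁ L y T (-Real.exp L) (-2) hL hw₀ hw₁ hw₂ hLy hT hLT hLθ (by linarith)
    (fun t h1 => by
      rw [abs_of_neg (by linarith [h1.2])]
      exact ⟨by linarith [h1.2], by linarith [h1.1]⟩)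
    (Or.inr (by rw [abs_neg, abs_of_pos (Real.exp_pos L)])) (Or.inl (by norm_num))
  have m5 := hb₁ L y T 2 (Real.exp L) hL hw₀ hw₁ hw₂ hLy hT hLT hLθ (by linarith)
    (fun t h1 => by
      rw [abs_of_pos (by linarith [h1.1])]
      exact h1)
    (Or.inl (by norm_num)) (Or.inr (abs_of_pos (Real.exp_pos L)))
  rw [hfin] at m4 m5 ⊢
  have m6 : ‖∫ t in (-2 : ℝ)..2, f (σ + t * Complex.I)‖ ≤ 32 * C₄ * Φ := by
    refine (intervalIntegral.norm_integral_le_of_norm_le_const (C := 8 * C₄ * Φ) fun t h1 => ?_).trans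
      (le_of_eq ?_)
    · rw [uIoc_of_le (by norm_num)] at h1
      have n1 := hb₄ (σ + t * Complex.I) (by simp; linarith) (by simp; linarith)
        (by simpa using abs_le.2 ⟨h1.1.le, h1.2⟩)
      have n2 := norm_gker_le (y := y) hT (by linarith : 0 ≤ σ) (by linarith) t
      have n3 : Real.exp (σ * y) ≤ Φ := by
        rw [hΦ, Real.exp_le_exp, hσ]
        have : 0 ≤ 4 * (8 / 9 * width d L) * (L / (1 - θ)) := by positivity
        linarith
      rw [hf]; simp only [norm_mul]
      calc _ ≤ C₄ * (8 * Real.exp (σ * y)) := mul_le_mul n1 n2 (norm_nonneg _) hC₄.le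
        _ ≤ C₄ * (8 * Φ) := by gcongr
        _ = _ := by ring
    · norm_num; ring
  have m7 : C₃ * y * Real.exp y * T * τ ≤ C₃ * y * Ψ := by
    have e1 : T ≤ Real.exp L ^ 3 := hTL.trans (le_self_pow₀ (by linarith) (by norm_num))
    calc C₃ * y * Real.exp y * T * τ ≤ C₃ * y * Real.exp y * Real.exp L ^ 3 * τ := by gcongr
      _ = _ := by rw [hΨ]; ring
  have hy7 : y ≤ y ^ 7 := le_self_pow₀ hy1 (by norm_num)
  have hy27 : y ^ 2 ≤ y ^ 7 := pow_le_pow_right₀ hy1 (by norm_num)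
  have h1y7 : 1 ≤ y ^ 7 := one_le_pow₀ hy1
  set Q := Φ + Ψ + Ω with hQ
  have m8 : C₃ * y * Ψ ≤ C₃ * y ^ 7 * Q := by gcongr; linarith
  have m9 : 24 * (C₂ + 1) * y ^ 2 * Ψ ≤ 24 * (C₂ + 1) * y ^ 7 * Q := by gcongr; linarith
  have m10 : 32 * C₄ * Φ ≤ 32 * C₄ * y ^ 7 * Q := by
    calc 32 * C₄ * Φ = 32 * C₄ * 1 * Φ := by ring
      _ ≤ _ := by gcongr; linarith
  have m11 := norm_add₃_le (a := ∫ t in -Real.exp L..(-2), f (σ + t * Complex.I))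
    (b := ∫ t in (-2 : ℝ)..2, f (σ + t * Complex.I)) (c := ∫ t in (2 : ℝ)..Real.exp L, f (σ + t * Complex.I))
  rw [← m3] at m11
  refine m1.trans ?_
  have e : (C₃ + 2 * (24 * (C₂ + 1)) + 2 * C₁ + 32 * C₄) * y ^ 7 * Q
      = C₃ * y ^ 7 * Q + 2 * (24 * (C₂ + 1) * y ^ 7 * Q) + 2 * (C₁ * y ^ 7 * Q)
        + 32 * C₄ * y ^ 7 * Q := by ring
  rw [e]
  linarith only [m2, m11, m4, m5, m6, m7, m8, m9, m10]

lemma eventually_mul_pow_mul_exp_neg_le {C b ε : ℝ} (hC : 0 < C) (hb : 0 < b) (hε : 0 < ε) :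
    ∀ᶠ y : ℝ in atTop, C * y ^ 7 * Real.exp (-(b * y)) ≤ ε := by
  have h := (isLittleO_pow_exp_pos_mul_atTop 7 hb).bound (show 0 < ε / C by positivity)
  filter_upwards [h, eventually_ge_atTop 0] with y hy h0
  rw [Real.norm_of_nonneg (by positivity), Real.norm_of_nonneg (Real.exp_pos _).le] at hy
  rw [Real.exp_neg, ← div_eq_mul_inv, div_le_iff₀ (Real.exp_pos _)]
  calc C * y ^ 7 ≤ C * (ε / C * Real.exp (b * y)) := by gcongr
    _ = _ := by field_simp

/-- With `L` and `log T` proportional to `y`, the error term is negligible against `exp y`. -/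
lemma eventually_errTerm_le {d u u' C ε : ℝ} (hθ : θ < 1) (hd : 0 < d) (hu' : 0 < u')
    (huu : u < u') (hsm : u' * (4 * d + 9 * (1 - θ)) < (1 - θ) * d) (hC : 0 < C) (hε : 0 < ε) :
    ∀ᶠ y : ℝ in atTop, ∀ T : ℝ, 0 < T → T ≤ Real.exp (u * y) →
      C * y ^ 7 * errTerm θ d (u' * y) y T ≤ ε * Real.exp y := by
  have hκ : 0 < 1 - θ := by linarith
  have hdu : 0 < u' - u := by linarith
  have hb : 9 < d * (1 / u' - 4 / (1 - θ)) := by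
    have : d * (1 / u' - 4 / (1 - θ)) - 9
        = ((1 - θ) * d - u' * (4 * d + 9 * (1 - θ))) / (u' * (1 - θ)) := by
      field_simp; ring
    have h2 : 0 < ((1 - θ) * d - u' * (4 * d + 9 * (1 - θ))) / (u' * (1 - θ)) :=
      div_pos (by linarith) (by positivity)
    linarith
  have hq : 0 < (1 - θ) / 4 - u' := by nlinarith
  have hε3 : 0 < ε / 3 := by positivity
  filter_upwards [eventually_mul_pow_mul_exp_neg_le hC hq hε3,
    eventually_mul_pow_mul_exp_neg_le hC one_pos hε3,
    eventually_ge_atTop 1, eventually_ge_atTop (1 / u'),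
    eventually_ge_atTop (9 / (d * (1 / u' - 4 / (1 - θ)) - 9) / u'),
    eventually_ge_atTop (2 * (3 * u' + 1) / (u' - u) ^ 2),
    eventually_ge_atTop (C / u' ^ 8 / (ε / 3))] with y h1 h2 h3 h4 h5 h6 h7 T hT hTy
  have hy : 0 < y := by linarith
  set b := d * (1 / u' - 4 / (1 - θ)) with hbdef
  set L := u' * y with hL
  have hL1 : 1 ≤ L := by
    rw [div_le_iff₀ hu'] at h4; linarith
  have hL0 : 0 < L := by linarith
  have hbL : 8 ≤ 8 / 9 * b * (L / (L + 1)) := by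
    rw [div_le_iff₀ hu', div_le_iff₀ (by linarith)] at h5
    have : 9 * (L + 1) ≤ b * L := by rw [hL]; linarith
    rw [← mul_div_assoc, le_div_iff₀ (by linarith)]
    linarith
  have hlog : 0 ≤ Real.log L := Real.log_nonneg hL1
  have t1 : C * y ^ 7 * Real.exp (y - 8 / 9 * width d L * y
      + 4 * (8 / 9 * width d L) * (L / (1 - θ))) ≤ ε / 3 * Real.exp y := by
    have e1 : y - 8 / 9 * width d L * y + 4 * (8 / 9 * width d L) * (L / (1 - θ))
        = y - 8 / 9 * b * (L / (L + 1)) * Real.log L := by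
      have : y = L / u' := by rw [hL]; field_simp
      rw [hbdef, width]
      nth_rewrite 2 [this]
      field_simp
      ring
    have e2 : y - 8 / 9 * b * (L / (L + 1)) * Real.log L ≤ y - 8 * Real.log L := by
      have := mul_le_mul_of_nonneg_right hbL hlog
      linarith
    have e3 : Real.exp (y - 8 * Real.log L) = Real.exp y / L ^ 8 := by
      rw [Real.exp_sub, show 8 * Real.log L = ((8 : ℕ) : ℝ) * Real.log L by norm_num,
        Real.exp_nat_mul, Real.exp_log hL0]
    rw [e1]
    calc _ ≤ C * y ^ 7 * (Real.exp y / L ^ 8) := by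
          rw [← e3]; gcongr
      _ = C / u' ^ 8 / y * Real.exp y := by rw [hL]; field_simp
      _ ≤ ε / 3 * Real.exp y := by
          refine mul_le_mul_of_nonneg_right ?_ (Real.exp_pos y).le
          rw [div_le_iff₀ hε3] at h7
          rw [div_le_iff₀ hy]; linarith
  have t2 : C * y ^ 7 * (Real.exp y * (Real.exp L ^ 3 * Real.exp (-(Real.exp L ^ 2 / (4 * T ^ 2)))))
      ≤ ε / 3 * Real.exp y := by
    have e1 : (u' - u) ^ 2 * y ^ 2 / 2 ≤ Real.exp L ^ 2 / (4 * T ^ 2) := by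
      have f1 : Real.exp (2 * ((u' - u) * y)) ≤ Real.exp L ^ 2 / T ^ 2 := by
        rw [le_div_iff₀ (by positivity)]
        calc _ ≤ Real.exp (2 * ((u' - u) * y)) * Real.exp (u * y) ^ 2 := by gcongr
          _ = Real.exp L ^ 2 := by
            rw [← Real.exp_nat_mul, ← Real.exp_nat_mul, ← Real.exp_add, hL]; push_cast; ring_nf
      have f2 := Real.quadratic_le_exp_of_nonneg (x := 2 * ((u' - u) * y)) (by positivity)
      have f3 : Real.exp L ^ 2 / (4 * T ^ 2) = Real.exp L ^ 2 / T ^ 2 / 4 := by field_simp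
      have f4 : 0 < (u' - u) * y := by positivity
      rw [f3]
      nlinarith
    have e2 : (3 * u' + 1) * y ≤ (u' - u) ^ 2 * y ^ 2 / 2 := by
      rw [div_le_iff₀ (by positivity)] at h6
      nlinarith
    have e3 : Real.exp L ^ 3 * Real.exp (-(Real.exp L ^ 2 / (4 * T ^ 2))) ≤ Real.exp (-(1 * y)) := by
      rw [← Real.exp_nat_mul, ← Real.exp_add, Real.exp_le_exp]
      push_cast
      rw [hL]; rw [hL] at e1; linarith
    calc _ ≤ C * y ^ 7 * (Real.exp y * Real.exp (-(1 * y))) := by gcongr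
      _ = C * y ^ 7 * Real.exp (-(1 * y)) * Real.exp y := by ring
      _ ≤ _ := by gcongr
  have t3 : C * y ^ 7 * (Real.exp ((1 - (1 - θ) / 4) * y) * Real.exp L) ≤ ε / 3 * Real.exp y := by
    have e1 : Real.exp ((1 - (1 - θ) / 4) * y) * Real.exp L
        = Real.exp (-(((1 - θ) / 4 - u') * y)) * Real.exp y := by
      rw [← Real.exp_add, ← Real.exp_add, hL]; ring_nf
    rw [e1, ← mul_assoc]
    gcongr
  rw [errTerm]
  linarith

/-- The prime number theorem smoothed at the scale `exp (-u y)`. -/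
lemma IsZeta.eventually_abs_smooth_sub_le {ζ : ℂ → ℂ} (hζ : S.IsZeta θ ζ)
    (h : S.WellBehaved A θ K₀) {d t₀ : ℝ} (hd : 0 < d)
    (hZ : ∀ ρ : ℂ, θ < ρ.re → ρ ≠ 1 → t₀ < ρ.im →
      1 - d * Real.log (Real.log ρ.im) / Real.log ρ.im < ρ.re → ζ ρ ≠ 0)
    {u ε : ℝ} (hu : 0 < u) (hsm : u * (4 * d + 9 * (1 - θ)) < (1 - θ) * d) (hε : 0 < ε) :
    ∀ᶠ y : ℝ in atTop, ∀ T : ℝ, Real.exp (u * y) / 8 ≤ T → T ≤ Real.exp (u * y) →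
      |S.smooth T y - Real.exp y| ≤ ε * Real.exp y := by
  obtain ⟨C, m, hC, hm, hb⟩ := hζ.exists_abs_smooth_sub_le h hd hZ
  have hθ0 := h.2.1
  have hθ := h.2.2.1
  have hκ : 0 < 1 - θ := by linarith
  have hs0 : 0 < 4 * d + 9 * (1 - θ) := by positivity
  obtain ⟨u', hu1, hu2⟩ : ∃ u', u < u' ∧ u' < min (2 * u) ((1 - θ) * d / (4 * d + 9 * (1 - θ))) :=
    exists_between (lt_min (by linarith) (by rwa [lt_div_iff₀ hs0]))
  rw [lt_min_iff, lt_div_iff₀ hs0] at hu2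
  obtain ⟨hu2, hu3⟩ := hu2
  have hu0 : 0 < u' := by linarith
  have hq : 4 * u' < 1 - θ := by nlinarith
  have hlin : Tendsto (fun y : ℝ => u' * y) atTop atTop := tendsto_id.const_mul_atTop hu0
  have hw : Tendsto (width d) atTop (𝓝 0) := by
    have h1 : Tendsto (fun L : ℝ => d * (Real.log L / L)) atTop (𝓝 0) := by
      have := (Real.isLittleO_log_id_atTop.tendsto_div_nhds_zero).const_mul d
      simpa using this
    refine squeeze_zero' ?_ ?_ h1
    · filter_upwards [eventually_ge_atTop 3] with L hL
      exact (width_pos hd hL).le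
    · filter_upwards [eventually_ge_atTop 1] with L hL
      have := Real.log_nonneg hL
      rw [width, mul_div_assoc]
      gcongr
      linarith
  have hT8 : Tendsto (fun y : ℝ => Real.exp (u * y)) atTop atTop :=
    Real.tendsto_exp_atTop.comp (tendsto_id.const_mul_atTop hu)
  have hε3 : 0 < ε / 3 := by positivity
  filter_upwards [eventually_errTerm_le (θ := θ) hθ hd hu0 hu1 hu3 hC hε3,
    hlin.eventually (eventually_ge_atTop 3), (hw.comp hlin).eventually (eventually_le_nhds hm),
    (Real.tendsto_log_atTop.comp hlin).eventually (eventually_ge_atTop (2 / d * u')),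
    hT8.eventually (eventually_ge_atTop (8 + 8 * (3 / ε))), eventually_gt_atTop 0,
    Real.tendsto_exp_atTop.eventually (eventually_ge_atTop (3 / ε)),
    (hlin.eventually (eventually_ge_atTop 3))] with y h1 h3 h4 h5 h6 h7 h8 _ T hT1 hT2
  simp only [Function.comp_apply] at h4 h5
  have hT0 : 1 ≤ T := by
    have : 0 < 3 / ε := by positivity
    linarith
  have hTε : 3 / ε ≤ T := by linarith
  have hfin := hb (u' * y) y T h3 h4 (by nlinarith) ?_ hT0 (hT2.trans ?_) ?_ ?_
  · have e1 : Real.exp (1 / (2 * T ^ 2)) - 1 ≤ ε / 3 := by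
      have f0 : 1 / (2 * T ^ 2) ≤ 1 / 2 := by
        apply one_div_le_one_div_of_le (by norm_num); nlinarith
      have f1 := Real.abs_exp_sub_one_le (x := 1 / (2 * T ^ 2)) (by
        rw [abs_of_nonneg (by positivity)]; linarith)
      rw [abs_of_nonneg (by positivity : 0 ≤ 1 / (2 * T ^ 2))] at f1
      have f2 : 2 * (1 / (2 * T ^ 2)) ≤ ε / 3 := by
        rw [div_le_iff₀ hε] at hTε
        have : 2 * (1 / (2 * T ^ 2)) = 1 / T ^ 2 := by field_simp
        rw [this, div_le_iff₀ (by positivity)]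
        nlinarith
      linarith [le_abs_self (Real.exp (1 / (2 * T ^ 2)) - 1)]
    have e2 : 1 ≤ ε / 3 * Real.exp y := by
      rw [div_le_iff₀ hε] at h8; linarith
    have e3 := h1 T (by linarith) hT2
    have e4 := mul_le_mul_of_nonneg_left e1 (Real.exp_pos y).le
    linarith
  · rw [width, div_le_div_iff₀ h7 (by linarith)]
    have : 2 * u' ≤ d * Real.log (u' * y) := by
      have := mul_le_mul_of_nonneg_left h5 hd.le
      rw [← mul_assoc, mul_div_cancel₀ _ hd.ne'] at this
      exact this
    nlinarith
  · exact Real.exp_le_exp.2 (by nlinarith)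
  · calc Real.exp (u' * y) ≤ Real.exp (2 * (u * y)) := Real.exp_le_exp.2 (by nlinarith)
      _ = 64 * (Real.exp (u * y) / 8) ^ 2 := by
        rw [show 2 * (u * y) = ((2 : ℕ) : ℝ) * (u * y) by norm_num, Real.exp_nat_mul]; ring
      _ ≤ _ := by gcongr
  · rw [← mul_div_assoc, div_le_iff₀ hκ]
    nlinarith

lemma continuous_gauss_sub (T c : ℝ) : Continuous fun y => gauss T (y - c) := by
  unfold gauss
  fun_prop

lemma gauss_sqrt_two_mul_le {T δ v : ℝ} (hT : 0 < T) (hδ : 0 ≤ δ) (hv : δ ≤ |v|) :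
    gauss (√2 * T) v ≤ √2 * Real.exp (-(T ^ 2 * δ ^ 2 / 2)) * gauss T v := by
  have h2 : √2 ^ 2 = (2 : ℝ) := Real.sq_sqrt (by norm_num)
  have hsq : δ ^ 2 ≤ v ^ 2 := by
    rw [← sq_abs v]
    gcongr
  have h3 : Real.exp (-((√2 * T) ^ 2 * v ^ 2 / 2))
      ≤ Real.exp (-(T ^ 2 * δ ^ 2 / 2)) * Real.exp (-(T ^ 2 * v ^ 2 / 2)) := by
    rw [← Real.exp_add, Real.exp_le_exp, mul_pow, h2]
    nlinarith [mul_le_mul_of_nonneg_left hsq (sq_nonneg T)]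
  unfold gauss
  calc √2 * T / √(2 * Real.pi) * Real.exp (-((√2 * T) ^ 2 * v ^ 2 / 2))
      ≤ √2 * T / √(2 * Real.pi)
        * (Real.exp (-(T ^ 2 * δ ^ 2 / 2)) * Real.exp (-(T ^ 2 * v ^ 2 / 2))) := by gcongr
    _ = _ := by ring

lemma sqrt_two_mul_exp_le {T δ ε : ℝ} (hT : 0 < T) (hδ : 0 < δ) (h : 4 ≤ T ^ 2 * δ ^ 2 * ε) :
    √2 * Real.exp (-(T ^ 2 * δ ^ 2 / 2)) ≤ ε := by
  have h1 := Real.add_one_le_exp (T ^ 2 * δ ^ 2 / 2)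
  have h2 : √2 ≤ 2 := by
    rw [Real.sqrt_le_left (by norm_num)]; norm_num
  have h3 : 0 < T ^ 2 * δ ^ 2 := by positivity
  have hε : 0 < ε := by
    by_contra! h0
    nlinarith
  rw [Real.exp_neg, ← div_eq_mul_inv, div_le_iff₀ (Real.exp_pos _)]
  nlinarith

lemma integral_gauss_sub_le_one {T : ℝ} (hT : 0 < T) (c a b : ℝ) (hab : a ≤ b) :
    ∫ y in a..b, gauss T (y - c) ≤ 1 := by
  rw [intervalIntegral.integral_of_le hab, ← integral_gauss hT,
    ← integral_sub_right_eq_self (gauss T) c]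
  exact setIntegral_le_integral ((integrable_gauss hT).comp_sub_right c)
    (ae_of_all _ fun y => gauss_nonneg hT.le _)

lemma one_sub_le_integral_gauss_sub {T δ c a b : ℝ} (hT : 0 < T) (hδ : 0 ≤ δ)
    (ha : a + δ ≤ c) (hb : c ≤ b - δ) :
    1 - √2 * Real.exp (-(T ^ 2 * δ ^ 2 / 2)) ≤ ∫ y in a..b, gauss (√2 * T) (y - c) := by
  have hT2 : 0 < √2 * T := by positivity
  have i1 := (integrable_gauss hT2).comp_sub_right c
  have i2 := (integrable_gauss hT).comp_sub_right c
  have e0 : ∫ y, gauss (√2 * T) (y - c) = 1 := by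
    rw [integral_sub_right_eq_self (gauss (√2 * T)) c, integral_gauss hT2]
  have e1 := integral_add_compl (measurableSet_Ioc (a := a) (b := b)) i1
  rw [e0] at e1
  rw [intervalIntegral.integral_of_le (by linarith)]
  have e2 : ∫ y in (Ioc a b)ᶜ, gauss (√2 * T) (y - c)
      ≤ ∫ y in (Ioc a b)ᶜ, √2 * Real.exp (-(T ^ 2 * δ ^ 2 / 2)) * gauss T (y - c) := by
    refine setIntegral_mono_on i1.integrableOn (i2.const_mul _).integrableOn
      measurableSet_Ioc.compl fun y hy => gauss_sqrt_two_mul_le hT hδ ?_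
    rw [mem_compl_iff, mem_Ioc, not_and_or, not_lt, not_le] at hy
    rcases hy with hy | hy
    · rw [abs_sub_comm]
      exact le_trans (by linarith) (le_abs_self _)
    · exact le_trans (by linarith) (le_abs_self _)
  have e3 : ∫ y in (Ioc a b)ᶜ, √2 * Real.exp (-(T ^ 2 * δ ^ 2 / 2)) * gauss T (y - c)
      ≤ √2 * Real.exp (-(T ^ 2 * δ ^ 2 / 2)) := by
    refine (setIntegral_le_integral (i2.const_mul _) (ae_of_all _ fun y =>
      mul_nonneg (by positivity) (gauss_nonneg hT.le _))).trans (le_of_eq ?_)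
    rw [integral_const_mul, integral_sub_right_eq_self (gauss T) c, integral_gauss hT, mul_one]
  linarith

lemma tsum_le_sum_add_mul_tsum {ι : Type*} {f g : ι → ℝ} (hf : Summable f) (hg : Summable g)
    (hg0 : ∀ n, 0 ≤ g n) {c : ℝ} (hc : 0 ≤ c) {B : Finset ι} (hB : ∀ n ∉ B, f n ≤ c * g n) :
    ∑' n, f n ≤ ∑ n ∈ B, f n + c * ∑' n, g n := by
  classical
  have h1 := hf.sum_add_tsum_subtype_compl B
  have h2 := (hg.mul_left c).sum_add_tsum_subtype_compl B
  have h3 : 0 ≤ ∑ n ∈ B, c * g n := Finset.sum_nonneg fun n _ => mul_nonneg hc (hg0 n)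
  have h4 := Summable.tsum_le_tsum (fun n : {n // n ∉ B} => hB n n.2) (hf.subtype _)
    ((hg.mul_left c).subtype _)
  rw [← tsum_mul_left]
  linarith

lemma WellBehaved.smooth_sqrt_two_mul_le (hW : S.WellBehaved A θ K₀) {T δ y : ℝ} (hT : 0 < T)
    (hδ : 0 ≤ δ) {B : Finset (ℕ →₀ ℕ)} (hB : ∀ n ∉ B, δ ≤ |y - Real.log (S.val n)|) :
    S.smooth (√2 * T) y ≤ (∑ n ∈ B, S.vonMangoldt n * gauss (√2 * T) (y - Real.log (S.val n)))
      + √2 * Real.exp (-(T ^ 2 * δ ^ 2 / 2)) * S.smooth T y := by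
  have hT2 : 0 < √2 * T := by positivity
  refine tsum_le_sum_add_mul_tsum (hW.summable_smooth hT2 y) (hW.summable_smooth hT y)
    (fun n => mul_nonneg (vonMangoldt_nonneg n) (gauss_nonneg hT.le _)) (by positivity) fun n hn => ?_
  have := mul_le_mul_of_nonneg_left (gauss_sqrt_two_mul_le hT hδ (hB n hn))
    (vonMangoldt_nonneg (S := S) n)
  linarith

lemma psi_eq_sum (x : ℝ) : S.psi x = ∑ n ∈ S.below x, S.vonMangoldt n := by
  rw [psi]
  exact finsum_mem_eq_finite_toFinset_sum _ (S.finite_val_le x)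

lemma psi_sub_eq_sum {x y : ℝ} (h : x ≤ y) :
    S.psi y - S.psi x = ∑ n ∈ S.below y \ S.below x, S.vonMangoldt n := by
  rw [psi_eq_sum, psi_eq_sum, ← Finset.sum_sdiff (S.below_mono h)]
  ring

/-- The number of prime powers in a short interval is controlled by the smoothed sum. -/
lemma WellBehaved.psi_sub_le (hW : S.WellBehaved A θ K₀) {x h δ ε T : ℝ} (hx : 0 < x) (hh : 0 < h)
    (hT : 0 < T) (hδ : 0 < δ) (hε : 4 ≤ T ^ 2 * δ ^ 2 * ε)
    (hs : ∀ y, Real.log x - δ ≤ y → y ≤ Real.log (x + h) + δ →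
      |S.smooth (√2 * T) y - Real.exp y| ≤ ε * Real.exp y) :
    (S.psi (x + h) - S.psi x) * (1 - ε)
      ≤ (1 + ε) * ((x + h) * Real.exp δ - x * Real.exp (-δ)) := by
  have hT2 : 0 < √2 * T := by positivity
  have hlog : Real.log x ≤ Real.log (x + h) := Real.log_le_log hx (by linarith)
  rw [psi_sub_eq_sum (by linarith)]
  set B := S.below (x + h) \ S.below x with hB
  set a := Real.log x - δ with ha
  set b := Real.log (x + h) + δ with hb
  have hab : a ≤ b := by linarith
  have hci : ∀ n, IntervalIntegrable
      (fun y => S.vonMangoldt n * gauss (√2 * T) (y - Real.log (S.val n))) volume a b := fun n =>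
    ((continuous_gauss_sub _ _).const_mul _).intervalIntegrable _ _
  calc (∑ n ∈ B, S.vonMangoldt n) * (1 - ε) = ∑ n ∈ B, S.vonMangoldt n * (1 - ε) :=
        Finset.sum_mul _ _ _
    _ ≤ ∑ n ∈ B, S.vonMangoldt n * ∫ y in a..b, gauss (√2 * T) (y - Real.log (S.val n)) := by
        refine Finset.sum_le_sum fun n hn => mul_le_mul_of_nonneg_left ?_ (vonMangoldt_nonneg n)
        rw [hB, Finset.mem_sdiff, mem_below, mem_below, not_le] at hn
        have h1 := Real.log_le_log hx hn.2.le
        have h2 := Real.log_le_log (S.val_pos n) hn.1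
        have := one_sub_le_integral_gauss_sub (T := T) (δ := δ) (c := Real.log (S.val n))
          (a := a) (b := b) hT hδ.le (by linarith) (by linarith)
        linarith [sqrt_two_mul_exp_le hT hδ hε]
    _ = ∫ y in a..b, ∑ n ∈ B, S.vonMangoldt n * gauss (√2 * T) (y - Real.log (S.val n)) := by
        rw [intervalIntegral.integral_finsetSum fun n _ => hci n]
        simp_rw [intervalIntegral.integral_const_mul]
    _ ≤ ∫ y in a..b, (1 + ε) * Real.exp y := by
        refine intervalIntegral.integral_mono_on hab ?_
          (by apply Continuous.intervalIntegrable; fun_prop) fun y hy => ?_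
        · exact (continuous_finsetSum B fun n _ => (continuous_gauss_sub _ _).const_mul _).intervalIntegrable _ _
        · have h1 := (hW.summable_smooth hT2 y).sum_le_tsum B fun n _ =>
            mul_nonneg (vonMangoldt_nonneg n) (gauss_nonneg hT2.le _)
          have h2 := (abs_le.1 (hs y hy.1 hy.2)).2
          rw [smooth] at h2
          linarith
    _ = _ := by
        rw [intervalIntegral.integral_const_mul, integral_exp, hb, ha, Real.exp_add,
          sub_eq_add_neg (Real.log x), Real.exp_add, Real.exp_log hx, Real.exp_log (by linarith)]

lemma WellBehaved.le_psi_sub (hW : S.WellBehaved A θ K₀) {x h δ ε T : ℝ} (hx : 0 < x) (hh : 0 < h)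
    (hT : 0 < T) (hδ : 0 < δ) (hε : 4 ≤ T ^ 2 * δ ^ 2 * ε) (hε1 : ε ≤ 1)
    (hδx : x * Real.exp δ ≤ (x + h) * Real.exp (-δ))
    (hs : ∀ y, Real.log x ≤ y → y ≤ Real.log (x + h) →
      |S.smooth (√2 * T) y - Real.exp y| ≤ ε * Real.exp y)
    (hs' : ∀ y, Real.log x ≤ y → y ≤ Real.log (x + h) →
      |S.smooth T y - Real.exp y| ≤ ε * Real.exp y) :
    (1 - 3 * ε) * ((x + h) * Real.exp (-δ) - x * Real.exp δ) ≤ S.psi (x + h) - S.psi x := by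
  have hT2 : 0 < √2 * T := by positivity
  rw [psi_sub_eq_sum (by linarith)]
  set B := S.below (x + h) \ S.below x with hB
  set a := Real.log x + δ with ha
  set b := Real.log (x + h) + -δ with hb
  have hea : Real.exp a = x * Real.exp δ := by rw [ha, Real.exp_add, Real.exp_log hx]
  have heb : Real.exp b = (x + h) * Real.exp (-δ) := by
    rw [hb, Real.exp_add, Real.exp_log (by linarith)]
  have hab : a ≤ b := by rw [← Real.exp_le_exp, hea, heb]; exact hδx
  have hτ := sqrt_two_mul_exp_le hT hδ hε
  have hci : ∀ n, IntervalIntegrable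
      (fun y => S.vonMangoldt n * gauss (√2 * T) (y - Real.log (S.val n))) volume a b := fun n =>
    ((continuous_gauss_sub _ _).const_mul _).intervalIntegrable _ _
  calc _ = ∫ y in a..b, (1 - 3 * ε) * Real.exp y := by
        rw [intervalIntegral.integral_const_mul, integral_exp, hea, heb]
    _ ≤ ∫ y in a..b, ∑ n ∈ B, S.vonMangoldt n * gauss (√2 * T) (y - Real.log (S.val n)) := by
        refine intervalIntegral.integral_mono_on hab
          (by apply Continuous.intervalIntegrable; fun_prop) ?_ fun y hy => ?_
        · exact (continuous_finsetSum B fun n _ => (continuous_gauss_sub _ _).const_mul _).intervalIntegrable _ _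
        · have h1 := (abs_le.1 (hs y (by linarith [hy.1]) (by linarith [hy.2]))).1
          have h2 := (abs_le.1 (hs' y (by linarith [hy.1]) (by linarith [hy.2]))).2
          have h3 := hW.smooth_sqrt_two_mul_le hT hδ.le (y := y) (B := B) fun n hn => by
            simp only [hB, Finset.mem_sdiff, mem_below, not_and_or, not_le] at hn
            rcases hn with hn | hn
            · have := Real.log_le_log (by linarith) hn.le
              rw [abs_sub_comm]
              exact le_trans (by linarith [hy.2]) (le_abs_self _)
            · have := Real.log_le_log (S.val_pos n) (not_lt.1 hn)
              exact le_trans (by linarith [hy.1]) (le_abs_self _)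
          have hε0 : 0 ≤ ε := le_trans (by positivity) hτ
          have h5 : ε * Real.exp y ≤ Real.exp y := mul_le_of_le_one_left (Real.exp_pos y).le hε1
          have h4 := mul_le_mul hτ (show S.smooth T y ≤ 2 * Real.exp y by linarith)
            (tsum_nonneg fun n => mul_nonneg (vonMangoldt_nonneg n) (gauss_nonneg hT.le _)) hε0
          linarith
    _ = ∑ n ∈ B, S.vonMangoldt n * ∫ y in a..b, gauss (√2 * T) (y - Real.log (S.val n)) := by
        rw [intervalIntegral.integral_finsetSum fun n _ => hci n]
        simp_rw [intervalIntegral.integral_const_mul]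
    _ ≤ ∑ n ∈ B, S.vonMangoldt n * 1 :=
        Finset.sum_le_sum fun n _ => mul_le_mul_of_nonneg_left
          (integral_gauss_sub_le_one hT2 _ _ _ hab) (vonMangoldt_nonneg n)
    _ = _ := by simp

/-- Short intervals of length at most `x`, given the smoothed estimate at scale `T`. -/
lemma WellBehaved.abs_psi_sub_sub_le (hW : S.WellBehaved A θ K₀) {x h ε T : ℝ} (hx : 0 < x)
    (hh : 0 < h) (hhx : h ≤ x) (hT : 0 < T) (hε0 : 0 < ε) (hε8 : ε ≤ 1 / 8)
    (hε : 4 ≤ T ^ 2 * (ε * h / x) ^ 2 * ε)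
    (hs : ∀ y, Real.log x - ε * h / x ≤ y → y ≤ Real.log (x + h) + ε * h / x →
      |S.smooth (√2 * T) y - Real.exp y| ≤ ε * Real.exp y)
    (hs' : ∀ y, Real.log x ≤ y → y ≤ Real.log (x + h) →
      |S.smooth T y - Real.exp y| ≤ ε * Real.exp y) :
    |S.psi (x + h) - S.psi x - h| ≤ 40 * ε * h := by
  set δ := ε * h / x with hδ
  have hδ0 : 0 < δ := by positivity
  have hδx : δ * x = ε * h := by rw [hδ]; field_simp
  have hδ1 : δ ≤ ε := by
    rw [hδ, div_le_iff₀ hx]; gcongr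
  have e1 : Real.exp δ ≤ 1 + 2 * δ := by
    have := Real.abs_exp_sub_one_le (x := δ) (by rw [abs_of_pos hδ0]; linarith)
    rw [abs_of_pos hδ0] at this
    linarith [le_abs_self (Real.exp δ - 1)]
  have e2 : 1 - δ ≤ Real.exp (-δ) := by linarith [Real.add_one_le_exp (-δ)]
  have g1 : (x + h) * Real.exp δ ≤ (x + h) * (1 + 2 * δ) := by gcongr
  have g2 : x * (1 - δ) ≤ x * Real.exp (-δ) := by gcongr
  have g3 : (x + h) * (1 - δ) ≤ (x + h) * Real.exp (-δ) := by gcongr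
  have g4 : x * Real.exp δ ≤ x * (1 + 2 * δ) := by gcongr
  have g5 : h * δ ≤ ε * h := by rw [mul_comm]; gcongr
  have hεh : 0 < ε * h := by positivity
  have hε2 : ε * h ≤ 1 / 8 * h := by gcongr
  have up := hW.psi_sub_le hx hh hT hδ0 hε hs
  have lo := hW.le_psi_sub hx hh hT hδ0 hε (by linarith) (by linarith)
    (fun y h1 h2 => hs y (by linarith) (by linarith)) hs'
  set D := S.psi (x + h) - S.psi x
  have up2 : (x + h) * Real.exp δ - x * Real.exp (-δ) ≤ h + 5 * (ε * h) := by linarith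
  have lo2 : h - 5 * (ε * h) ≤ (x + h) * Real.exp (-δ) - x * Real.exp δ := by linarith
  have up3 : (1 + ε) * ((x + h) * Real.exp δ - x * Real.exp (-δ))
      ≤ (1 + ε) * (h + 5 * (ε * h)) := by gcongr
  have lo3 : (1 - 3 * ε) * (h - 5 * (ε * h))
      ≤ (1 - 3 * ε) * ((x + h) * Real.exp (-δ) - x * Real.exp δ) :=
    mul_le_mul_of_nonneg_left lo2 (by linarith)
  have hεε : ε * (ε * h) ≤ 1 / 8 * (ε * h) := by gcongr
  rw [abs_le]
  constructor
  · have : 0 ≤ ε * (ε * h) := by positivity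
    linarith
  · by_contra! hc
    have h3 : (h + 40 * ε * h) * (1 - ε) < D * (1 - ε) :=
      mul_lt_mul_of_pos_right (by linarith) (by linarith)
    linarith

set_option maxHeartbeats 1000000 in
/-- The prime number theorem in intervals of length at least `x ^ lam` and at most `x`. -/
lemma IsZeta.eventually_abs_psi_sub_sub_le {ζ : ℂ → ℂ} (hζ : S.IsZeta θ ζ)
    (hW : S.WellBehaved A θ K₀) {d t₀ : ℝ} (hd : 0 < d)
    (hZ : ∀ ρ : ℂ, θ < ρ.re → ρ ≠ 1 → t₀ < ρ.im →
      1 - d * Real.log (Real.log ρ.im) / Real.log ρ.im < ρ.re → ζ ρ ≠ 0)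
    {u lam ε : ℝ} (hu : 0 < u) (hsm : u * (4 * d + 9 * (1 - θ)) < (1 - θ) * d)
    (hlam : 1 - u < lam) (hε : 0 < ε) (hε8 : ε ≤ 1 / 8) :
    ∀ᶠ x : ℝ in atTop, ∀ h, x ^ lam ≤ h → h ≤ x →
      |S.psi (x + h) - S.psi x - h| ≤ 40 * ε * h := by
  have hu1 : u ≤ 1 := by
    have hθ0 := hW.2.1
    have hθ := hW.2.2.1
    by_contra! h1
    have : 0 < 4 * d + 9 * (1 - θ) := by nlinarith
    nlinarith
  obtain ⟨y₀, hy₀⟩ := eventually_atTop.1 (hζ.eventually_abs_smooth_sub_le hW hd hZ hu hsm hε)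
  filter_upwards [eventually_gt_atTop 0,
    Real.tendsto_log_atTop.eventually (eventually_ge_atTop (y₀ + 1 / 8)),
    (tendsto_rpow_atTop (show 0 < lam - (1 - u) by linarith)).eventually
      (eventually_ge_atTop (64 / ε ^ 3 + 1))] with x hx h1 h2 h hlo hhi
  have hh : 0 < h := lt_of_lt_of_le (by positivity) hlo
  have hexp : Real.exp (u * Real.log x) = x ^ u := by
    rw [Real.rpow_def_of_pos hx, mul_comm]
  have hxu : 0 < x ^ u := by positivity
  have s2 : √2 ^ 2 = (2 : ℝ) := Real.sq_sqrt (by norm_num)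
  have s3 : (7 : ℝ) / 5 ≤ √2 := Real.le_sqrt_of_sq_le (by norm_num)
  have s4 : √2 ≤ (3 : ℝ) / 2 := by
    rw [Real.sqrt_le_left (by norm_num)]; norm_num
  set δ := ε * h / x with hδ
  have hδ0 : 0 < δ := by positivity
  have hδ1 : δ ≤ 1 / 8 := by
    rw [hδ, div_le_iff₀ hx]
    exact mul_le_mul hε8 hhi hh.le (by norm_num)
  have hlog2 : Real.log (x + h) ≤ Real.log x + Real.log 2 := by
    rw [← Real.log_mul hx.ne' (by norm_num)]
    exact Real.log_le_log (by linarith) (by linarith)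
  have hl2 := Real.log_two_lt_d9
  have hl20 : 0 < Real.log 2 := Real.log_pos (by norm_num)
  have hTδ : 64 / ε ≤ (x ^ u * δ) ^ 2 := by
    have e1 : x ^ (lam - (1 - u)) * ε ≤ x ^ u * δ := by
      have : x ^ (lam - (1 - u)) = x ^ u * x ^ lam / x := by
        rw [← Real.rpow_add hx, ← Real.rpow_sub_one hx.ne']; ring_nf
      rw [this, hδ]
      calc _ = x ^ u * (ε * x ^ lam / x) := by ring
        _ ≤ _ := by gcongr
    have e2 : (64 / ε ^ 3 + 1) * ε ^ 2 ≤ (x ^ u * δ) ^ 2 := by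
      have hX : 1 ≤ x ^ (lam - (1 - u)) := by
        have : 0 < 64 / ε ^ 3 := by positivity
        linarith
      calc (64 / ε ^ 3 + 1) * ε ^ 2 ≤ (x ^ (lam - (1 - u))) ^ 2 * ε ^ 2 := by
            gcongr
            nlinarith
        _ = (x ^ (lam - (1 - u)) * ε) ^ 2 := by ring
        _ ≤ _ := by gcongr
    have e3 : (64 / ε ^ 3 + 1) * ε ^ 2 = 64 / ε + ε ^ 2 := by field_simp
    linarith [sq_nonneg ε]
  refine hW.abs_psi_sub_sub_le (T := x ^ u / 4) hx hh hhi (by positivity) hε hε8 ?_ ?_ ?_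
  · rw [div_le_iff₀ hε] at hTδ
    rw [← hδ]
    linarith [show (x ^ u / 4) ^ 2 * δ ^ 2 * ε = (x ^ u * δ) ^ 2 * ε / 16 by ring]
  · intro y hy1 hy2
    have e0 : Real.exp (u * y) = x ^ u * Real.exp (u * (y - Real.log x)) := by
      rw [← hexp, ← Real.exp_add]; ring_nf
    apply hy₀ y (by linarith)
    · have : Real.exp (u * (y - Real.log x)) ≤ 2 * √2 := by
        calc Real.exp (u * (y - Real.log x)) ≤ Real.exp (Real.log 2 + 1 / 8) := by
              rw [Real.exp_le_exp]; nlinarith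
          _ = 2 * Real.exp (1 / 8) := by rw [Real.exp_add, Real.exp_log (by norm_num)]
          _ ≤ 2 * √2 := by
              have := Real.abs_exp_sub_one_le (x := 1 / 8) (by norm_num [abs_le])
              rw [abs_of_pos (by norm_num : (0 : ℝ) < 1 / 8)] at this
              linarith [le_abs_self (Real.exp (1 / 8) - 1)]
      rw [e0]; nlinarith
    · have : 7 / 8 ≤ Real.exp (u * (y - Real.log x)) := by
        have := Real.add_one_le_exp (u * (y - Real.log x))
        nlinarith
      rw [e0]; nlinarith
  · intro y hy1 hy2
    have e0 : Real.exp (u * y) = x ^ u * Real.exp (u * (y - Real.log x)) := by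
      rw [← hexp, ← Real.exp_add]; ring_nf
    apply hy₀ y (by linarith)
    · have : Real.exp (u * (y - Real.log x)) ≤ 2 := by
        calc Real.exp (u * (y - Real.log x)) ≤ Real.exp (Real.log 2) := by
              rw [Real.exp_le_exp]; nlinarith
          _ = 2 := Real.exp_log (by norm_num)
      rw [e0]; nlinarith
    · have : 1 ≤ Real.exp (u * (y - Real.log x)) := Real.one_le_exp (mul_nonneg hu.le (by linarith))
      rw [e0]; nlinarith

/-- An additive short-interval estimate for `h ≤ x` propagates to all larger `h`. -/
lemma eventually_abs_sub_sub_le {f : ℝ → ℝ} {lam ε : ℝ} (hlam : lam < 1)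
    (hf : ∀ᶠ x : ℝ in atTop, ∀ h, x ^ lam ≤ h → h ≤ x → |f (x + h) - f x - h| ≤ ε * h) :
    ∀ᶠ x : ℝ in atTop, ∀ h, x ^ lam ≤ h → |f (x + h) - f x - h| ≤ ε * h := by
  obtain ⟨x₀, hx₀⟩ := eventually_atTop.1 hf
  have hpow : ∀ᶠ x : ℝ in atTop, x ^ lam ≤ x / 3 := by
    filter_upwards [(tendsto_rpow_atTop (sub_pos.2 hlam)).eventually (eventually_ge_atTop 3),
      eventually_gt_atTop 0] with x h1 hx
    have : x = x ^ (1 - lam) * x ^ lam := by rw [← Real.rpow_add hx]; simp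
    have h2 : 0 < x ^ lam := by positivity
    nlinarith
  obtain ⟨x₁, hx₁⟩ := eventually_atTop.1 hpow
  filter_upwards [eventually_ge_atTop (max x₀ (max x₁ 1))] with x hx h hh
  simp only [max_le_iff] at hx
  have main : ∀ k : ℕ, ∀ h, x ^ lam ≤ h → h ≤ 2 ^ k * x → |f (x + h) - f x - h| ≤ ε * h := by
    intro k
    induction k with
    | zero => intro h h1 h2; exact hx₀ x hx.1 h h1 (by simpa using h2)
    | succ k ih =>
      intro h h1 h2
      rcases le_total h x with h3 | h3
      · exact hx₀ x hx.1 h h1 h3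
      · have i1 := ih (h / 2) (by linarith [hx₁ x hx.2.1]) (by rw [pow_succ] at h2; linarith)
        have i2 := hx₀ (x + h / 2) (by linarith) (h / 2)
          (by linarith [hx₁ (x + h / 2) (by linarith)]) (by linarith)
        rw [show x + h / 2 + h / 2 = x + h by ring] at i2
        calc |f (x + h) - f x - h|
            = |(f (x + h / 2) - f x - h / 2) + (f (x + h) - f (x + h / 2) - h / 2)| := by ring_nf
          _ ≤ _ := abs_add_le _ _
          _ ≤ ε * h := by linarith
  obtain ⟨k, hk⟩ := pow_unbounded_of_one_lt (h / x) (one_lt_two (α := ℝ))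
  exact main k h hh (by rw [div_lt_iff₀ (by linarith)] at hk; exact hk.le)

end BeurlingSystem

/-- **PNT in short intervals from a Littlewood-type zero-free region**
(Corollary 4.5). If the zeta function of a `θ`-well-behaved Beurling system has no
zeros with `σ > 1 - d log log t / log t`, `t > t₀`, then `ψ(x+h) - ψ(x) ∼ h`
uniformly for `h ≥ c₀ x^λ` whenever `λ > 1 - (1-θ)d/(4d + 9(1-θ))`. -/
theorem beurling_pnt_short_intervals_corollary
    (S : BeurlingSystem) (A θ K₀ : ℝ) (hWB : S.WellBehaved A θ K₀)
    (ζ : ℂ → ℂ) (hζ : S.IsZeta θ ζ)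
    (d t₀ : ℝ) (hd : 0 < d) (ht₀ : Real.exp 2 ≤ t₀)
    (hZeroFree : ∀ ρ : ℂ, θ < ρ.re → ρ ≠ 1 → t₀ < ρ.im →
      1 - d * Real.log (Real.log ρ.im) / Real.log ρ.im < ρ.re → ζ ρ ≠ 0) :
    ∀ lam : ℝ, 1 - (1 - θ) * d / (4 * d + 9 * (1 - θ)) < lam →
      ∀ c₀ : ℝ, 0 < c₀ →
        ∀ ε : ℝ, 0 < ε →
          ∃ x₀ : ℝ, ∀ x h : ℝ, x₀ ≤ x → c₀ * x ^ lam ≤ h →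
            |S.psi (x + h) - S.psi x - h| ≤ ε * h := by
  intro lam hlam c₀ hc₀ ε hε
  have hκ : 0 < 1 - θ := by linarith [hWB.2.2.1]
  have hs0 : 0 < 4 * d + 9 * (1 - θ) := by positivity
  set v := (1 - θ) * d / (4 * d + 9 * (1 - θ)) with hv
  have hv0 : 0 < v := by positivity
  obtain ⟨u, hu1, hu2⟩ : ∃ u, max 0 (1 - lam) < u ∧ u < v :=
    exists_between (max_lt hv0 (by linarith))
  rw [max_lt_iff] at hu1
  obtain ⟨mu, hmu1, hmu2⟩ : ∃ mu, 1 - u < mu ∧ mu < min 1 lam :=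
    exists_between (lt_min (by linarith) (by linarith))
  rw [lt_min_iff] at hmu2
  have hsm : u * (4 * d + 9 * (1 - θ)) < (1 - θ) * d := by rwa [hv, lt_div_iff₀ hs0] at hu2
  have hη : 0 < min (1 / 8) (ε / 40) := by positivity
  have h1 := BeurlingSystem.eventually_abs_sub_sub_le hmu2.1
    (hζ.eventually_abs_psi_sub_sub_le hWB hd hZeroFree hu1.1 hsm hmu1 hη (min_le_left _ _))
  have h2 := (tendsto_rpow_atTop (sub_pos.2 hmu2.2)).eventually (eventually_ge_atTop (1 / c₀))
  obtain ⟨x₀, hx₀⟩ := eventually_atTop.1 ((h1.and h2).and (eventually_gt_atTop 0))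
  refine ⟨x₀, fun x h hx hh => ?_⟩
  obtain ⟨⟨k1, k2⟩, hx0⟩ := hx₀ x hx
  rw [div_le_iff₀ hc₀] at k2
  have hp : 0 < x ^ mu := by positivity
  have k3 : x ^ mu ≤ h := by
    have : x ^ lam = x ^ (lam - mu) * x ^ mu := by rw [← Real.rpow_add hx0]; ring_nf
    rw [this] at hh
    nlinarith
  refine (k1 h k3).trans ?_
  have := min_le_right (1 / 8) (ε / 40)
  gcongr
  · linarith
  · linarith
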